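/- Let ⟨S | R⟩ be a classical C'(1/6) presentation with S finite, and assume the group G is infinite. Then there exists an infinite-order element g ∈ G such that the subgroup ⟨g⟩ is strongly contracting in Cay(G,S). -/

import Mathlib

/- Common definitions: words, classical C'(1/6) presentations, word metrics,
   contraction, Morse property, etc. -/

namespace GSC

open Filter

/-- A word over the alphabet `S`: a list of letters with an exponent `±1`
(`true` = the letter, `false` = its formal inverse). -/
abbrev Word (S : Type) := List (S × Bool)

/-- The formal inverse of a word. -/
def wordInv {S : Type} (w : Word S) : Word S := (w.map fun l => (l.1, !l.2)).reverse

/-- A word is (freely) reduced if no letter is followed by its formal inverse. -/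
def Reduced {S : Type} (w : Word S) : Prop :=
  List.Chain' (fun a b => a.1 ≠ b.1 ∨ a.2 = b.2) w

/-- A word is cyclically reduced if its square is reduced. -/
def CyclicallyReduced {S : Type} (w : Word S) : Prop := Reduced (w ++ w)

/-- A piece with respect to a set of relators `R`: a word occurring as a prefix of
two distinct elements of `R`. -/
def IsPiece {S : Type} (R : Set (Word S)) (p : Word S) : Prop :=
  ∃ r₁ ∈ R, ∃ r₂ ∈ R, r₁ ≠ r₂ ∧ p <+: r₁ ∧ p <+: r₂

/-- Closure of a set of words under inversion and cyclic permutation. -/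
def symmClosure {S : Type} (R : Set (Word S)) : Set (Word S) :=
  {w | ∃ r ∈ R, ∃ n : ℕ, w = r.rotate n ∨ w = wordInv (r.rotate n)}

/-- A classical `C'(1/den)` collection of cyclically reduced words: after closing under
inversion and cyclic permutation, every piece `p` contained in a relator `r` satisfies
`den * |p| < |r|`. -/
def CprimeCollection {S : Type} (den : ℕ) (R : Set (Word S)) : Prop :=
  (∀ r ∈ R, CyclicallyReduced r) ∧
  ∀ r ∈ symmClosure R, ∀ p : Word S, p <+: r → IsPiece (symmClosure R) p →
    den * p.length < r.length

/-- A classical `C'(1/6)` presentation: a set of cyclically reduced relators, closed under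
inversion and cyclic permutation, in which every piece contained in a relator `r` has
length `< |r|/6`. -/
structure C6Presentation (S : Type) where
  rels : Set (Word S)
  cyclically_reduced : ∀ r ∈ rels, CyclicallyReduced r
  inv_mem : ∀ r ∈ rels, wordInv r ∈ rels
  rotate_mem : ∀ r ∈ rels, ∀ n : ℕ, r.rotate n ∈ rels
  small_cancellation : ∀ r ∈ rels, ∀ p : Word S, p <+: r → IsPiece rels p →
    6 * p.length < r.length

/-- The element of the free group represented by a word. -/
def wordVal {S : Type} (w : Word S) : FreeGroup S :=
  (w.map fun l => (FreeGroup.of l.1) ^ (if l.2 then (1 : ℤ) else -1)).prod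

/-- The group defined by a `C'(1/6)` presentation. -/
abbrev C6Presentation.Grp {S : Type} (P : C6Presentation S) : Type :=
  PresentedGroup (wordVal '' P.rels)

/-- The generating set of the presented group (the images of the letters of `S`). -/
def C6Presentation.gens {S : Type} (P : C6Presentation S) : Set P.Grp :=
  Set.range fun a : S => (PresentedGroup.of a : P.Grp)

/-- The element of the presented group represented by a word. -/
def C6Presentation.elt {S : Type} (P : C6Presentation S) (w : Word S) : P.Grp :=
  (w.map fun l => (PresentedGroup.of l.1 : P.Grp) ^ (if l.2 then (1 : ℤ) else -1)).prod

/-- The word length of `g` with respect to a generating set `S ⊆ G`: the least `n`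
such that `g` is a product of `n` elements of `S ∪ S⁻¹`. -/
noncomputable def wordLength {G : Type*} [Group G] (S : Set G) (g : G) : ℕ :=
  sInf {n : ℕ | ∃ l : List G, l.length = n ∧ (∀ x ∈ l, x ∈ S ∨ x⁻¹ ∈ S) ∧ l.prod = g}

/-- The word metric on `G` with respect to `S`, as a real-valued function. -/
noncomputable def wdist {G : Type*} [Group G] (S : Set G) (g h : G) : ℝ :=
  (wordLength S (g⁻¹ * h) : ℝ)

/-- Distance from a point to a subset, in the word metric. -/
noncomputable def setDist {G : Type*} [Group G] (S : Set G) (x : G) (Y : Set G) : ℝ :=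
  sInf (wdist S x '' Y)

/-- Closest point projection to a subset `Y`, in the word metric. -/
def proj {G : Type*} [Group G] (S : Set G) (Y : Set G) (x : G) : Set G :=
  {y ∈ Y | wdist S x y = setDist S x Y}

/-- Diameter of a subset, in the word metric. -/
noncomputable def setDiam {G : Type*} [Group G] (S : Set G) (A : Set G) : ℝ :=
  sSup {d : ℝ | ∃ x ∈ A, ∃ y ∈ A, d = wdist S x y}

/-- Admissibility of a pair of contraction gauges `(ρ₁, ρ₂)`: both non-decreasing and
eventually non-negative, `ρ₁ r ≤ r`, `ρ₁` unbounded, and `ρ₂/ρ₁ → 0` at infinity. -/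
def Admissible (ρ₁ ρ₂ : ℝ → ℝ) : Prop :=
  Monotone ρ₁ ∧ Monotone ρ₂ ∧
  (∀ᶠ r in atTop, 0 ≤ ρ₁ r) ∧ (∀ᶠ r in atTop, 0 ≤ ρ₂ r) ∧
  (∀ r : ℝ, ρ₁ r ≤ r) ∧ (∀ M : ℝ, ∃ r : ℝ, M ≤ ρ₁ r) ∧
  Tendsto (fun r => ρ₂ r / ρ₁ r) atTop (nhds 0)

/-- `Y` is `(ρ₁,ρ₂)`-contracting inside the subspace `X` (with the metric induced by the
word metric of `S`): whenever `x, x' ∈ X` satisfy `d(x,x') ≤ ρ₁(d(x,Y))`, the projections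
`π(x) ∪ π(x')` have diameter at most `ρ₂(d(x,Y))`. -/
def ContractingIn {G : Type*} [Group G] (S : Set G) (X Y : Set G) (ρ₁ ρ₂ : ℝ → ℝ) : Prop :=
  Admissible ρ₁ ρ₂ ∧
  ∀ x ∈ X, ∀ x' ∈ X, wdist S x x' ≤ ρ₁ (setDist S x Y) →
    ∀ y ∈ proj S Y x ∪ proj S Y x', ∀ y' ∈ proj S Y x ∪ proj S Y x',
      wdist S y y' ≤ ρ₂ (setDist S x Y)

/-- `Y` is `(ρ₁,ρ₂)`-contracting in `Cay(G,S)`. -/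
def ContractingWith {G : Type*} [Group G] (S : Set G) (ρ₁ ρ₂ : ℝ → ℝ) (Y : Set G) : Prop :=
  ContractingIn S Set.univ Y ρ₁ ρ₂

/-- `Y` is strongly contracting: `(r, C)`-contracting for some constant `C`. -/
def StronglyContracting {G : Type*} [Group G] (S : Set G) (Y : Set G) : Prop :=
  ∃ C : ℝ, ContractingWith S (fun r => r) (fun _ => C) Y

/-- A sublinear function: non-decreasing, eventually non-negative, `f(r)/r → 0`. -/
def Sublinear (f : ℝ → ℝ) : Prop :=
  Monotone f ∧ (∀ᶠ r in atTop, 0 ≤ f r) ∧ Tendsto (fun r => f r / r) atTop (nhds 0)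

/-- `f ⪯ g`: there are constants `C₁, C₂ > 0` and `C₃, C₄ ≥ 0` with
`f(x) ≤ C₁ g(C₂ x + C₃) + C₄` for all `x`. -/
def Preceq (f g : ℝ → ℝ) : Prop :=
  ∃ C₁ C₂ C₃ C₄ : ℝ, 0 < C₁ ∧ 0 < C₂ ∧ 0 ≤ C₃ ∧ 0 ≤ C₄ ∧
    ∀ x : ℝ, f x ≤ C₁ * g (C₂ * x + C₃) + C₄

/-- `f ≍ g`: `f ⪯ g` and `g ⪯ f`. -/
def Asymp (f g : ℝ → ℝ) : Prop := Preceq f g ∧ Preceq g f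

/-- `α ⊆ G` is a geodesic of `Cay(G,S)`: the image of an isometric embedding of a
subinterval of `ℤ` into `(G, d_S)`. -/
def IsGeodesic {G : Type*} [Group G] (S : Set G) (α : Set G) : Prop :=
  ∃ (I : Set ℤ) (γ : ℤ → G), I.OrdConnected ∧
    (∀ m ∈ I, ∀ n ∈ I, wdist S (γ m) (γ n) = |(m : ℝ) - (n : ℝ)|) ∧ α = γ '' I

/-- `α ⊆ G` is a bi-infinite geodesic of `Cay(G,S)`. -/
def IsBiInfGeodesic {G : Type*} [Group G] (S : Set G) (α : Set G) : Prop :=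
  ∃ γ : ℤ → G, (∀ m n : ℤ, wdist S (γ m) (γ n) = |(m : ℝ) - (n : ℝ)|) ∧ α = Set.range γ

/-- `Y` is Morse: there is `μ` such that every `(L,A)`-quasi-geodesic with endpoints on
`Y` stays in the `μ(L,A)`-neighborhood of `Y`. -/
def IsMorse {G : Type*} [Group G] (S : Set G) (Y : Set G) : Prop :=
  ∃ μ : ℝ → ℝ → ℝ, ∀ L A : ℝ, 1 ≤ L → 0 ≤ A →
    ∀ (q : ℤ → G) (m n : ℤ), m ≤ n → q m ∈ Y → q n ∈ Y →
    (∀ i j : ℤ, m ≤ i → i ≤ n → m ≤ j → j ≤ n →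
      L⁻¹ * |(i : ℝ) - (j : ℝ)| - A ≤ wdist S (q i) (q j) ∧
      wdist S (q i) (q j) ≤ L * |(i : ℝ) - (j : ℝ)| + A) →
    ∀ i : ℤ, m ≤ i → i ≤ n → setDist S (q i) Y ≤ μ L A

/-- Two subsets are at finite Hausdorff distance in the word metric. -/
def FinHausdorffDist {G : Type*} [Group G] (S : Set G) (A B : Set G) : Prop :=
  ∃ ε : ℝ, (∀ a ∈ A, ∃ b ∈ B, wdist S a b ≤ ε) ∧ ∀ b ∈ B, ∃ a ∈ A, wdist S a b ≤ ε

/-- The embedded relator cycle determined by `g ∈ G(Γ)` and a relator `r`: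
the set `{g ⋅ p̄ : p a prefix of r}`. -/
def relatorCycle {S : Type} (P : C6Presentation S) (g : P.Grp) (r : Word S) :
    Set P.Grp :=
  {x | ∃ p : Word S, p <+: r ∧ x = g * P.elt p}

/-- A geodesic `α` is locally `(ρ₁,ρ₂)`-contracting: for every embedded relator cycle
`Γ₀` meeting `α`, the set `Γ₀ ∩ α` is `(ρ₁,ρ₂)`-contracting as a subspace of `Γ₀`. -/
def LocallyContracting {S : Type} (P : C6Presentation S) (α : Set P.Grp)
    (ρ₁ ρ₂ : ℝ → ℝ) : Prop :=
  ∀ (g : P.Grp) (r : Word S), r ∈ P.rels → (relatorCycle P g r ∩ α).Nonempty →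
    ContractingIn P.gens (relatorCycle P g r) (relatorCycle P g r ∩ α) ρ₁ ρ₂

/-- The generating set `S ∪ W` of the coned-off space: `W` is the set of elements
represented by subwords of cyclic permutations of relators (equivalently, by prefixes
of relators, since the relator set is closed under cyclic permutation). -/
def conedGens {S : Type} (P : C6Presentation S) : Set P.Grp :=
  P.gens ∪ {x | ∃ r ∈ P.rels, ∃ p : Word S, p <+: r ∧ x = P.elt p}

/-- The exponential growth rate of `(G,S)`. -/
noncomputable def growthRate {G : Type*} [Group G] (S : Set G) : ℝ :=
  limsup (fun n : ℕ => Real.log (Nat.card {g : G // wordLength S g ≤ n}) / (n : ℝ)) atTop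

/-- Quasi-isometry of marked groups `(G,S)` and `(H,T)` via word metrics. -/
def QIsom {G H : Type*} [Group G] [Group H] (S : Set G) (T : Set H) : Prop :=
  ∃ (f : G → H) (L A : ℝ), 1 ≤ L ∧ 0 ≤ A ∧
    (∀ x y : G, L⁻¹ * wdist S x y - A ≤ wdist T (f x) (f y) ∧
      wdist T (f x) (f y) ≤ L * wdist S x y + A) ∧
    ∀ h : H, ∃ x : G, wdist T (f x) h ≤ A

/-- A subgroup is virtually cyclic if it contains a cyclic subgroup of finite index. -/
def VirtuallyCyclic {G : Type*} [Group G] (E : Subgroup G) : Prop :=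
  ∃ g : G, Subgroup.zpowers g ≤ E ∧ ((Subgroup.zpowers g).subgroupOf E).index ≠ 0

end GSC
namespace GSC

/-- The formal inverse of a letter. -/
def linv {S : Type} (l : S × Bool) : S × Bool := (l.1, !l.2)

section Words

variable {S : Type}

@[simp] theorem linv_linv (l : S × Bool) : linv (linv l) = l := by
  simp [linv]

theorem linv_ne (l : S × Bool) : linv l ≠ l := by
  rcases l with ⟨a, b⟩
  cases b <;> simp [linv]

theorem reduced_rel_iff (a b : S × Bool) : (a.1 ≠ b.1 ∨ a.2 = b.2) ↔ b ≠ linv a := by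
  rcases a with ⟨a, x⟩
  rcases b with ⟨b, y⟩
  cases x <;> cases y <;> simp [linv, eq_comm]

@[simp] theorem wordInv_nil : wordInv ([] : Word S) = [] := rfl

theorem wordInv_append (u v : Word S) : wordInv (u ++ v) = wordInv v ++ wordInv u := by
  simp [wordInv]

theorem wordInv_cons (a : S × Bool) (v : Word S) : wordInv (a :: v) = wordInv v ++ [linv a] := by
  simp [wordInv, linv]

@[simp] theorem wordInv_wordInv (u : Word S) : wordInv (wordInv u) = u := by
  induction u with
  | nil => rfl
  | cons a u ih => rw [wordInv_cons, wordInv_append, ih]; simp [wordInv, linv]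

@[simp] theorem length_wordInv (u : Word S) : (wordInv u).length = u.length := by
  simp [wordInv]

theorem mk_wordInv (u : Word S) : FreeGroup.mk (wordInv u) = (FreeGroup.mk u)⁻¹ := by
  rw [FreeGroup.inv_mk]; rfl

theorem mk_cons (a : S × Bool) (u : Word S) :
    FreeGroup.mk (a :: u) = FreeGroup.mk [a] * FreeGroup.mk u := by
  rw [FreeGroup.mul_mk]; rfl

theorem mk_linv (a : S × Bool) : FreeGroup.mk [linv a] = (FreeGroup.mk [a])⁻¹ := by
  rw [FreeGroup.inv_mk]; rfl

theorem of_zpow_sign (a : S × Bool) :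
    (FreeGroup.of a.1) ^ (if a.2 then (1 : ℤ) else -1) = FreeGroup.mk [a] := by
  rcases a with ⟨a, b⟩
  cases b
  · simp [FreeGroup.of, FreeGroup.inv_mk, FreeGroup.invRev]
  · simp [FreeGroup.of]

theorem wordVal_eq (w : Word S) : wordVal w = FreeGroup.mk w := by
  induction w with
  | nil => rfl
  | cons a w ih =>
    rw [mk_cons, ← ih, ← of_zpow_sign]
    simp [wordVal]

theorem prod_map_mk (w : Word S) : (w.map fun a => FreeGroup.mk [a]).prod = FreeGroup.mk w := by
  induction w with
  | nil => rfl
  | cons a w ih => rw [mk_cons, ← ih]; simp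

variable (P : C6Presentation S)

theorem C6Presentation.elt_eq (w : Word S) :
    P.elt w = PresentedGroup.mk (wordVal '' P.rels) (FreeGroup.mk w) := by
  induction w with
  | nil => simp [C6Presentation.elt, FreeGroup.one_eq_mk.symm]
  | cons a w ih =>
    rw [mk_cons, map_mul, ← ih, ← of_zpow_sign, map_zpow]
    simp only [C6Presentation.elt, List.map_cons, List.prod_cons]
    rfl

@[simp] theorem C6Presentation.elt_nil : P.elt [] = 1 := by
  simp [C6Presentation.elt]

theorem C6Presentation.elt_append (u v : Word S) : P.elt (u ++ v) = P.elt u * P.elt v := by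
  simp [C6Presentation.elt]

theorem C6Presentation.elt_cons (a : S × Bool) (v : Word S) :
    P.elt (a :: v) = P.elt [a] * P.elt v := by
  rw [← P.elt_append]; rfl

theorem C6Presentation.elt_wordInv (u : Word S) : P.elt (wordInv u) = (P.elt u)⁻¹ := by
  rw [P.elt_eq, P.elt_eq, mk_wordInv, map_inv]

theorem C6Presentation.elt_linv (a : S × Bool) : P.elt [linv a] = (P.elt [a])⁻¹ := by
  rw [P.elt_eq, P.elt_eq, mk_linv, map_inv]

theorem C6Presentation.elt_surjective (g : P.Grp) : ∃ w : Word S, P.elt w = g := by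
  obtain ⟨x, rfl⟩ := PresentedGroup.mk_surjective _ g
  classical exact ⟨x.toWord, by rw [P.elt_eq, FreeGroup.mk_toWord]⟩

theorem C6Presentation.elt_rel {r : Word S} (hr : r ∈ P.rels) : P.elt r = 1 := by
  rw [P.elt_eq, ← wordVal_eq]
  exact PresentedGroup.mk_eq_one_iff.2 (Subgroup.subset_normalClosure ⟨r, hr, rfl⟩)

/-- `x` is a product of `n` conjugates of nonempty relators. -/
def C6Presentation.Area : ℕ → FreeGroup S → Prop
  | 0, x => x = 1
  | n + 1, x => ∃ g y : FreeGroup S, ∃ r ∈ P.rels, r ≠ [] ∧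
      C6Presentation.Area n y ∧ x = g * FreeGroup.mk r * g⁻¹ * y

theorem C6Presentation.Area.mul {m n : ℕ} {x y : FreeGroup S} (hx : P.Area m x)
    (hy : P.Area n y) : P.Area (m + n) (x * y) := by
  induction m generalizing x with
  | zero => cases hx; simpa using hy
  | succ m ih =>
    obtain ⟨g, z, r, hr, hr0, hz, rfl⟩ := hx
    rw [show m + 1 + n = (m + n) + 1 by omega]
    exact ⟨g, z * y, r, hr, hr0, ih hz, by group⟩

theorem C6Presentation.Area.conj {m : ℕ} {x : FreeGroup S} (hx : P.Area m x)
    (g : FreeGroup S) : P.Area m (g * x * g⁻¹) := by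
  induction m generalizing x with
  | zero => cases hx; simp [C6Presentation.Area]
  | succ m ih =>
    obtain ⟨k, z, r, hr, hr0, hz, rfl⟩ := hx
    exact ⟨g * k, g * z * g⁻¹, r, hr, hr0, ih hz, by group⟩

theorem C6Presentation.area_rel {r : Word S} (hr : r ∈ P.rels) (h0 : r ≠ []) :
    P.Area 1 (FreeGroup.mk r) :=
  ⟨1, 1, r, hr, h0, rfl, by simp⟩

theorem C6Presentation.Area.inv {m : ℕ} {x : FreeGroup S} (hx : P.Area m x) :
    P.Area m x⁻¹ := by
  induction m generalizing x with
  | zero => cases hx; simp [C6Presentation.Area]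
  | succ m ih =>
    obtain ⟨g, z, r, hr, hr0, hz, rfl⟩ := hx
    have h := (ih hz).mul P ((P.area_rel (P.inv_mem r hr) (r := wordInv r)
      (by simpa [wordInv] using hr0)).conj P g)
    convert h using 1
    rw [mk_wordInv]; group

theorem C6Presentation.exists_area {w : Word S} (h : P.elt w = 1) :
    ∃ n, P.Area n (FreeGroup.mk w) := by
  rw [P.elt_eq, PresentedGroup.mk_eq_one_iff] at h
  let N : Subgroup (FreeGroup S) :=
    { carrier := {x | ∃ n, P.Area n x}
      mul_mem' := by rintro a b ⟨m, hm⟩ ⟨n, hn⟩; exact ⟨_, hm.mul P hn⟩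
      one_mem' := ⟨0, rfl⟩
      inv_mem' := by rintro a ⟨m, hm⟩; exact ⟨_, hm.inv P⟩ }
  have : N.Normal := ⟨by rintro a ⟨m, hm⟩ g; exact ⟨_, hm.conj P g⟩⟩
  refine Subgroup.normalClosure_le_normal (N := N) ?_ h
  rintro _ ⟨r, hr, rfl⟩
  rw [wordVal_eq]
  rcases eq_or_ne r [] with rfl | h0
  · exact ⟨0, rfl⟩
  · exact ⟨1, P.area_rel hr h0⟩

/-- `f` is the bi-infinite-to-the-right periodic reading of a relator of length `n`. -/
def C6Presentation.IsRel (n : ℕ) (f : ℕ → S × Bool) : Prop :=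
  1 ≤ n ∧ (List.range n).map f ∈ P.rels ∧ ∀ t, f (t + n) = f t

variable {P}

theorem C6Presentation.IsRel.mod {n : ℕ} {f : ℕ → S × Bool} (h : P.IsRel n f) (t : ℕ) :
    f (t % n) = f t := by
  have := Function.Periodic.map_mod_nat (f := f) (a := n) h.2.2 t
  exact this

theorem map_range_shift {n : ℕ} {f : ℕ → S × Bool} (h : ∀ t, f (t + n) = f t) (c : ℕ)
    : (List.range n).map (fun t => f (c + t)) = ((List.range n).map f).rotate c := by
  rcases Nat.eq_zero_or_pos n with rfl | hn
  · simp
  have hm : ∀ t, f (t % n) = f t := fun t => Function.Periodic.map_mod_nat (f := f) (a := n) h t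
  apply List.ext_getElem
  · simp
  · intro i h1 h2
    rw [List.getElem_rotate]
    simp [hm, add_comm]

theorem C6Presentation.IsRel.shift {n : ℕ} {f : ℕ → S × Bool} (h : P.IsRel n f) (c : ℕ) :
    P.IsRel n (fun t => f (c + t)) := by
  refine ⟨h.1, ?_, fun t => ?_⟩
  · rw [map_range_shift h.2.2]; exact P.rotate_mem _ h.2.1 c
  · simp only [← add_assoc, h.2.2]

theorem C6Presentation.isRel_of_mem {r : Word S} (hr : r ∈ P.rels) (h0 : r ≠ []) (d : S × Bool) :
    P.IsRel r.length (fun t => r.getD (t % r.length) d) := by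
  have hl : 0 < r.length := List.length_pos_of_ne_nil h0
  refine ⟨hl, ?_, fun t => by simp⟩
  convert hr
  apply List.ext_getElem
  · simp
  · intro i h1 h2
    simp [Nat.mod_eq_of_lt h2, h2]

theorem C6Presentation.IsRel.heavy {n n' m : ℕ} {f f' : ℕ → S × Bool} (h : P.IsRel n f)
    (h' : P.IsRel n' f') (hm : m ≤ n) (hm' : m ≤ n') (h6 : n ≤ 6 * m)
    (heq : ∀ t < m, f t = f' t) : n = n' ∧ f = f' := by
  by_cases hr : (List.range n).map f = (List.range n').map f'
  · have hn : n = n' := by simpa using congrArg List.length hr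
    subst hn
    refine ⟨rfl, funext fun t => ?_⟩
    rw [← h.mod, ← h'.mod]
    have hl : t % n < n := Nat.mod_lt _ h.1
    exact List.map_inj_left.1 hr _ (List.mem_range.2 hl)
  · exfalso
    have hp : ∀ (k : ℕ) (g : ℕ → S × Bool), m ≤ k →
        (List.range m).map g <+: (List.range k).map g := by
      intro k g hk
      obtain ⟨j, rfl⟩ := Nat.exists_eq_add_of_le hk
      rw [List.range_add, List.map_append]
      exact List.prefix_append _ _
    have h1 := P.small_cancellation _ h.2.1 ((List.range m).map f) (hp n f hm)
      ⟨_, h.2.1, _, h'.2.1, hr, hp n f hm, by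
        rw [show (List.range m).map f = (List.range m).map f' from
          List.map_congr_left fun t ht => heq t (List.mem_range.1 ht)]
        exact hp n' f' hm'⟩
    simp at h1
    omega

/-- Aligned version of `heavy` at arbitrary offsets. -/
theorem C6Presentation.IsRel.heavy_at {n n' m a b : ℕ} {f f' : ℕ → S × Bool} (h : P.IsRel n f)
    (h' : P.IsRel n' f') (hm : m ≤ n) (hm' : m ≤ n') (h6 : n ≤ 6 * m)
    (heq : ∀ t < m, f (a + t) = f' (b + t)) : n = n' ∧ ∀ t, f (a + t) = f' (b + t) := by
  have := (h.shift a).heavy (h'.shift b) hm hm' h6 heq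
  exact ⟨this.1, fun t => congrFun this.2 t⟩

theorem C6Presentation.IsRel.succ_ne {n : ℕ} {f : ℕ → S × Bool} (h : P.IsRel n f) (t : ℕ) :
    f (t + 1) ≠ linv (f t) := by
  have h1 := P.cyclically_reduced _ (h.shift t).2.1
  obtain ⟨k, hk⟩ : ∃ k, n = k + 1 := ⟨n - 1, by have := h.1; omega⟩
  have hp : [f t, f (t + 1)] <+: (List.range n).map (fun s => f (t + s)) ++
      (List.range n).map (fun s => f (t + s)) := by
    rw [hk, List.range_succ_eq_map, List.map_cons, List.cons_append]
    rcases k with _ | k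
    · have := h.2.2 t
      rw [hk] at this
      simp [this]
    · rw [List.range_succ_eq_map]
      simp [List.cons_prefix_cons]
  obtain ⟨v, hv⟩ := hp
  rw [CyclicallyReduced, Reduced, ← hv] at h1
  have h2 := (List.isChain_append.1 h1).1
  simp only [List.isChain_cons_cons] at h2
  exact (reduced_rel_iff _ _).1 h2.1

/-- The reading of the inverse relator. -/
theorem C6Presentation.IsRel.inv {n : ℕ} {f : ℕ → S × Bool} (h : P.IsRel n f) :
    P.IsRel n (fun t => linv (f (n - 1 - t % n))) := by
  refine ⟨h.1, ?_, fun t => by simp⟩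
  convert P.inv_mem _ h.2.1
  apply List.ext_getElem
  · simp
  · intro i h1 h2
    have : i < n := by simpa using h1
    simp [wordInv, Nat.mod_eq_of_lt this, linv]

end Words
end GSC

namespace GSC

/-- Combinatorial data of a (spherical) diagram: darts and vertices are natural numbers. -/
structure PreDiagram {S : Type} (P : C6Presentation S) where
  flip : ℕ → ℕ
  lab : ℕ → S × Bool
  vert : ℕ → ℕ
  pos : ℕ → P.Grp
  base : ℕ
  outer : List ℕ
  inner : List (List ℕ)

/-- `x` is a product of conjugates of the inverses of the entries of the list. -/
def ConjProd {G : Type*} [Group G] : List G → G → Prop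
  | [], x => x = 1
  | c :: l, x => ∃ g y, ConjProd l y ∧ x = g * c⁻¹ * g⁻¹ * y

namespace PreDiagram

variable {S : Type} {P : C6Presentation S}

/-- All darts of a diagram. -/
def darts (D : PreDiagram P) : List ℕ := D.outer ++ D.inner.flatten

/-- `l` is a path of darts from the vertex `v` to the vertex `w`. -/
def IsPath (D : PreDiagram P) : ℕ → List ℕ → ℕ → Prop
  | v, [], w => v = w
  | v, d :: l, w => D.vert d = v ∧ IsPath D (D.vert (D.flip d)) l w

/-- All vertices of a diagram. -/
def verts (D : PreDiagram P) : Finset ℕ := insert D.base (D.darts.map D.vert).toFinset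

/-- The well-formedness conditions of a diagram, including the Euler inequality and the
filling property: the outer boundary is a product of conjugates of the inner boundaries in
every labelling by a free group. -/
structure Valid (D : PreDiagram P) : Prop where
  nodup : D.darts.Nodup
  flip_mem : ∀ d ∈ D.darts, D.flip d ∈ D.darts
  flip_flip : ∀ d ∈ D.darts, D.flip (D.flip d) = d
  flip_ne : ∀ d ∈ D.darts, D.flip d ≠ d
  lab_flip : ∀ d ∈ D.darts, D.lab (D.flip d) = linv (D.lab d)
  pos_flip : ∀ d ∈ D.darts, D.pos (D.vert (D.flip d)) = D.pos (D.vert d) * P.elt [D.lab d]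
  outer_path : D.IsPath D.base D.outer D.base
  inner_path : ∀ c ∈ D.inner, ∃ v, D.IsPath v c v
  inner_ne : ∀ c ∈ D.inner, c ≠ []
  inner_rel : ∀ c ∈ D.inner, c.map D.lab ∈ P.rels
  euler : D.darts.length + 4 ≤ 2 * D.verts.card + 2 * (D.inner.length + 1)
  fill : ∀ h : ℕ → FreeGroup S, (∀ d ∈ D.darts, h (D.flip d) = (h d)⁻¹) →
    ConjProd (D.inner.map fun c => (c.map h).prod) (D.outer.map h).prod

theorem isPath_append {D : PreDiagram P} {v w : ℕ} {l m : List ℕ} :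
    D.IsPath v (l ++ m) w ↔ ∃ u, D.IsPath v l u ∧ D.IsPath u m w := by
  induction l generalizing v with
  | nil => simp [IsPath]
  | cons d l ih => simp [IsPath, ih, and_assoc]

theorem IsPath.map {D D' : PreDiagram P} (ρ : ℕ → ℕ) {v w : ℕ} {l : List ℕ}
    (h : D.IsPath v l w) (h1 : ∀ d ∈ l, D'.vert d = ρ (D.vert d))
    (h2 : ∀ d ∈ l, D'.vert (D'.flip d) = ρ (D.vert (D.flip d))) :
    D'.IsPath (ρ v) l (ρ w) := by
  induction l generalizing v with
  | nil => simp only [IsPath] at h ⊢; rw [h]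
  | cons d l ih =>
    simp only [IsPath] at h ⊢
    refine ⟨by rw [h1 d (by simp), h.1], ?_⟩
    rw [h2 d (by simp)]
    exact ih h.2 (fun d hd => h1 d (by simp [hd])) (fun d hd => h2 d (by simp [hd]))

theorem Valid.pos_path {D : PreDiagram P} (hD : D.Valid) {l : List ℕ} {u z : ℕ}
    (hd : ∀ d ∈ l, d ∈ D.darts) (hl : D.IsPath u l z) :
    D.pos z = D.pos u * P.elt (l.map D.lab) := by
  induction l generalizing u with
  | nil => simp only [IsPath] at hl; simp [hl]
  | cons d l ih =>
    simp only [IsPath] at hl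
    rw [ih (fun e he => hd e (by simp [he])) hl.2, hD.pos_flip d (hd d (by simp)), hl.1,
      List.map_cons, P.elt_cons (D.lab d) (l.map D.lab), mul_assoc]

/-- `B` bounds a valid diagram with `n` inner faces. -/
def _root_.GSC.HasDiagram (P : C6Presentation S) (B : Word S) (n : ℕ) : Prop :=
  ∃ D : PreDiagram P, D.Valid ∧ D.outer.map D.lab = B ∧ D.inner.length = n

theorem hasDiagram_nil [Inhabited S] : HasDiagram P [] 0 :=
  ⟨{ flip := id, lab := fun _ => default, vert := id, pos := fun _ => 1, base := 0,
     outer := [], inner := [] },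
   { nodup := by simp [darts]
     flip_mem := by simp [darts]
     flip_flip := by simp [darts]
     flip_ne := by simp [darts]
     lab_flip := by simp [darts]
     pos_flip := by simp [darts]
     outer_path := by simp [IsPath]
     inner_path := by simp
     inner_ne := by simp
     inner_rel := by simp
     euler := by simp [darts, verts]
     fill := by simp [ConjProd] }, by simp, by simp⟩

theorem exists_fresh (l : List ℕ) : ∃ N, ∀ d ∈ l, d < N :=
  ⟨l.toFinset.sup id + 1, fun _ hd =>
    Nat.lt_succ_of_le (Finset.le_sup (f := id) (List.mem_toFinset.2 hd))⟩

theorem hasDiagram_insert {A C : Word S} {x : S × Bool} {n : ℕ}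
    (h : HasDiagram P (A ++ C) n) : HasDiagram P (A ++ x :: linv x :: C) n := by
  obtain ⟨D, hD, hB, hn⟩ := h
  obtain ⟨A', C', hAC, rfl, rfl⟩ := List.map_eq_append_iff.1 hB
  obtain ⟨N, hN⟩ := exists_fresh D.darts
  obtain ⟨M, hM⟩ := exists_fresh (D.base :: D.darts.map D.vert)
  have hp := hD.outer_path
  rw [hAC, isPath_append] at hp
  obtain ⟨v, hv1, hv2⟩ := hp
  have hvM : v < M := by
    cases C' with
    | nil =>
      simp only [IsPath] at hv2
      exact hM _ (by simp [hv2])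
    | cons c C' =>
      simp only [IsPath] at hv2
      refine hM _ ?_
      rw [← hv2.1]
      simp [darts, hAC]
  let D' : PreDiagram P :=
    { flip := fun d => if d = N then N + 1 else if d = N + 1 then N else D.flip d
      lab := fun d => if d = N then x else if d = N + 1 then linv x else D.lab d
      vert := fun d => if d = N then v else if d = N + 1 then M else D.vert d
      pos := fun u => if u = M then D.pos v * P.elt [x] else D.pos u
      base := D.base
      outer := A' ++ N :: (N + 1) :: C'
      inner := D.inner }
  have hmem : ∀ d, d ∈ D'.darts ↔ d = N ∨ d = N + 1 ∨ d ∈ D.darts := by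
    intro d
    simp only [darts, hAC, D', List.mem_append, List.mem_cons]
    tauto
  have hperm : D'.darts.Perm (N :: (N + 1) :: D.darts) := by
    simp only [darts, hAC, D', List.append_assoc, List.cons_append]
    refine List.perm_middle.trans ?_
    exact List.Perm.cons _ List.perm_middle
  have hlt : ∀ d ∈ D.darts, d ≠ N ∧ d ≠ N + 1 := fun d hd => by
    have := hN d hd
    omega
  have hfl : ∀ d ∈ D.darts, D'.flip d = D.flip d := fun d hd => by
    simp [D', hlt d hd]
  have hla : ∀ d ∈ D.darts, D'.lab d = D.lab d := fun d hd => by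
    simp [D', hlt d hd]
  have hve : ∀ d ∈ D.darts, D'.vert d = D.vert d := fun d hd => by
    simp [D', hlt d hd]
  have hpo : ∀ d ∈ D.darts, D'.pos (D.vert d) = D.pos (D.vert d) := fun d hd => by
    have := hM (D.vert d) (by simp; exact Or.inr ⟨d, hd, rfl⟩)
    simp [D', this.ne]
  have hpv : D'.pos v = D.pos v := by simp [D', hvM.ne]
  have hfN : D'.flip N = N + 1 := by simp [D']
  have hfN1 : D'.flip (N + 1) = N := by simp [D']
  have hout : ∀ d ∈ D.outer, d ∈ D.darts := fun d hd => by simp [darts, hd]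
  have hinn : ∀ c ∈ D.inner, ∀ d ∈ c, d ∈ D.darts := fun c hc d hd => by
    simp only [darts, List.mem_append, List.mem_flatten]
    exact Or.inr ⟨c, hc, hd⟩
  have hpath : ∀ (l : List ℕ) (u w : ℕ), (∀ d ∈ l, d ∈ D.darts) → D.IsPath u l w →
      D'.IsPath u l w := fun l u w hl hlp =>
    hlp.map (D' := D') id (fun d hd => hve d (hl d hd)) (fun d hd => by
      rw [hfl d (hl d hd), hve _ (hD.flip_mem d (hl d hd))]; rfl)
  have hlen := hperm.length_eq
  simp only [List.length_cons] at hlen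
  refine ⟨D', ⟨?_, ?_, ?_, ?_, ?_, ?_, ?_, ?_, hD.inner_ne, ?_, ?_, ?_⟩, ?_, hn⟩
  · rw [hperm.nodup_iff]
    simp only [List.nodup_cons, List.mem_cons, not_or]
    exact ⟨⟨by omega, fun h => absurd rfl (hlt _ h).1⟩, fun h => absurd rfl (hlt _ h).2, hD.nodup⟩
  · intro d hd
    rcases (hmem d).1 hd with rfl | rfl | hd
    · rw [hfN, hmem]; simp
    · rw [hfN1, hmem]; simp
    · rw [hfl d hd, hmem]; exact Or.inr (Or.inr (hD.flip_mem d hd))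
  · intro d hd
    rcases (hmem d).1 hd with rfl | rfl | hd
    · rw [hfN, hfN1]
    · rw [hfN1, hfN]
    · rw [hfl d hd, hfl _ (hD.flip_mem d hd), hD.flip_flip d hd]
  · intro d hd
    rcases (hmem d).1 hd with rfl | rfl | hd
    · rw [hfN]; omega
    · rw [hfN1]; omega
    · rw [hfl d hd]; exact hD.flip_ne d hd
  · intro d hd
    rcases (hmem d).1 hd with rfl | rfl | hd
    · rw [hfN]; simp [D']
    · rw [hfN1]; simp [D']
    · rw [hfl d hd, hla _ (hD.flip_mem d hd), hla d hd, hD.lab_flip d hd]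
  · intro d hd
    rcases (hmem d).1 hd with rfl | rfl | hd
    · rw [hfN]; simp [D', hvM.ne]
    · rw [hfN1]
      simp [D', hvM.ne, P.elt_linv]
    · rw [hfl d hd, hve _ (hD.flip_mem d hd), hve d hd, hla d hd, hpo _ (hD.flip_mem d hd),
        hpo d hd, hD.pos_flip d hd]
  · change D'.IsPath D.base (A' ++ N :: (N + 1) :: C') D.base
    rw [isPath_append]
    refine ⟨v, hpath _ _ _ (fun d hd => hout d (by simp [hAC, hd])) hv1, ?_⟩
    simp only [IsPath]
    refine ⟨by simp [D'], by rw [hfN], ?_⟩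
    rw [hfN1, show D'.vert N = v by simp [D']]
    exact hpath _ _ _ (fun d hd => hout d (by simp [hAC, hd])) hv2
  · intro c hc
    obtain ⟨u, hu⟩ := hD.inner_path c hc
    exact ⟨u, hpath _ _ _ (hinn c hc) hu⟩
  · intro c hc
    rw [List.map_congr_left fun d hd => hla d (hinn c hc d hd)]
    exact hD.inner_rel c hc
  · have h1 : insert M D.verts ⊆ D'.verts := by
      intro u hu
      simp only [verts, Finset.mem_insert, List.mem_toFinset, List.mem_map] at hu ⊢
      rcases hu with rfl | hu | ⟨d, hd, rfl⟩
      · exact Or.inr ⟨N + 1, by simp [hmem], by simp [D']⟩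
      · exact Or.inl hu
      · exact Or.inr ⟨d, by simp [hmem, hd], hve d hd⟩
    have h2 : M ∉ D.verts := fun hm => by
      have := hM M (by simpa [verts] using hm)
      omega
    have h3 := Finset.card_le_card h1
    rw [Finset.card_insert_of_notMem h2] at h3
    have := hD.euler
    change D'.darts.length + 4 ≤ 2 * D'.verts.card + 2 * (D.inner.length + 1)
    omega
  · intro h hh
    have h1 := hD.fill h (fun d hd => by rw [← hfl d hd]; exact hh d ((hmem d).2 (by simp [hd])))
    have h2 := hh N (by simp [hmem])
    rw [hfN] at h2
    simpa [D', hAC, h2] using h1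
  · simp only [D', List.map_append, List.map_cons, if_true]
    rw [List.map_congr_left fun d hd => hla d (hout d (by simp [hAC, hd])),
      List.map_congr_left fun d hd => hla d (hout d (by simp [hAC, hd]))]
    simp

theorem hasDiagram_edge {A C : Word S} {x : S × Bool} {t : Word S} {n : ℕ}
    (hr : x :: t ∈ P.rels)
    (h : HasDiagram P (A ++ (wordInv t ++ C)) n) : HasDiagram P (A ++ x :: C) (n + 1) := by
  obtain ⟨D, hD, hB, hn⟩ := h
  obtain ⟨A', TC, hAC, rfl, hTC⟩ := List.map_eq_append_iff.1 hB
  obtain ⟨T, C', rfl, hT, rfl⟩ := List.map_eq_append_iff.1 hTC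
  obtain ⟨N, hN⟩ := exists_fresh D.darts
  have hp := hD.outer_path
  rw [hAC, isPath_append] at hp
  obtain ⟨v, hv1, hv2⟩ := hp
  rw [isPath_append] at hv2
  obtain ⟨w, hv2, hv3⟩ := hv2
  let D' : PreDiagram P :=
    { flip := fun d => if d = N then N + 1 else if d = N + 1 then N else D.flip d
      lab := fun d => if d = N then x else if d = N + 1 then linv x else D.lab d
      vert := fun d => if d = N then v else if d = N + 1 then w else D.vert d
      pos := D.pos
      base := D.base
      outer := A' ++ N :: C'
      inner := (T ++ [N + 1]) :: D.inner }
  have hperm : D'.darts.Perm (N :: (N + 1) :: D.darts) := by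
    simp only [darts, hAC, D', List.append_assoc, List.cons_append, List.flatten_cons,
      List.nil_append]
    refine List.perm_middle.trans (List.Perm.cons _ ?_)
    have : A' ++ (C' ++ (T ++ (N + 1) :: D.inner.flatten)) =
      (A' ++ (C' ++ T)) ++ (N + 1) :: D.inner.flatten := by simp
    rw [this]
    refine List.perm_middle.trans (List.Perm.cons _ ?_)
    simp only [List.append_assoc]
    refine List.Perm.append_left _ ?_
    rw [← List.append_assoc, ← List.append_assoc]
    exact List.Perm.append_right _ List.perm_append_comm
  have hmem : ∀ d, d ∈ D'.darts ↔ d = N ∨ d = N + 1 ∨ d ∈ D.darts := by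
    intro d
    rw [hperm.mem_iff]; simp
  have hlt : ∀ d ∈ D.darts, d ≠ N ∧ d ≠ N + 1 := fun d hd => by
    have := hN d hd
    omega
  have hfl : ∀ d ∈ D.darts, D'.flip d = D.flip d := fun d hd => by
    simp [D', hlt d hd]
  have hla : ∀ d ∈ D.darts, D'.lab d = D.lab d := fun d hd => by
    simp [D', hlt d hd]
  have hve : ∀ d ∈ D.darts, D'.vert d = D.vert d := fun d hd => by
    simp [D', hlt d hd]
  have hfN : D'.flip N = N + 1 := by simp [D']
  have hfN1 : D'.flip (N + 1) = N := by simp [D']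
  have hout : ∀ d ∈ D.outer, d ∈ D.darts := fun d hd => by simp [darts, hd]
  have hinn : ∀ c ∈ D.inner, ∀ d ∈ c, d ∈ D.darts := fun c hc d hd => by
    simp only [darts, List.mem_append, List.mem_flatten]
    exact Or.inr ⟨c, hc, hd⟩
  have hpath : ∀ (l : List ℕ) (u w : ℕ), (∀ d ∈ l, d ∈ D.darts) → D.IsPath u l w →
      D'.IsPath u l w := fun l u w hl hlp =>
    hlp.map (D' := D') id (fun d hd => hve d (hl d hd)) (fun d hd => by
      rw [hfl d (hl d hd), hve _ (hD.flip_mem d (hl d hd))]; rfl)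
  have hTd : ∀ d ∈ T, d ∈ D.darts := fun d hd => hout d (by simp [hAC, hd])
  have hposw : D.pos w = D.pos v * P.elt [x] := by
    rw [hD.pos_path hTd hv2, hT, P.elt_wordInv]
    have := P.elt_rel hr
    rw [P.elt_cons] at this
    rw [eq_inv_of_mul_eq_one_left this]
  have hlen := hperm.length_eq
  simp only [List.length_cons] at hlen
  refine ⟨D', ⟨?_, ?_, ?_, ?_, ?_, ?_, ?_, ?_, ?_, ?_, ?_, ?_⟩, ?_, by simp [D', hn]⟩
  · rw [hperm.nodup_iff]
    simp only [List.nodup_cons, List.mem_cons, not_or]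
    exact ⟨⟨by omega, fun h => absurd rfl (hlt _ h).1⟩, fun h => absurd rfl (hlt _ h).2, hD.nodup⟩
  · intro d hd
    rcases (hmem d).1 hd with rfl | rfl | hd
    · rw [hfN, hmem]; simp
    · rw [hfN1, hmem]; simp
    · rw [hfl d hd, hmem]; exact Or.inr (Or.inr (hD.flip_mem d hd))
  · intro d hd
    rcases (hmem d).1 hd with rfl | rfl | hd
    · rw [hfN, hfN1]
    · rw [hfN1, hfN]
    · rw [hfl d hd, hfl _ (hD.flip_mem d hd), hD.flip_flip d hd]
  · intro d hd
    rcases (hmem d).1 hd with rfl | rfl | hd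
    · rw [hfN]; omega
    · rw [hfN1]; omega
    · rw [hfl d hd]; exact hD.flip_ne d hd
  · intro d hd
    rcases (hmem d).1 hd with rfl | rfl | hd
    · rw [hfN]; simp [D']
    · rw [hfN1]; simp [D']
    · rw [hfl d hd, hla _ (hD.flip_mem d hd), hla d hd, hD.lab_flip d hd]
  · intro d hd
    rcases (hmem d).1 hd with rfl | rfl | hd
    · rw [hfN]; simp [D', hposw]
    · rw [hfN1]
      simp [D', hposw, P.elt_linv]
    · rw [hfl d hd, hve _ (hD.flip_mem d hd), hve d hd, hla d hd]
      exact hD.pos_flip d hd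
  · change D'.IsPath D.base (A' ++ N :: C') D.base
    rw [isPath_append]
    refine ⟨v, hpath _ _ _ (fun d hd => hout d (by simp [hAC, hd])) hv1, ?_⟩
    simp only [IsPath]
    refine ⟨by simp [D'], ?_⟩
    rw [hfN, show D'.vert (N + 1) = w by simp [D']]
    exact hpath _ _ _ (fun d hd => hout d (by simp [hAC, hd])) hv3
  · intro c hc
    rcases List.mem_cons.1 hc with rfl | hc
    · refine ⟨v, isPath_append.2 ⟨w, hpath _ _ _ hTd hv2, ?_⟩⟩
      simp only [IsPath]
      rw [hfN1]
      simp [D']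
    · obtain ⟨u, hu⟩ := hD.inner_path c hc
      exact ⟨u, hpath _ _ _ (hinn c hc) hu⟩
  · intro c hc
    rcases List.mem_cons.1 hc with rfl | hc
    · simp
    · exact hD.inner_ne c hc
  · intro c hc
    rcases List.mem_cons.1 hc with rfl | hc
    · rw [List.map_append, List.map_congr_left fun d hd => hla d (hTd d hd), hT]
      have := P.inv_mem _ hr
      rw [wordInv_cons] at this
      simpa [D'] using this
    · rw [List.map_congr_left fun d hd => hla d (hinn c hc d hd)]
      exact hD.inner_rel c hc
  · have h1 : D.verts ⊆ D'.verts := by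
      intro u hu
      simp only [verts, Finset.mem_insert, List.mem_toFinset, List.mem_map] at hu ⊢
      rcases hu with hu | ⟨d, hd, rfl⟩
      · exact Or.inl hu
      · exact Or.inr ⟨d, by simp [hmem, hd], hve d hd⟩
    have h3 := Finset.card_le_card h1
    have := hD.euler
    change D'.darts.length + 4 ≤ 2 * D'.verts.card + 2 * (D.inner.length + 1 + 1)
    omega
  · intro h hh
    have h1 := hD.fill h (fun d hd => by rw [← hfl d hd]; exact hh d ((hmem d).2 (by simp [hd])))
    have h2 := hh N (by simp [hmem])
    rw [hfN] at h2
    refine ⟨(A'.map h).prod, (D.outer.map h).prod, h1, ?_⟩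
    simp only [D', hAC, List.map_append, List.map_cons, List.map_nil, List.prod_append,
      List.prod_cons, List.prod_nil, h2]
    group
  · simp only [D', List.map_append, List.map_cons, if_true]
    rw [List.map_congr_left fun d hd => hla d (hout d (by simp [hAC, hd])),
      List.map_congr_left fun d hd => hla d (hout d (by simp [hAC, hd]))]

end PreDiagram
end GSC

namespace GSC
namespace PreDiagram
variable {S : Type} {P : C6Presentation S}

theorem hasDiagram_fold {A C : Word S} {x : S × Bool} {n : ℕ}
    (h : HasDiagram P (A ++ x :: linv x :: C) n) : HasDiagram P (A ++ C) n := by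
  obtain ⟨D, hD, hB, hn⟩ := h
  obtain ⟨A', XC, hAC, rfl, hXC⟩ := List.map_eq_append_iff.1 hB
  obtain ⟨d1, YC, rfl, rfl, hYC⟩ := List.map_eq_cons_iff.1 hXC
  obtain ⟨d2, C', rfl, h12, rfl⟩ := List.map_eq_cons_iff.1 hYC
  have hperm : D.darts.Perm (d1 :: d2 :: (A' ++ C' ++ D.inner.flatten)) := by
    simp only [darts, hAC, List.append_assoc, List.cons_append]
    exact List.perm_middle.trans (List.Perm.cons _ List.perm_middle)
  have hnd := hperm.nodup_iff.1 hD.nodup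
  have hmem : ∀ d, d ∈ D.darts ↔ d = d1 ∨ d = d2 ∨ d ∈ A' ++ C' ++ D.inner.flatten := by
    intro d
    rw [hperm.mem_iff]; simp
  generalize hE : A' ++ C' ++ D.inner.flatten = E at *
  simp only [List.nodup_cons, List.mem_cons, not_or] at hnd
  have hd1 : d1 ∈ D.darts := (hmem _).2 (by simp)
  have hd2 : d2 ∈ D.darts := (hmem _).2 (by simp)
  have hEd : ∀ d ∈ E, d ∈ D.darts := fun d hd => (hmem d).2 (by simp [hd])
  have hEne : ∀ d ∈ E, d ≠ d1 ∧ d ≠ d2 := fun d hd =>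
    ⟨fun h => hnd.1.2 (h ▸ hd), fun h => hnd.2.1 (h ▸ hd)⟩
  have hp := hD.outer_path
  rw [hAC, isPath_append] at hp
  obtain ⟨s, hs1, hs2⟩ := hp
  simp only [IsPath] at hs2
  obtain ⟨hs, hm, hs3⟩ := hs2
  have hAE : ∀ d ∈ A', d ∈ E := fun d hd => by rw [← hE]; simp [hd]
  have hCE : ∀ d ∈ C', d ∈ E := fun d hd => by rw [← hE]; simp [hd]
  have hIE : ∀ c ∈ D.inner, ∀ d ∈ c, d ∈ E := fun c hc d hd => by
    rw [← hE]
    simp only [List.mem_append, List.mem_flatten]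
    exact Or.inr ⟨c, hc, hd⟩
  set e := D.vert (D.flip d2) with he
  have hpos_e : D.pos e = D.pos s := by
    rw [he, hD.pos_flip d2 hd2, hm, hD.pos_flip d1 hd1, hs, h12, P.elt_linv]
    group
  have hff1 := hD.flip_flip d1 hd1
  have hff2 := hD.flip_flip d2 hd2
  by_cases h0 : D.flip d1 = d2
  · have h0' : D.flip d2 = d1 := by rw [← h0, hff1]
    have hes : e = s := by rw [he, h0', hs]
    have hflE : ∀ d ∈ E, D.flip d ∈ E := by
      intro d hd
      have h1 := (hmem _).1 (hD.flip_mem d (hEd d hd))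
      have h2 := hD.flip_flip d (hEd d hd)
      rcases h1 with h1 | h1 | h1
      · rw [h1, h0] at h2; exact absurd h2.symm (hEne d hd).2
      · rw [h1, h0'] at h2; exact absurd h2.symm (hEne d hd).1
      · exact h1
    let D' : PreDiagram P := { D with outer := A' ++ C' }
    have hda : D'.darts = E := hE
    have hpath : ∀ (l : List ℕ) (u w : ℕ), D.IsPath u l w → D'.IsPath u l w := fun l u w hlp =>
      hlp.map (D' := D') id (fun d _ => rfl) (fun d _ => rfl)
    have hlen := hperm.length_eq
    simp only [List.length_cons] at hlen
    refine ⟨D', ⟨?_, ?_, ?_, ?_, ?_, ?_, ?_, ?_, hD.inner_ne, hD.inner_rel, ?_, ?_⟩, ?_, hn⟩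
    · rw [hda]; exact hnd.2.2
    · rw [hda]; exact hflE
    · rw [hda]; exact fun d hd => hD.flip_flip d (hEd d hd)
    · rw [hda]; exact fun d hd => hD.flip_ne d (hEd d hd)
    · rw [hda]; exact fun d hd => hD.lab_flip d (hEd d hd)
    · rw [hda]; exact fun d hd => hD.pos_flip d (hEd d hd)
    · refine hpath _ _ _ (isPath_append.2 ⟨s, hs1, ?_⟩)
      rw [← hes]; exact hs3
    · intro c hc
      obtain ⟨u, hu⟩ := hD.inner_path c hc
      exact ⟨u, hpath _ _ _ hu⟩
    · have h1 : D.verts.erase (D.vert d2) ⊆ D'.verts := by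
        intro u hu
        have hsm : s ∈ D'.verts := by
          rcases List.eq_nil_or_concat A' with rfl | ⟨A'', a, rfl⟩
          · simp only [IsPath] at hs1
            rw [← hs1]; exact Finset.mem_insert_self _ _
          · rw [List.concat_eq_append, isPath_append] at hs1
            obtain ⟨u, _, hu⟩ := hs1
            simp only [IsPath] at hu
            have : D.flip a ∈ E := hflE _ (hAE _ (by simp))
            simp only [verts, Finset.mem_insert, List.mem_toFinset, List.mem_map, hda]
            exact Or.inr ⟨_, this, hu.2⟩
        simp only [verts, Finset.mem_erase, Finset.mem_insert, List.mem_toFinset, List.mem_map] at hu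
        rcases hu with ⟨hu0, hu | ⟨d, hd, rfl⟩⟩
        · simp [verts, hu, D']
        · rcases (hmem d).1 hd with rfl | rfl | hd
          · rw [hs]; exact hsm
          · exact absurd rfl hu0
          · simp only [verts, Finset.mem_insert, List.mem_toFinset, List.mem_map, hda]
            exact Or.inr ⟨d, hd, rfl⟩
      have h3 := Finset.card_le_card h1
      have h4 := Finset.pred_card_le_card_erase (s := D.verts) (a := D.vert d2)
      have := hD.euler
      change D'.darts.length + 4 ≤ 2 * D'.verts.card + 2 * (D.inner.length + 1)
      rw [hda]
      omega
    · intro h hh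
      rw [hda] at hh
      have h1 := hD.fill (fun d => if d = d1 ∨ d = d2 then 1 else h d) (by
        intro d hd
        rcases (hmem d).1 hd with rfl | rfl | hd
        · simp [h0]
        · simp [h0']
        · have := hflE d hd
          simp only [hEne d hd, hEne _ this, or_self, if_false]
          exact hh d hd)
      have hc : ∀ l : List ℕ, (∀ d ∈ l, d ∈ E) →
          l.map (fun d => if d = d1 ∨ d = d2 then 1 else h d) = l.map h := fun l hl =>
        List.map_congr_left fun d hd => by simp [hEne d (hl d hd)]
      rw [hAC] at h1
      simp only [List.map_append, List.map_cons, hc _ hAE, hc _ hCE] at h1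
      rw [List.map_congr_left fun c hcc => by rw [hc c (hIE c hcc)]] at h1
      simpa [D'] using h1
    · simp [D']
  · set p := D.flip d1 with hp
    set q := D.flip d2 with hq
    have hpE : p ∈ E := by
      rcases (hmem _).1 (hD.flip_mem d1 hd1) with h1 | h1 | h1
      · exact absurd h1 (hD.flip_ne d1 hd1)
      · exact absurd h1 h0
      · exact h1
    have hqE : q ∈ E := by
      rcases (hmem _).1 (hD.flip_mem d2 hd2) with h1 | h1 | h1
      · exact absurd (by rw [hp, ← h1, hff2]) h0
      · exact absurd h1 (hD.flip_ne d2 hd2)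
      · exact h1
    have hpq : p ≠ q := fun h => by
      rw [h, hff2] at hff1
      exact hnd.1.1 hff1.symm
    have hflE : ∀ d ∈ E, d ≠ p → d ≠ q → D.flip d ∈ E ∧ D.flip d ≠ p ∧ D.flip d ≠ q := by
      intro d hd hdp hdq
      have h1 := (hmem _).1 (hD.flip_mem d (hEd d hd))
      have h2 := hD.flip_flip d (hEd d hd)
      refine ⟨?_, ?_, ?_⟩
      · rcases h1 with h1 | h1 | h1
        · rw [h1] at h2; exact absurd h2.symm hdp
        · rw [h1] at h2; exact absurd h2.symm hdq
        · exact h1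
      · intro h3; rw [h3, hff1] at h2; exact (hEne d hd).1 h2.symm
      · intro h3; rw [h3, hff2] at h2; exact (hEne d hd).2 h2.symm
    let ρ : ℕ → ℕ := fun v => if v = e then s else v
    let D' : PreDiagram P :=
      { flip := fun d => if d = p then q else if d = q then p else D.flip d
        lab := D.lab
        vert := fun d => ρ (D.vert d)
        pos := D.pos
        base := ρ D.base
        outer := A' ++ C'
        inner := D.inner }
    have hda : D'.darts = E := hE
    have hfp : D'.flip p = q := by simp [D']
    have hfq : D'.flip q = p := by simp [D', hpq.symm]
    have hfE : ∀ d, d ≠ p → d ≠ q → D'.flip d = D.flip d := fun d h1 h2 => by simp [D', h1, h2]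
    have hρe : ρ e = s := by simp [ρ]
    have hρs : ρ s = s := by simp [ρ]
    have hposρ : ∀ v, D.pos (ρ v) = D.pos v := by
      intro v
      simp only [ρ]
      split_ifs with hv
      · rw [hv, hpos_e]
      · rfl
    have hvf : ∀ d, D'.vert (D'.flip d) = ρ (D.vert (D.flip d)) := by
      intro d
      by_cases h1 : d = p
      · subst h1
        rw [hfp, hff1, hs, hρs, ← hρe]
      by_cases h2 : d = q
      · subst h2
        rw [hfq, hff2, hm]
      rw [hfE d h1 h2]
    have hpath : ∀ (l : List ℕ) (u w : ℕ), D.IsPath u l w → D'.IsPath (ρ u) l (ρ w) :=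
      fun l u w hlp => hlp.map (D' := D') ρ (fun d _ => rfl) (fun d _ => hvf d)
    have hlp : D.lab p = linv (D.lab d1) := hD.lab_flip d1 hd1
    have hlq : D.lab q = D.lab d1 := by rw [hq, hD.lab_flip d2 hd2, h12, linv_linv]
    have hlen := hperm.length_eq
    simp only [List.length_cons] at hlen
    refine ⟨D', ⟨?_, ?_, ?_, ?_, ?_, ?_, ?_, ?_, hD.inner_ne, hD.inner_rel, ?_, ?_⟩, ?_, hn⟩
    · rw [hda]; exact hnd.2.2
    · rw [hda]
      intro d hd
      by_cases h1 : d = p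
      · rwa [h1, hfp]
      by_cases h2 : d = q
      · rwa [h2, hfq]
      rw [hfE d h1 h2]; exact (hflE d hd h1 h2).1
    · rw [hda]
      intro d hd
      by_cases h1 : d = p
      · rw [h1, hfp, hfq]
      by_cases h2 : d = q
      · rw [h2, hfq, hfp]
      obtain ⟨h3, h4, h5⟩ := hflE d hd h1 h2
      rw [hfE d h1 h2, hfE _ h4 h5, hD.flip_flip d (hEd d hd)]
    · rw [hda]
      intro d hd
      by_cases h1 : d = p
      · rw [h1, hfp]; exact hpq.symm
      by_cases h2 : d = q
      · rw [h2, hfq]; exact hpq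
      rw [hfE d h1 h2]; exact hD.flip_ne d (hEd d hd)
    · rw [hda]
      intro d hd
      change D.lab (D'.flip d) = linv (D.lab d)
      by_cases h1 : d = p
      · rw [h1, hfp, hlq, hlp, linv_linv]
      by_cases h2 : d = q
      · rw [h2, hfq, hlq, hlp]
      rw [hfE d h1 h2]; exact hD.lab_flip d (hEd d hd)
    · rw [hda]
      intro d hd
      rw [hvf]
      change D.pos (ρ (D.vert (D.flip d))) = D.pos (ρ (D.vert d)) * P.elt [D.lab d]
      rw [hposρ, hposρ, hD.pos_flip d (hEd d hd)]
    · refine isPath_append.2 ⟨s, ?_, ?_⟩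
      · have := hpath _ _ _ hs1
        rwa [hρs] at this
      · have := hpath _ _ _ hs3
        rwa [hρe] at this
    · intro c hc
      obtain ⟨u, hu⟩ := hD.inner_path c hc
      exact ⟨_, hpath _ _ _ hu⟩
    · have h1 : D.verts.erase e ⊆ D'.verts := by
        intro u hu
        simp only [verts, Finset.mem_erase, Finset.mem_insert, List.mem_toFinset, List.mem_map] at hu
        obtain ⟨hu0, hu⟩ := hu
        have hρu : ρ u = u := by simp [ρ, hu0]
        simp only [verts, Finset.mem_insert, List.mem_toFinset, List.mem_map, hda]
        rcases hu with hu | ⟨d, hd, rfl⟩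
        · left
          change u = ρ D.base
          rw [← hu, hρu]
        · right
          rcases (hmem d).1 hd with rfl | rfl | hd
          · exact ⟨q, hqE, by change ρ e = _; rw [hρe, hs]⟩
          · exact ⟨p, hpE, by change ρ (D.vert p) = _; rw [← hm, hρu]⟩
          · exact ⟨d, hd, hρu⟩
      have h3 := Finset.card_le_card h1
      have h4 := Finset.pred_card_le_card_erase (s := D.verts) (a := e)
      have := hD.euler
      change D'.darts.length + 4 ≤ 2 * D'.verts.card + 2 * (D.inner.length + 1)
      rw [hda]
      omega
    · intro h hh
      rw [hda] at hh
      have hhq : h q = (h p)⁻¹ := by rw [← hfp]; exact hh p hpE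
      have h1 := hD.fill (fun d => if d = d1 then (h p)⁻¹ else if d = d2 then h p else h d) (by
        intro d hd
        rcases (hmem d).1 hd with rfl | rfl | hd
        · rw [← hp]; simp [hEne p hpE]
        · rw [← hq]; simp [hEne q hqE, hhq, Ne.symm hnd.1.1]
        · by_cases h1 : d = p
          · subst h1; simp [hff1, hEne p hpE]
          by_cases h2 : d = q
          · subst h2; simp [hff2, hEne q hqE, hhq, Ne.symm hnd.1.1]
          have h3 := hh d hd
          rw [hfE d h1 h2] at h3
          simp [hEne d hd, hEne _ (hflE d hd h1 h2).1, h3])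
      have hc : ∀ l : List ℕ, (∀ d ∈ l, d ∈ E) →
          l.map (fun d => if d = d1 then (h p)⁻¹ else if d = d2 then h p else h d) = l.map h :=
        fun l hl => List.map_congr_left fun d hd => by simp [hEne d (hl d hd)]
      rw [hAC] at h1
      simp only [List.map_append, List.map_cons, hc _ hAE, hc _ hCE] at h1
      rw [List.map_congr_left fun c hcc => by rw [hc c (hIE c hcc)]] at h1
      simpa [D', Ne.symm hnd.1.1] using h1
    · simp [D']

end PreDiagram

open PreDiagram in
theorem HasDiagram.of_mk_eq {S : Type} {P : C6Presentation S} {B B' : Word S} {n : ℕ}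
    (h : HasDiagram P B n) (he : FreeGroup.mk B = FreeGroup.mk B') : HasDiagram P B' n := by
  obtain ⟨Z, h1, h2⟩ := FreeGroup.Red.exact.1 he
  have hZ : HasDiagram P Z n := by
    clear h2 he
    induction h1 with
    | refl => exact h
    | tail _ hs ih =>
      cases hs with
      | not => exact hasDiagram_fold ih
  clear h1 he h
  induction h2 using Relation.ReflTransGen.head_induction_on with
  | refl => exact hZ
  | head hs _ ih =>
    cases hs with
    | not => exact hasDiagram_insert ih

open PreDiagram in
theorem C6Presentation.Area.hasDiagram {S : Type} {P : C6Presentation S} [Inhabited S] {n : ℕ}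
    {B : Word S} (h : P.Area n (FreeGroup.mk B)) : HasDiagram P B n := by
  induction n generalizing B with
  | zero => exact hasDiagram_nil.of_mk_eq h.symm
  | succ n ih =>
    obtain ⟨g, y, r, hr, hr0, hy, he⟩ := h
    obtain ⟨Y, rfl⟩ : ∃ Y, FreeGroup.mk Y = y := Quot.exists_rep y
    obtain ⟨G, rfl⟩ : ∃ G, FreeGroup.mk G = g := Quot.exists_rep g
    obtain ⟨x, t, rfl⟩ := List.exists_cons_of_ne_nil hr0
    have h1 : HasDiagram P (G ++ (wordInv t ++ (t ++ (wordInv G ++ Y)))) n := by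
      refine (ih hy).of_mk_eq ?_
      simp only [← FreeGroup.mul_mk, mk_wordInv]
      group
    refine (hasDiagram_edge hr h1).of_mk_eq ?_
    rw [he, mk_cons x t, ← FreeGroup.mul_mk, mk_cons x (t ++ _), ← FreeGroup.mul_mk,
      ← FreeGroup.mul_mk, mk_wordInv]
    group
end GSC

namespace GSC

/-- The face permutation of a disjoint family of cyclic lists. -/
theorem exists_face_perm (F : List (List ℕ)) (h : F.flatten.Nodup) :
    ∃ φ : Equiv.Perm ℕ, (∀ fc ∈ F, ∀ t (ht : t < fc.length),
      φ fc[t] = getElem fc ((t + 1) % fc.length) (Nat.mod_lt _ (by omega))) ∧ ∀ x ∉ F.flatten, φ x = x := by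
  induction F with
  | nil => exact ⟨1, by simp, by simp⟩
  | cons fc F ih =>
    rw [List.flatten_cons, List.nodup_append] at h
    obtain ⟨hfc, hF, hdis⟩ := h
    obtain ⟨φ, h1, h2⟩ := ih hF
    refine ⟨fc.formPerm * φ, ?_, ?_⟩
    · intro fc' hfc' t ht
      rw [Equiv.Perm.mul_apply]
      rcases List.mem_cons.1 hfc' with rfl | hfc'
      · rw [h2 _ (fun hm => hdis _ (List.getElem_mem ht) _ hm rfl)]
        exact List.formPerm_apply_getElem _ hfc t ht
      · rw [h1 fc' hfc' t ht]
        refine List.formPerm_apply_of_notMem fun hm => hdis _ hm _ ?_ rfl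
        exact List.mem_flatten.2 ⟨fc', hfc', List.getElem_mem _⟩
    · intro x hx
      rw [List.flatten_cons, List.mem_append, not_or] at hx
      rw [Equiv.Perm.mul_apply, h2 x hx.2, List.formPerm_apply_of_notMem hx.1]

theorem zpow_zpow_apply (φ : Equiv.Perm ℕ) (i j : ℤ) (x : ℕ) :
    (φ ^ i) ((φ ^ j) x) = (φ ^ (i + j)) x := by
  rw [zpow_add]; rfl

namespace PreDiagram

variable {S : Type} {P : C6Presentation S}

theorem IsPath.vert_getElem {v w : ℕ} {l : List ℕ} {D : PreDiagram P} (h : D.IsPath v l w)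
    (t : ℕ) (ht : t + 1 < l.length) : D.vert (D.flip l[t]) = D.vert l[t + 1] := by
  induction l generalizing v t with
  | nil => simp at ht
  | cons d l ih =>
    simp only [IsPath] at h
    cases t with
    | zero =>
      cases l with
      | nil => simp at ht
      | cons e l =>
        simp only [IsPath] at h
        simpa using h.2.1.symm
    | succ t =>
      simpa using ih h.2 t (by simpa using ht)

theorem IsPath.vert_head {v w : ℕ} {l : List ℕ} {D : PreDiagram P} (h : D.IsPath v l w)
    (hl : 0 < l.length) : D.vert l[0] = v := by
  cases l with
  | nil => simp at hl
  | cons d l => exact h.1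

theorem IsPath.vert_last {v w : ℕ} {l : List ℕ} {D : PreDiagram P} (h : D.IsPath v l w)
    (hl : 0 < l.length) : D.vert (D.flip l[l.length - 1]) = w := by
  induction l generalizing v with
  | nil => simp at hl
  | cons d l ih =>
    simp only [IsPath] at h
    cases l with
    | nil => simpa [IsPath] using h.2
    | cons e l =>
      have := ih h.2 (by simp)
      simpa using this

/-- A valid diagram with its face permutation. -/
structure HasNext (D : PreDiagram P) (φ : Equiv.Perm ℕ) : Prop where
  valid : D.Valid
  next : ∀ fc ∈ D.outer :: D.inner, ∀ t (ht : t < fc.length),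
      φ fc[t] = getElem fc ((t + 1) % fc.length) (Nat.mod_lt _ (by omega))

theorem Valid.exists_hasNext {D : PreDiagram P} (hD : D.Valid) : ∃ φ, D.HasNext φ := by
  obtain ⟨φ, h, -⟩ := exists_face_perm (D.outer :: D.inner) hD.nodup
  exact ⟨φ, hD, h⟩

theorem mem_darts {D : PreDiagram P} {d : ℕ} :
    d ∈ D.darts ↔ ∃ fc ∈ D.outer :: D.inner, d ∈ fc := by
  simp [darts]

namespace HasNext

variable {D : PreDiagram P} {φ : Equiv.Perm ℕ} (H : D.HasNext φ)
include H

theorem face_nodup {fc : List ℕ} (hfc : fc ∈ D.outer :: D.inner) : fc.Nodup := by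
  have := H.valid.nodup
  rw [darts, ← List.flatten_cons, List.nodup_flatten] at this
  exact this.1 fc hfc

theorem face_unique {fc fc' : List ℕ} (hfc : fc ∈ D.outer :: D.inner) (hfc' : fc' ∈ D.outer :: D.inner)
    {d : ℕ} (hd : d ∈ fc) (hd' : d ∈ fc') : fc = fc' := by
  have := H.valid.nodup
  rw [darts, ← List.flatten_cons, List.nodup_flatten] at this
  by_contra hne
  have hsymm : Std.Symm (List.Disjoint (α := ℕ)) := ⟨fun _ _ h => h.symm⟩
  exact this.2.forall hfc hfc' hne hd hd'

theorem zpow_getElem {fc : List ℕ} (hfc : fc ∈ D.outer :: D.inner) {i : ℕ} (hi : i < fc.length)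
    (t : ℕ) : (φ ^ (t : ℤ)) fc[i] = getElem fc ((i + t) % fc.length) (Nat.mod_lt _ (by omega)) := by
  induction t with
  | zero => simp [Nat.mod_eq_of_lt hi]
  | succ t ih =>
    have : (φ ^ ((t + 1 : ℕ) : ℤ)) fc[i] = φ ((φ ^ (t : ℤ)) fc[i]) := by
      rw [show ((t + 1 : ℕ) : ℤ) = 1 + t by push_cast; ring, zpow_add, zpow_one]; rfl
    rw [this, ih, H.next fc hfc]
    congr 1
    rw [Nat.mod_add_mod]
    rfl

theorem zpow_length {fc : List ℕ} (hfc : fc ∈ D.outer :: D.inner) {d : ℕ} (hd : d ∈ fc) :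
    (φ ^ (fc.length : ℤ)) d = d := by
  obtain ⟨i, hi, rfl⟩ := List.getElem_of_mem hd
  rw [H.zpow_getElem hfc hi]
  congr 1
  simp [Nat.mod_eq_of_lt hi]

theorem zpow_add_mul_length {fc : List ℕ} (hfc : fc ∈ D.outer :: D.inner) {d : ℕ} (hd : d ∈ fc)
    (i k : ℤ) : (φ ^ (i + k * fc.length)) d = (φ ^ i) d := by
  rw [← zpow_zpow_apply]
  congr 1
  rw [mul_comm, zpow_mul]
  exact Equiv.Perm.zpow_apply_eq_self_of_apply_eq_self (H.zpow_length hfc hd) k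

theorem zpow_mem {fc : List ℕ} (hfc : fc ∈ D.outer :: D.inner) {d : ℕ} (hd : d ∈ fc) (i : ℤ) :
    (φ ^ i) d ∈ fc := by
  have hl : 0 < fc.length := List.length_pos_of_mem hd
  have h1 := H.zpow_add_mul_length hfc hd i (|i|)
  have h2 : 0 ≤ i + |i| * fc.length := by
    have h3 : |i| * 1 ≤ |i| * fc.length :=
      mul_le_mul_of_nonneg_left (by exact_mod_cast hl) (abs_nonneg i)
    have := neg_abs_le i
    omega
  obtain ⟨n, hn⟩ := Int.eq_ofNat_of_zero_le h2
  rw [← h1, hn]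
  obtain ⟨j, hj, rfl⟩ := List.getElem_of_mem hd
  rw [H.zpow_getElem hfc hj]
  exact List.getElem_mem _

theorem next_mem {fc : List ℕ} (hfc : fc ∈ D.outer :: D.inner) {d : ℕ} (hd : d ∈ fc) : φ d ∈ fc :=
  H.zpow_mem hfc hd 1

theorem prev_mem {fc : List ℕ} (hfc : fc ∈ D.outer :: D.inner) {d : ℕ} (hd : d ∈ fc) : φ⁻¹ d ∈ fc :=
by
  simpa using H.zpow_mem hfc hd (-1)

theorem rotate_eq {fc : List ℕ} (hfc : fc ∈ D.outer :: D.inner) {d : ℕ} (hd : d ∈ fc) :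
    ∃ i, fc.rotate i = (List.range fc.length).map fun t : ℕ => (φ ^ (t : ℤ)) d := by
  obtain ⟨i, hi, rfl⟩ := List.getElem_of_mem hd
  refine ⟨i, List.ext_getElem (by simp) fun t h1 h2 => ?_⟩
  rw [List.getElem_rotate, List.getElem_map, H.zpow_getElem hfc hi]
  simp [add_comm]

theorem exists_zpow {fc : List ℕ} (hfc : fc ∈ D.outer :: D.inner) {d e : ℕ} (hd : d ∈ fc)
    (he : e ∈ fc) : ∃ t : ℕ, t < fc.length ∧ (φ ^ (t : ℤ)) d = e := by
  obtain ⟨i, hi⟩ := H.rotate_eq hfc hd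
  have : e ∈ fc.rotate i := List.mem_rotate.2 he
  rw [hi] at this
  simpa using this

theorem zpow_inj {fc : List ℕ} (hfc : fc ∈ D.outer :: D.inner) {d : ℕ} (hd : d ∈ fc) {s t : ℕ}
    (hs : s < fc.length) (ht : t < fc.length) (h : (φ ^ (s : ℤ)) d = (φ ^ (t : ℤ)) d) : s = t := by
  obtain ⟨i, hi⟩ := H.rotate_eq hfc hd
  have h1 : (fc.rotate i).Nodup := List.nodup_rotate.2 (H.face_nodup hfc)
  rw [hi] at h1
  exact List.inj_on_of_nodup_map h1 (List.mem_range.2 hs) (List.mem_range.2 ht) h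

theorem isRel {fc : List ℕ} (hfc : fc ∈ D.inner) {d : ℕ} (hd : d ∈ fc) :
    P.IsRel fc.length (fun t => D.lab ((φ ^ (t : ℤ)) d)) := by
  have hfc' : fc ∈ D.outer :: D.inner := List.mem_cons_of_mem _ hfc
  refine ⟨List.length_pos_of_mem hd, ?_, fun t => ?_⟩
  · obtain ⟨i, hi⟩ := H.rotate_eq hfc' hd
    have h1 := P.rotate_mem _ (H.valid.inner_rel fc hfc) i
    rw [← List.map_rotate, hi, List.map_map] at h1
    exact h1
  · have := H.zpow_add_mul_length hfc' hd t 1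
    push_cast
    rw [one_mul] at this
    rw [this]

/-- The inverse reading of an inner face. -/
theorem isRel_inv {fc : List ℕ} (hfc : fc ∈ D.inner) {d : ℕ} (hd : d ∈ fc) :
    P.IsRel fc.length (fun t => linv (D.lab ((φ ^ (-t : ℤ)) d))) := by
  have hfc' : fc ∈ D.outer :: D.inner := List.mem_cons_of_mem _ hfc
  have hl : 0 < fc.length := List.length_pos_of_mem hd
  convert (H.isRel hfc (H.next_mem hfc' hd)).inv using 4 with t
  have h1 : φ d = (φ ^ (1 : ℤ)) d := by simp
  rw [h1, zpow_zpow_apply]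
  have h2 := Nat.mod_lt t hl
  have h3 := Nat.div_add_mod t fc.length
  have h4 := H.zpow_add_mul_length hfc' hd (-(t : ℤ)) (t / fc.length + 1 : ℕ)
  rw [← h4]
  congr 2
  have h5 : ((fc.length - 1 - t % fc.length : ℕ) : ℤ) = fc.length - 1 - (t % fc.length : ℕ) := by omega
  rw [h5]
  have h6 : (t : ℤ) = fc.length * (t / fc.length : ℕ) + (t % fc.length : ℕ) := by exact_mod_cast h3.symm
  generalize (t / fc.length : ℕ) = q at *
  generalize (t % fc.length : ℕ) = r at *
  rw [h6]
  push_cast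
  ring

theorem flip_mem_iff {d : ℕ} (hd : d ∈ D.darts) : ∃ fc ∈ D.outer :: D.inner, D.flip d ∈ fc :=
  mem_darts.1 (H.valid.flip_mem d hd)

theorem isPath_face {fc : List ℕ} (hfc : fc ∈ D.outer :: D.inner) : ∃ v, D.IsPath v fc v := by
  rcases List.mem_cons.1 hfc with rfl | hfc
  · exact ⟨_, H.valid.outer_path⟩
  · exact H.valid.inner_path fc hfc

theorem vert_next {d : ℕ} (hd : d ∈ D.darts) : D.vert (φ d) = D.vert (D.flip d) := by
  obtain ⟨fc, hfc, hdc⟩ := mem_darts.1 hd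
  obtain ⟨v, hv⟩ := H.isPath_face hfc
  obtain ⟨t, ht, rfl⟩ := List.getElem_of_mem hdc
  rw [H.next fc hfc t ht]
  rcases Nat.lt_or_ge (t + 1) fc.length with h1 | h1
  · simp only [Nat.mod_eq_of_lt h1]
    exact (hv.vert_getElem t h1).symm
  · have h2 : t = fc.length - 1 := by omega
    have h3 : (t + 1) % fc.length = 0 := by
      rw [show t + 1 = fc.length by omega, Nat.mod_self]
    simp only [h3]
    rw [hv.vert_head (by omega)]
    subst h2
    exact (hv.vert_last (by omega)).symm

end HasNext
end PreDiagram
end GSC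

namespace GSC

theorem ConjProd.area {S : Type} {P : C6Presentation S} {α : Type} (l : List α)
    (p : α → Bool) (g : α → FreeGroup S) (hp : ∀ a ∈ l, p a = false → g a = 1)
    (hr : ∀ a ∈ l, p a = true → ∃ r ∈ P.rels, r ≠ [] ∧ g a = FreeGroup.mk r) {x : FreeGroup S}
    (h : ConjProd (l.map g) x) : P.Area (l.countP p) x := by
  induction l generalizing x with
  | nil => exact h
  | cons a l ih =>
    obtain ⟨k, y, hy, rfl⟩ := h
    have h1 := ih (fun b hb => hp b (by simp [hb])) (fun b hb => hr b (by simp [hb])) hy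
    rcases hpa : p a with _ | _
    · rw [List.countP_cons_of_neg (by simp [hpa]), hp a (by simp) hpa]
      simpa using h1
    · rw [List.countP_cons_of_pos hpa]
      obtain ⟨r, hr1, hr2, hr3⟩ := hr a (by simp) hpa
      refine ⟨k, y, wordInv r, P.inv_mem r hr1, by simpa [wordInv] using hr2, h1, ?_⟩
      rw [mk_wordInv, hr3]

namespace PreDiagram

variable {S : Type} {P : C6Presentation S}

/-- A diagram with minimal number of faces and simple boundary. -/
structure Minimal (D : PreDiagram P) (φ : Equiv.Perm ℕ) : Prop extends D.HasNext φ where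
  outer_ne : D.outer ≠ []
  inj : ∀ d ∈ D.outer, ∀ e ∈ D.outer, D.vert d = D.vert e → d = e
  noext : ∀ d ∈ D.outer, D.flip d ∉ D.outer
  minimal : ∀ n < D.inner.length, ¬ P.Area n (FreeGroup.mk (D.outer.map D.lab))

namespace HasNext

variable {D : PreDiagram P} {φ : Equiv.Perm ℕ} (H : D.HasNext φ)
include H

theorem prod_eq_one {fc : List ℕ} (hfc : fc ∈ D.outer :: D.inner) {d : ℕ} (hd : d ∈ fc)
    (h : ℕ → FreeGroup S)
    (h1 : ((List.range fc.length).map fun t : ℕ => h ((φ ^ (t : ℤ)) d)).prod = 1) :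
    (fc.map h).prod = 1 := by
  obtain ⟨i, hi⟩ := H.rotate_eq hfc hd
  have h2 : ((fc.map h).rotate i).prod = 1 := by
    rw [← List.map_rotate, hi, List.map_map]; exact h1
  have h3 := List.prod_rotate_eq_one_of_prod_eq_one h2 ((fc.map h).length - i % (fc.map h).length)
  rw [List.rotate_rotate] at h3
  rcases Nat.eq_zero_or_pos (fc.map h).length with h0 | h0
  · rw [List.length_eq_zero_iff.1 h0]; rfl
  have h4 : (i + ((fc.map h).length - i % (fc.map h).length)) % (fc.map h).length = 0 := by
    have h5 := Nat.mod_lt i h0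
    have h6 := Nat.div_add_mod i (fc.map h).length
    generalize (fc.map h).length = n at *
    generalize i / n = q at *
    generalize i % n = r at *
    rw [show i + (n - r) = n * (q + 1) by rw [mul_add]; omega]
    simp
  rw [← List.rotate_mod, h4, List.rotate_zero] at h3
  exact h3

end HasNext

theorem prod_reverse_telescope {G : Type*} [Group G] (a : ℕ → G) (n : ℕ) :
    ((List.range n).map fun t => (a (n - 1 - t))⁻¹).prod = (((List.range n).map a).prod)⁻¹ := by
  induction n with
  | zero => simp
  | succ n ih =>
    rw [List.range_succ_eq_map, List.map_cons, List.prod_cons, List.map_map,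
      ← List.range_succ_eq_map, List.range_succ, List.map_append, List.prod_append, mul_inv_rev,
      ← ih]
    simp only [List.map_cons, List.map_nil, List.prod_singleton, Nat.add_sub_cancel, Nat.sub_zero]
    congr 2
    refine List.map_congr_left fun t ht => ?_
    simp only [Function.comp]
    congr 2
    omega

namespace Minimal

variable {D : PreDiagram P} {φ : Equiv.Perm ℕ} (H : D.Minimal φ)
include H

theorem not_mirror {d : ℕ} {fc fc' : List ℕ} (hfc : fc ∈ D.inner) (hfc' : fc' ∈ D.inner)
    (hd : d ∈ fc) (hd' : D.flip d ∈ fc') (hlen : fc.length = fc'.length)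
    (hm : ∀ t : ℕ, D.lab ((φ ^ (t : ℤ)) d) = linv (D.lab ((φ ^ (-t : ℤ)) (D.flip d)))) :
    False := by
  have hc1 : fc ∈ D.outer :: D.inner := List.mem_cons_of_mem _ hfc
  have hc1' : fc' ∈ D.outer :: D.inner := List.mem_cons_of_mem _ hfc'
  have hdd : d ∈ D.darts := mem_darts.2 ⟨fc, hc1, hd⟩
  have hff := H.valid.flip_flip d hdd
  have hfne := H.valid.flip_ne d hdd
  by_cases hcc : fc = fc'
  · subst hcc
    obtain ⟨m, hm1, hm2⟩ := H.exists_zpow hc1 hd hd'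
    rcases Nat.even_or_odd' m with ⟨u, rfl | rfl⟩
    · have := hm u
      rw [← hm2, zpow_zpow_apply, show (-(u : ℤ) + ((2 * u : ℕ) : ℤ)) = u by push_cast; ring] at this
      exact linv_ne _ this.symm
    · have := hm (u + 1)
      rw [← hm2, zpow_zpow_apply,
        show (-((u + 1 : ℕ) : ℤ) + ((2 * u + 1 : ℕ) : ℤ)) = u by push_cast; ring] at this
      exact (H.isRel hfc hd).succ_ne u this
  set n := fc.length with hn
  obtain ⟨k, hk⟩ : ∃ k, n = k + 1 := ⟨n - 1, by have := List.length_pos_of_mem hd; omega⟩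
  set ρ : FreeGroup S :=
    ((List.range k).map fun t : ℕ => FreeGroup.mk [D.lab ((φ ^ ((t + 1 : ℕ) : ℤ)) d)]).prod with hρ
  let h : ℕ → FreeGroup S := fun x => if x = d then ρ⁻¹ else if x = D.flip d then ρ else
    FreeGroup.mk [D.lab x]
  have hne : ∀ x, x ∉ fc → x ≠ d := fun x hx hxd => hx (hxd ▸ hd)
  have hne' : ∀ x, x ∉ fc' → x ≠ D.flip d := fun x hx hxd => hx (hxd ▸ hd')
  have hgen : ∀ x, x ≠ d → x ≠ D.flip d → h x = FreeGroup.mk [D.lab x] := fun x h1 h2 => by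
    simp [h, h1, h2]
  have hdisj : ∀ x ∈ fc, x ∉ fc' := fun x hx hx' => hcc (H.face_unique hc1 hc1' hx hx')
  have hflip : ∀ x ∈ D.darts, h (D.flip x) = (h x)⁻¹ := by
    intro x hx
    by_cases h1 : x = d
    · subst h1; simp [h, hfne]
    by_cases h2 : x = D.flip d
    · subst h2; simp [h, hff, hfne]
    rw [hgen x h1 h2, hgen, H.valid.lab_flip x hx, mk_linv]
    · intro h3; exact h2 (by rw [← h3, H.valid.flip_flip x hx])
    · intro h3; exact h1 (by rw [← H.valid.flip_flip x hx, h3, hff])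
  have hfc1 : (fc.map h).prod = 1 := by
    refine H.prod_eq_one hc1 hd h ?_
    rw [← hn, hk, List.range_succ_eq_map, List.map_cons, List.prod_cons, List.map_map]
    have h0 : h ((φ ^ ((0 : ℕ) : ℤ)) d) = ρ⁻¹ := by simp [h]
    rw [h0, inv_mul_eq_one, hρ]
    congr 1
    refine List.map_congr_left fun t ht => ?_
    have ht' : t < k := List.mem_range.1 ht
    simp only [Function.comp]
    rw [hgen]
    · intro h1
      have := H.zpow_inj hc1 hd (s := t + 1) (t := 0) (by omega) (by omega) (by simpa using h1)
      omega
    · exact hne' _ (hdisj _ (H.zpow_mem hc1 hd _))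
  have hfc2 : (fc'.map h).prod = 1 := by
    refine H.prod_eq_one hc1' hd' h ?_
    rw [← hlen, hk, List.range_succ_eq_map, List.map_cons, List.prod_cons, List.map_map]
    have h0 : h ((φ ^ ((0 : ℕ) : ℤ)) (D.flip d)) = ρ := by simp [h, hfne]
    rw [h0, mul_eq_one_iff_eq_inv', hρ, ← prod_reverse_telescope]
    congr 1
    refine List.map_congr_left fun t ht => ?_
    have ht' : t < k := List.mem_range.1 ht
    simp only [Function.comp]
    rw [hgen]
    · rw [← mk_linv, hm, linv_linv]
      have := H.zpow_add_mul_length hc1' hd' (-((k - 1 - t + 1 : ℕ) : ℤ)) 1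
      rw [← this, ← hlen, hk]
      have hexp : (-((k - 1 - t + 1 : ℕ) : ℤ)) + 1 * ((k + 1 : ℕ) : ℤ) = ((t + 1 : ℕ) : ℤ) := by
        omega
      rw [hexp]
    · intro h1
      exact hdisj _ hd (h1 ▸ H.zpow_mem hc1' hd' _)
    · intro h1
      have := H.zpow_inj hc1' hd' (s := t + 1) (t := 0) (by omega) (by omega) (by simpa using h1)
      omega
  have hout : ∀ fx ∈ D.outer :: D.inner, fx ≠ fc → fx ≠ fc' →
      fx.map h = fx.map fun x => FreeGroup.mk [D.lab x] := by
    intro fx hx h1 h2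
    refine List.map_congr_left fun x hxx => hgen x ?_ ?_
    · intro h3; exact h1 (H.face_unique hx hc1 hxx (h3 ▸ hd))
    · intro h3; exact h2 (H.face_unique hx hc1' hxx (h3 ▸ hd'))
  have hfill := H.valid.fill h hflip
  have hone : D.outer ≠ fc ∧ D.outer ≠ fc' := by
    have := H.valid.nodup
    rw [darts, List.nodup_append] at this
    constructor <;> intro h1
    · exact this.2.2 d (h1 ▸ hd) d (List.mem_flatten.2 ⟨fc, hfc, hd⟩) rfl
    · exact this.2.2 _ (h1 ▸ hd') _ (List.mem_flatten.2 ⟨fc', hfc', hd'⟩) rfl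
  have hprod : ∀ fx : List ℕ, (fx.map fun x => FreeGroup.mk [D.lab x]).prod =
      FreeGroup.mk (fx.map D.lab) := fun fx => by
    rw [← prod_map_mk, List.map_map]; rfl
  rw [hout _ (by simp) hone.1 hone.2, hprod] at hfill
  classical
  have harea := ConjProd.area (P := P) D.inner (fun fx => decide (fx ≠ fc ∧ fx ≠ fc'))
    (fun fx => (fx.map h).prod) (by
      intro fx hx h1
      simp only [decide_eq_false_iff_not, not_and_or, not_not] at h1
      rcases h1 with rfl | rfl
      · exact hfc1
      · exact hfc2) (by
      intro fx hx h1
      simp only [decide_eq_true_eq] at h1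
      refine ⟨fx.map D.lab, H.valid.inner_rel fx hx, by simpa using H.valid.inner_ne fx hx, ?_⟩
      rw [hout fx (by simp [hx]) h1.1 h1.2, hprod]) hfill
  refine H.minimal _ ?_ harea
  rw [List.countP_lt_length_iff]
  exact ⟨fc, hfc, by simp⟩

end Minimal
end PreDiagram
end GSC

namespace GSC

theorem perm_apply_inv (φ : Equiv.Perm ℕ) (x : ℕ) : φ (φ⁻¹ x) = x := by simp

theorem perm_inv_apply (φ : Equiv.Perm ℕ) (x : ℕ) : φ⁻¹ (φ x) = x := by simp

namespace PreDiagram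

variable {S : Type} {P : C6Presentation S}

/-- Rotation around the start vertex of a dart. -/
def turn (D : PreDiagram P) (φ : Equiv.Perm ℕ) (d : ℕ) : ℕ := D.flip (φ⁻¹ d)

/-- The start vertex of the dart has degree two. -/
def Smooth (D : PreDiagram P) (φ : Equiv.Perm ℕ) (d : ℕ) : Prop := D.turn φ (D.turn φ d) = d

namespace HasNext

variable {D : PreDiagram P} {φ : Equiv.Perm ℕ} (H : D.HasNext φ)
include H

theorem next_mem_darts {d : ℕ} (hd : d ∈ D.darts) : φ d ∈ D.darts := by
  obtain ⟨fc, hfc, hdc⟩ := mem_darts.1 hd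
  exact mem_darts.2 ⟨fc, hfc, H.next_mem hfc hdc⟩

theorem prev_mem_darts {d : ℕ} (hd : d ∈ D.darts) : φ⁻¹ d ∈ D.darts := by
  obtain ⟨fc, hfc, hdc⟩ := mem_darts.1 hd
  exact mem_darts.2 ⟨fc, hfc, H.prev_mem hfc hdc⟩

theorem zpow_mem_darts {d : ℕ} (hd : d ∈ D.darts) (i : ℤ) : (φ ^ i) d ∈ D.darts := by
  obtain ⟨fc, hfc, hdc⟩ := mem_darts.1 hd
  exact mem_darts.2 ⟨fc, hfc, H.zpow_mem hfc hdc i⟩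

theorem turn_mem {d : ℕ} (hd : d ∈ D.darts) : D.turn φ d ∈ D.darts :=
  H.valid.flip_mem _ (H.prev_mem_darts hd)

theorem flip_inj {d e : ℕ} (hd : d ∈ D.darts) (he : e ∈ D.darts) (h : D.flip d = D.flip e) :
    d = e := by
  rw [← H.valid.flip_flip d hd, h, H.valid.flip_flip e he]

theorem turn_inj {d e : ℕ} (hd : d ∈ D.darts) (he : e ∈ D.darts)
    (h : D.turn φ d = D.turn φ e) : d = e :=
  φ⁻¹.injective (H.flip_inj (H.prev_mem_darts hd) (H.prev_mem_darts he) h)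

theorem vert_turn {d : ℕ} (hd : d ∈ D.darts) : D.vert (D.turn φ d) = D.vert d := by
  rw [turn, ← H.vert_next (H.prev_mem_darts hd), perm_apply_inv]

theorem smooth_turn {d : ℕ} (hd : d ∈ D.darts) :
    D.Smooth φ (D.turn φ d) ↔ D.Smooth φ d := by
  constructor
  · exact fun h => H.turn_inj (H.turn_mem (H.turn_mem hd)) hd h
  · exact fun h => congrArg (D.turn φ) h

theorem smooth_next_iff_flip {d : ℕ} (hd : d ∈ D.darts) :
    D.Smooth φ (φ d) ↔ D.Smooth φ (D.flip d) := by
  rw [← H.smooth_turn (H.next_mem_darts hd), turn, perm_inv_apply]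

theorem smooth_next_iff {d : ℕ} (hd : d ∈ D.darts) :
    D.Smooth φ (φ d) ↔ φ (D.flip (φ d)) = D.flip d := by
  rw [Smooth, turn, turn, perm_inv_apply]
  constructor
  · intro h
    rw [← h, H.valid.flip_flip _ (H.prev_mem_darts (H.valid.flip_mem d hd)),
      perm_apply_inv]
  · intro h
    rw [← h, perm_inv_apply, H.valid.flip_flip _ (H.next_mem_darts hd)]

theorem flip_zpow_of_smooth {d : ℕ} (hd : d ∈ D.darts) {l : ℕ}
    (hs : ∀ t : ℕ, 0 < t → t < l → D.Smooth φ ((φ ^ (t : ℤ)) d)) {t : ℕ} (ht : t < l) :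
    D.flip ((φ ^ (t : ℤ)) d) = (φ ^ (-t : ℤ)) (D.flip d) := by
  induction t with
  | zero => simp
  | succ t ih =>
    have h1 : (φ ^ ((t + 1 : ℕ) : ℤ)) d = φ ((φ ^ (t : ℤ)) d) := by
      rw [show ((t + 1 : ℕ) : ℤ) = 1 + t by push_cast; ring, ← zpow_zpow_apply, zpow_one]
    have h2 := hs (t + 1) (by omega) ht
    rw [h1, H.smooth_next_iff (H.zpow_mem_darts hd _), ih (by omega)] at h2
    rw [h1]
    apply φ.injective
    rw [h2]
    have : φ ((φ ^ (-((t + 1 : ℕ) : ℤ))) (D.flip d)) =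
        (φ ^ (1 : ℤ)) ((φ ^ (-((t + 1 : ℕ) : ℤ))) (D.flip d)) := by simp
    rw [this, zpow_zpow_apply]
    congr 2
    push_cast
    ring

end HasNext

namespace Minimal

variable {D : PreDiagram P} {φ : Equiv.Perm ℕ} (H : D.Minimal φ)
include H

theorem next_flip_ne {d : ℕ} (hd : d ∈ D.darts) : φ d ≠ D.flip d := by
  intro h
  obtain ⟨fc, hfc, hdc⟩ := mem_darts.1 hd
  have h1 := H.next_mem hfc hdc
  rw [h] at h1
  rcases List.mem_cons.1 hfc with rfl | hfc
  · exact H.noext d hdc h1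
  · refine (H.isRel hfc hdc).succ_ne 0 ?_
    simp [h, H.valid.lab_flip d hd]

theorem turn_ne {d : ℕ} (hd : d ∈ D.darts) : D.turn φ d ≠ d := by
  intro h
  apply H.next_flip_ne (H.prev_mem_darts hd)
  rw [perm_apply_inv]
  exact h.symm

open Classical in
/-- The combinatorial Gauss-Bonnet inequality. -/
theorem gauss_bonnet : 6 + (D.darts.toFinset.filter fun d => ¬ D.Smooth φ d).card ≤
    6 * D.inner.length := by
  set A := D.darts.toFinset with hA
  have hAc : A.card = D.darts.length := List.toFinset_card_of_nodup H.valid.nodup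
  let w : ℕ → ℕ := fun d => if D.Smooth φ d then 3 else 2
  have hfib : ∑ v ∈ D.verts, ∑ d ∈ A with D.vert d = v, w d = ∑ d ∈ A, w d := by
    refine Finset.sum_fiberwise_of_maps_to (fun d hd => ?_) w
    rw [verts]
    refine Finset.mem_insert_of_mem (List.mem_toFinset.2 (List.mem_map_of_mem ?_))
    exact List.mem_toFinset.1 hd
  have hsix : ∀ v ∈ D.verts, 6 ≤ ∑ d ∈ A with D.vert d = v, w d := by
    intro v hv
    obtain ⟨d, hd, rfl⟩ : ∃ d ∈ D.darts, D.vert d = v := by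
      rw [verts, Finset.mem_insert, List.mem_toFinset, List.mem_map] at hv
      rcases hv with rfl | hv
      · have hl := List.length_pos_of_ne_nil H.outer_ne
        exact ⟨D.outer[0], mem_darts.2 ⟨D.outer, by simp, List.getElem_mem hl⟩,
          H.valid.outer_path.vert_head hl⟩
      · exact hv
    have hd1 := H.turn_mem hd
    have hd2 := H.turn_mem hd1
    have hm : ∀ e ∈ D.darts, D.vert e = D.vert d → e ∈ A.filter fun e => D.vert e = D.vert d :=
      fun e he h => Finset.mem_filter.2 ⟨List.mem_toFinset.2 he, h⟩
    have hv1 := H.vert_turn hd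
    have hv2 := (H.vert_turn hd1).trans hv1
    by_cases hs : D.Smooth φ d
    · have hs1 := (H.smooth_turn hd).2 hs
      calc 6 = ∑ e ∈ {d, D.turn φ d}, w e := by
            rw [Finset.sum_pair (H.turn_ne hd).symm]; simp [w, hs, hs1]
        _ ≤ _ := Finset.sum_le_sum_of_subset (by
            intro e he
            simp only [Finset.mem_insert, Finset.mem_singleton] at he
            rcases he with rfl | rfl
            · exact hm _ hd rfl
            · exact hm _ hd1 hv1)
    · have hs1 : ¬ D.Smooth φ (D.turn φ d) := fun h => hs ((H.smooth_turn hd).1 h)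
      have hs2 : ¬ D.Smooth φ (D.turn φ (D.turn φ d)) := fun h => hs1 ((H.smooth_turn hd1).1 h)
      have hne : D.turn φ (D.turn φ d) ≠ d := hs
      calc 6 = ∑ e ∈ {d, D.turn φ d, D.turn φ (D.turn φ d)}, w e := by
            rw [Finset.sum_insert, Finset.sum_pair (H.turn_ne hd1).symm]
            · simp [w, hs, hs1, hs2]
            · simp only [Finset.mem_insert, Finset.mem_singleton, not_or]
              exact ⟨(H.turn_ne hd).symm, hne.symm⟩
        _ ≤ _ := Finset.sum_le_sum_of_subset (by
            intro e he
            simp only [Finset.mem_insert, Finset.mem_singleton] at he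
            rcases he with rfl | rfl | rfl
            · exact hm _ hd rfl
            · exact hm _ hd1 hv1
            · exact hm _ hd2 hv2)
  have h1 := Finset.sum_le_sum hsix
  rw [hfib, Finset.sum_const, smul_eq_mul] at h1
  have h2 : ∑ d ∈ A, w d + (A.filter fun d => ¬ D.Smooth φ d).card = 3 * A.card := by
    rw [Finset.card_filter, ← Finset.sum_add_distrib, Finset.card_eq_sum_ones, Finset.mul_sum]
    refine Finset.sum_congr rfl fun d _ => ?_
    by_cases h : D.Smooth φ d <;> simp [w, h]
  have h3 := H.valid.euler
  omega

/-- Every arc between two inner faces is short. -/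
theorem exists_arc_end {fc : List ℕ} (hfc : fc ∈ D.inner) {d : ℕ} (hd : d ∈ fc)
    (ho : D.flip d ∉ D.outer) : ∃ t : ℕ, 6 * (t + 1) < fc.length ∧
      (∀ s : ℕ, s ≤ t → D.flip ((φ ^ (s : ℤ)) d) ∉ D.outer) ∧
      ¬ D.Smooth φ ((φ ^ ((t + 1 : ℕ) : ℤ)) d) := by
  have hc1 : fc ∈ D.outer :: D.inner := List.mem_cons_of_mem _ hfc
  have hdd : d ∈ D.darts := mem_darts.2 ⟨fc, hc1, hd⟩
  obtain ⟨fc', hfc', hd'⟩ := H.flip_mem_iff hdd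
  have hfc'' : fc' ∈ D.inner := by
    rcases List.mem_cons.1 hfc' with rfl | h
    · exact absurd hd' ho
    · exact h
  by_cases hex : ∃ t : ℕ, 0 < t ∧ ¬ D.Smooth φ ((φ ^ (t : ℤ)) d)
  · classical
    obtain ⟨h0, hns⟩ := Nat.find_spec hex
    have hmin : ∀ t : ℕ, 0 < t → t < Nat.find hex → D.Smooth φ ((φ ^ (t : ℤ)) d) := by
      intro t h1 h2
      have := Nat.find_min hex h2
      simp only [not_and, not_not] at this
      exact this h1
    set l := Nat.find hex with hl
    obtain ⟨t, ht⟩ : ∃ t, l = t + 1 := ⟨l - 1, by omega⟩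
    refine ⟨t, ?_, fun s hs => ?_, by rw [← ht]; exact hns⟩
    · by_contra hlen
      have hR := H.isRel hfc hd
      have hR' := H.isRel_inv hfc'' hd'
      have heq : ∀ s < l, D.lab ((φ ^ (s : ℤ)) d) = linv (D.lab ((φ ^ (-s : ℤ)) (D.flip d))) := by
        intro s hs
        rw [← H.flip_zpow_of_smooth hdd hmin hs, H.valid.lab_flip _ (H.zpow_mem_darts hdd _),
          linv_linv]
      have hpos := hR.1
      have hpos' := hR'.1
      have key : fc.length = fc'.length ∧ (fun s : ℕ => D.lab ((φ ^ (s : ℤ)) d)) =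
          fun s : ℕ => linv (D.lab ((φ ^ (-s : ℤ)) (D.flip d))) := by
        rcases Nat.lt_or_ge l fc.length with h1 | h1
        · rcases Nat.lt_or_ge l fc'.length with h2 | h2
          · exact hR.heavy hR' h1.le h2.le (by omega) heq
          · have := hR'.heavy hR (m := fc'.length) le_rfl (by omega) (by omega)
              fun s hs => (heq s (by omega)).symm
            exact ⟨this.1.symm, this.2.symm⟩
        · rcases Nat.le_total fc.length fc'.length with h2 | h2
          · exact hR.heavy hR' le_rfl h2 (by omega) fun s hs => heq s (by omega)
          · have := hR'.heavy hR (m := fc'.length) le_rfl h2 (by omega)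
              fun s hs => (heq s (by omega)).symm
            exact ⟨this.1.symm, this.2.symm⟩
      exact H.not_mirror hfc hfc'' hd hd' key.1 fun s => congrFun key.2 s
    · rw [H.flip_zpow_of_smooth hdd hmin (by omega)]
      intro h
      have h3 := H.zpow_mem hfc' hd' (-s)
      have h4 := H.face_unique hfc' (by simp) h3 h
      exact ho (h4 ▸ hd')
  · exfalso
    push Not at hex
    have heq : ∀ s : ℕ, D.lab ((φ ^ (s : ℤ)) d) = linv (D.lab ((φ ^ (-s : ℤ)) (D.flip d))) := by
      intro s
      rw [← H.flip_zpow_of_smooth hdd (l := s + 1) (fun t h1 _ => hex t h1) (by omega),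
        H.valid.lab_flip _ (H.zpow_mem_darts hdd _), linv_linv]
    have hR := H.isRel hfc hd
    have hR' := H.isRel_inv hfc'' hd'
    have hpos := hR.1
    have hpos' := hR'.1
    have key : fc.length = fc'.length := by
      rcases Nat.le_total fc.length fc'.length with h2 | h2
      · exact (hR.heavy hR' le_rfl h2 (by omega) fun s hs => heq s).1
      · exact (hR'.heavy hR (m := fc'.length) le_rfl h2 (by omega)
          fun s hs => (heq s).symm).1.symm
    exact H.not_mirror hfc hfc'' hd hd' key heq

open Classical in
theorem six_mul_interior_le {fc : List ℕ} (hfc : fc ∈ D.inner) :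
    6 * (fc.toFinset.filter fun d => D.flip d ∉ D.outer).card ≤
      (fc.toFinset.filter fun d => D.flip d ∉ D.outer ∧ ¬ D.Smooth φ (φ d)).card *
        (fc.length - 1) := by
  have hc1 : fc ∈ D.outer :: D.inner := List.mem_cons_of_mem _ hfc
  have hex : ∀ d, ∃ t : ℕ, d ∈ fc → D.flip d ∉ D.outer → 6 * (t + 1) < fc.length ∧
      (∀ s : ℕ, s ≤ t → D.flip ((φ ^ (s : ℤ)) d) ∉ D.outer) ∧
      ¬ D.Smooth φ ((φ ^ ((t + 1 : ℕ) : ℤ)) d) := by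
    intro d
    by_cases h : d ∈ fc ∧ D.flip d ∉ D.outer
    · obtain ⟨t, ht⟩ := H.exists_arc_end hfc h.1 h.2
      exact ⟨t, fun _ _ => ht⟩
    · exact ⟨0, fun h1 h2 => absurd ⟨h1, h2⟩ h⟩
  choose T hT using hex
  have h1 := Finset.card_le_mul_card_image_of_maps_to
    (s := fc.toFinset.filter fun d => D.flip d ∉ D.outer)
    (t := fc.toFinset.filter fun d => D.flip d ∉ D.outer ∧ ¬ D.Smooth φ (φ d))
    (f := fun d => (φ ^ (T d : ℤ)) d) ?_ ((fc.length - 1) / 6) ?_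
  · have h2 := Nat.div_mul_le_self (fc.length - 1) 6
    set a := (fc.length - 1) / 6
    set I := (fc.toFinset.filter fun d => D.flip d ∉ D.outer ∧ ¬ D.Smooth φ (φ d)).card
    have h3 := Nat.mul_le_mul_left I h2
    nlinarith
  · intro d hd
    simp only [Finset.mem_filter, List.mem_toFinset] at hd ⊢
    obtain ⟨-, h3, h4⟩ := hT d hd.1 hd.2
    refine ⟨H.zpow_mem hc1 hd.1 _, h3 _ le_rfl, ?_⟩
    rwa [show ((T d + 1 : ℕ) : ℤ) = 1 + T d by push_cast; ring, ← zpow_zpow_apply,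
      zpow_one] at h4
  · intro x hx
    have hsub : ((fc.toFinset.filter fun d => D.flip d ∉ D.outer).filter
        fun d => (φ ^ (T d : ℤ)) d = x) ⊆
        (Finset.range ((fc.length - 1) / 6)).image fun t : ℕ => (φ ^ (-t : ℤ)) x := by
      intro d hd
      simp only [Finset.mem_filter, List.mem_toFinset] at hd
      obtain ⟨h2, -, -⟩ := hT d hd.1.1 hd.1.2
      refine Finset.mem_image.2 ⟨T d, Finset.mem_range.2 (by omega), ?_⟩
      rw [← hd.2, zpow_zpow_apply]
      simp
    exact (Finset.card_le_card hsub).trans (Finset.card_image_le.trans (by simp))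

theorem smooth_next_of_ext {d : ℕ} (hd : d ∈ D.darts) (h1 : D.flip d ∈ D.outer)
    (h2 : D.flip (φ d) ∈ D.outer) : D.Smooth φ (φ d) := by
  have hd1 := H.next_mem_darts hd
  rw [H.smooth_next_iff hd]
  refine H.inj _ (H.next_mem (by simp) h2) _ h1 ?_
  rw [H.vert_next (H.valid.flip_mem _ hd1), H.valid.flip_flip _ hd1, H.vert_next hd]

theorem ext_next_iff {d : ℕ} (hd : d ∈ D.darts) (h : D.Smooth φ (φ d)) :
    D.flip (φ d) ∈ D.outer ↔ D.flip d ∈ D.outer := by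
  rw [H.smooth_next_iff hd] at h
  constructor
  · intro h1; rw [← h]; exact H.next_mem (by simp) h1
  · intro h1
    have := H.prev_mem (List.mem_cons_self ..) h1
    rwa [← h, perm_inv_apply] at this

open Classical in
theorem ext_le_int {fc : List ℕ} (hfc : fc ∈ D.inner) :
    (fc.toFinset.filter fun d => D.flip d ∈ D.outer ∧ ¬ D.Smooth φ (φ d)).card ≤
      (fc.toFinset.filter fun d => D.flip d ∉ D.outer ∧ ¬ D.Smooth φ (φ d)).card := by
  have hc1 : fc ∈ D.outer :: D.inner := List.mem_cons_of_mem _ hfc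
  have hdd : ∀ d ∈ fc, d ∈ D.darts := fun d hd => mem_darts.2 ⟨fc, hc1, hd⟩
  set F := fc.toFinset
  have hrot : (F.filter fun d => D.flip (φ d) ∈ D.outer).card =
      (F.filter fun d => D.flip d ∈ D.outer).card := by
    refine Finset.card_bij (fun d _ => φ d) ?_ (fun a _ b _ h => φ.injective h) ?_
    · intro d hd
      simp only [Finset.mem_filter, F, List.mem_toFinset] at hd ⊢
      exact ⟨H.next_mem hc1 hd.1, hd.2⟩
    · intro d hd
      simp only [Finset.mem_filter, F, List.mem_toFinset] at hd
      refine ⟨φ⁻¹ d, ?_, by simp⟩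
      simp only [Finset.mem_filter, F, List.mem_toFinset, perm_apply_inv]
      exact ⟨H.prev_mem hc1 hd.1, hd.2⟩
  have e1 : F.filter (fun d => D.flip d ∈ D.outer ∧ ¬ D.Smooth φ (φ d)) ⊆
      (F.filter fun d => D.flip d ∈ D.outer) \ F.filter fun d => D.flip (φ d) ∈ D.outer := by
    intro d hd
    simp only [Finset.mem_filter, F, List.mem_toFinset, Finset.mem_sdiff, not_and] at hd ⊢
    exact ⟨⟨hd.1, hd.2.1⟩, fun _ h => hd.2.2 (H.smooth_next_of_ext (hdd d hd.1) hd.2.1 h)⟩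
  have e2 : (F.filter fun d => D.flip (φ d) ∈ D.outer) \ F.filter (fun d => D.flip d ∈ D.outer) ⊆
      F.filter (fun d => D.flip d ∉ D.outer ∧ ¬ D.Smooth φ (φ d)) := by
    intro d hd
    simp only [Finset.mem_filter, F, List.mem_toFinset, Finset.mem_sdiff, not_and] at hd ⊢
    have h2 := hd.2 hd.1.1
    exact ⟨hd.1.1, h2, fun h => h2 ((H.ext_next_iff (hdd d hd.1.1) h).1 hd.1.2)⟩
  have h3 := Finset.card_le_card e1
  have h4 := Finset.card_le_card e2
  have h5 := Finset.card_sdiff_add_card_inter (F.filter fun d => D.flip d ∈ D.outer)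
    (F.filter fun d => D.flip (φ d) ∈ D.outer)
  have h6 := Finset.card_sdiff_add_card_inter (F.filter fun d => D.flip (φ d) ∈ D.outer)
    (F.filter fun d => D.flip d ∈ D.outer)
  rw [Finset.inter_comm] at h6
  omega

end Minimal
end PreDiagram
end GSC

namespace GSC

/-- The combinatorial information on the faces of a reduced simple disc diagram with boundary
word `B`: `own j` is the face adjacent to the `j`-th boundary edge, `brk j` tells whether the
`j`-th boundary vertex has degree at least three, and `len`, `int`, `cor` give for each face its
perimeter, its number of interior arcs and its number of exterior arcs. -/
structure Boundary {S : Type} (P : C6Presentation S) (B : Word S) where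
  m : ℕ
  len : Fin m → ℕ
  int : Fin m → ℕ
  cor : Fin m → ℕ
  own : ℕ → Fin m
  brk : ℕ → Bool
  len_pos : ∀ k, 1 ≤ len k
  gauss : 6 + ∑ k, (int k + 2 * cor k) ≤ 6 * m
  cor_eq : ∀ k, cor k = ((Finset.range B.length).filter fun j => own j = k ∧ brk j = true).card
  cor_le : ∀ k, cor k ≤ int k
  len_le : ∀ k, 6 * len k ≤ 6 * ((Finset.range B.length).filter fun j => own j = k).card +
    int k * (len k - 1)
  cor_pos : ∀ j < B.length, 1 ≤ cor (own j)
  run : ∀ a b, a < b → b ≤ B.length → (∀ t, a < t → t < b → brk t = false) →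
    (∀ t, a ≤ t → t < b → own t = own a) ∧ b - a ≤ len (own a) ∧
    ∃ f, P.IsRel (len (own a)) f ∧ ∀ t < b - a, B[a + t]? = some (f t)
  own_zero : brk 0 = false → own 0 = own (B.length - 1)
  chord : ∀ a b c d, a < b → b ≤ c → c < d → d ≤ B.length →
    (∀ t, a < t → t < b → brk t = false) → (∀ t, c < t → t < d → brk t = false) →
    own a = own c → ∃ v : Word S, P.elt v = (P.elt (B.take a))⁻¹ * P.elt (B.take d) ∧
      v.length + (b - a) + (d - c) ≤ len (own a)

namespace PreDiagram

variable {S : Type} {P : C6Presentation S}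

theorem outer_mem_darts {D : PreDiagram P} {d : ℕ} (hd : d ∈ D.outer) : d ∈ D.darts :=
  mem_darts.2 ⟨_, List.mem_cons_self .., hd⟩

theorem HasNext.pos_zpow {D : PreDiagram P} {φ : Equiv.Perm ℕ} (H : D.HasNext φ) {x : ℕ}
    (hx : x ∈ D.darts) (k : ℕ) : D.pos (D.vert ((φ ^ (k : ℤ)) x)) =
      D.pos (D.vert x) * P.elt ((List.range k).map fun t : ℕ => D.lab ((φ ^ (t : ℤ)) x)) := by
  induction k with
  | zero => simp
  | succ k ih =>
    have h1 : (φ ^ ((k + 1 : ℕ) : ℤ)) x = φ ((φ ^ (k : ℤ)) x) := by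
      rw [show ((k + 1 : ℕ) : ℤ) = 1 + k by push_cast; ring, ← zpow_zpow_apply, zpow_one]
    have hm := H.zpow_mem_darts hx k
    rw [h1, H.vert_next hm, H.valid.pos_flip _ hm, ih, List.range_succ, List.map_append,
      P.elt_append, mul_assoc]
    rfl

theorem HasNext.outer_eq {D : PreDiagram P} {φ : Equiv.Perm ℕ} (H : D.HasNext φ) {o : ℕ}
    (hl : 0 < D.outer.length) (ho : o = D.outer[0]) :
    D.outer = (List.range D.outer.length).map fun t : ℕ => (φ ^ (t : ℤ)) o := by
  refine List.ext_getElem (by simp) fun t h1 h2 => ?_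
  rw [List.getElem_map, List.getElem_range, ho, H.zpow_getElem (by simp) hl]
  simp [Nat.mod_eq_of_lt h1]

theorem HasNext.pos_outer {D : PreDiagram P} {φ : Equiv.Perm ℕ} (H : D.HasNext φ) {o : ℕ}
    (hl : 0 < D.outer.length) (ho : o = D.outer[0]) {j : ℕ} (hj : j ≤ D.outer.length) :
    D.pos (D.vert ((φ ^ (j : ℤ)) o)) = D.pos (D.vert o) * P.elt ((D.outer.map D.lab).take j) := by
  rw [H.pos_zpow (outer_mem_darts (ho ▸ List.getElem_mem _))]
  congr 2
  conv_rhs => rw [H.outer_eq hl ho]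
  rw [List.map_map, ← List.map_take, List.take_range, min_eq_left hj]
  rfl

namespace Minimal

variable {D : PreDiagram P} {φ : Equiv.Perm ℕ} (H : D.Minimal φ)
include H

theorem exists_inner {d : ℕ} (hd : d ∈ D.outer) : ∃ k : Fin D.inner.length, D.flip d ∈ D.inner[k] := by
  obtain ⟨fc, hfc, h⟩ := H.flip_mem_iff (outer_mem_darts hd)
  rcases List.mem_cons.1 hfc with rfl | hfc
  · exact absurd h (H.noext d hd)
  · obtain ⟨k, hk, rfl⟩ := List.getElem_of_mem hfc
    exact ⟨⟨k, hk⟩, h⟩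

theorem map_outer_mem_rels (hs : ∀ d ∈ D.outer, D.Smooth φ d) : D.outer.map D.lab ∈ P.rels := by
  have hl := List.length_pos_of_ne_nil H.outer_ne
  set o := D.outer[0] with ho
  have hom : o ∈ D.outer := List.getElem_mem _
  have hod := outer_mem_darts hom
  have hsm : ∀ t : ℕ, D.flip ((φ ^ (t : ℤ)) o) = (φ ^ (-t : ℤ)) (D.flip o) := fun t =>
    H.flip_zpow_of_smooth hod (l := t + 1) (fun s _ _ => hs _ (H.zpow_mem (by simp) hom _))
      (by omega)
  obtain ⟨k, hk⟩ := H.exists_inner hom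
  set fc := D.inner[k] with hfc
  have hfc1 : fc ∈ D.inner := List.getElem_mem _
  have hfc2 : fc ∈ D.outer :: D.inner := List.mem_cons_of_mem _ hfc1
  have hR := H.isRel_inv hfc1 hk
  have hlen : fc.length = D.outer.length := by
    rcases Nat.lt_trichotomy fc.length D.outer.length with h | h | h
    · exfalso
      have h1 := hsm fc.length
      have h2 := H.zpow_add_mul_length hfc2 hk 0 (-1)
      simp only [zero_add, neg_mul, one_mul, zpow_zero, Equiv.Perm.coe_one, id] at h2
      rw [h2] at h1
      have h3 := H.flip_inj (H.zpow_mem_darts hod _) hod h1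
      have := H.zpow_inj (by simp) hom (s := fc.length) (t := 0) h hl (by simpa using h3)
      have := hR.1
      omega
    · exact h
    · exfalso
      have h1 := hsm D.outer.length
      rw [H.zpow_length (by simp) hom] at h1
      have h2 : (φ ^ (D.outer.length : ℤ)) (D.flip o) = D.flip o := by
        conv_lhs => rw [h1]
        rw [zpow_zpow_apply]; simp
      have := H.zpow_inj hfc2 hk (s := D.outer.length) (t := 0) h (by omega) (by simpa using h2)
      omega
  rw [H.outer_eq hl ho, List.map_map, ← hlen]
  convert hR.2.1 using 1
  refine List.map_congr_left fun t _ => ?_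
  rw [Function.comp, ← hsm, H.valid.lab_flip _ (H.zpow_mem_darts hod _), linv_linv]

/-- A face with an exterior edge has an exterior corner, unless the boundary is a face. -/
theorem exists_corner (hns : ∃ d ∈ D.outer, ¬ D.Smooth φ d) {fc : List ℕ} (hfc : fc ∈ D.inner)
    {d : ℕ} (hd : d ∈ fc) (ho : D.flip d ∈ D.outer) :
    ∃ e ∈ fc, D.flip e ∈ D.outer ∧ ¬ D.Smooth φ (φ e) := by
  by_contra! hcon
  have hfc2 : fc ∈ D.outer :: D.inner := List.mem_cons_of_mem _ hfc
  have hdd : ∀ e ∈ fc, e ∈ D.darts := fun e he => mem_darts.2 ⟨fc, hfc2, he⟩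
  have hsucc : ∀ (t : ℕ) x, (φ ^ ((t + 1 : ℕ) : ℤ)) x = φ ((φ ^ (t : ℤ)) x) := fun t x => by
    rw [show ((t + 1 : ℕ) : ℤ) = 1 + t by push_cast; ring, ← zpow_zpow_apply, zpow_one]
  have hall : ∀ t : ℕ, D.flip ((φ ^ (t : ℤ)) d) ∈ D.outer := by
    intro t
    induction t with
    | zero => simpa using ho
    | succ t ih =>
      have hm := H.zpow_mem hfc2 hd t
      rw [hsucc, H.ext_next_iff (hdd _ hm) (hcon _ hm ih)]
      exact ih
  have hsm : ∀ t : ℕ, D.flip ((φ ^ (t : ℤ)) d) = (φ ^ (-t : ℤ)) (D.flip d) := fun t =>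
    H.flip_zpow_of_smooth (hdd d hd) (l := t + 1) (fun s h1 _ => by
      obtain ⟨r, rfl⟩ : ∃ r, s = r + 1 := ⟨s - 1, by omega⟩
      rw [hsucc]
      exact hcon _ (H.zpow_mem hfc2 hd _) (hall r)) (by omega)
  obtain ⟨x, hx, hxs⟩ := hns
  obtain ⟨t, ht, htx⟩ := H.exists_zpow (List.mem_cons_self ..) hx ho
  have h1 : (φ ^ (-t : ℤ)) (D.flip d) = x := by rw [← htx, zpow_zpow_apply]; simp
  rw [← h1, ← hsm, ← H.smooth_next_iff_flip (hdd _ (H.zpow_mem hfc2 hd _))] at hxs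
  exact hxs (hcon _ (H.zpow_mem hfc2 hd _) (hall t))

open Classical in
theorem card_ext_eq {o : ℕ} (ho : o ∈ D.outer) (p : ℕ → Prop) {fc : List ℕ}
    (hfc : fc ∈ D.inner) :
    (fc.toFinset.filter fun d => D.flip d ∈ D.outer ∧ p (D.flip d)).card =
    ((Finset.range D.outer.length).filter fun j : ℕ => D.flip ((φ ^ (j : ℤ)) o) ∈ fc ∧
      p ((φ ^ (j : ℤ)) o)).card := by
  symm
  have hdd : ∀ e ∈ fc, e ∈ D.darts := fun e he => mem_darts.2 ⟨fc, by simp [hfc], he⟩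
  have hoj : ∀ j : ℕ, (φ ^ (j : ℤ)) o ∈ D.outer := fun j => H.zpow_mem (by simp) ho _
  refine Finset.card_bij (fun j _ => D.flip ((φ ^ (j : ℤ)) o)) ?_ ?_ ?_
  · intro j hj
    simp only [Finset.mem_filter, List.mem_toFinset, Finset.mem_range] at hj ⊢
    rw [H.valid.flip_flip _ (outer_mem_darts (hoj j))]
    exact ⟨hj.2.1, hoj j, hj.2.2⟩
  · intro i hi j hj h
    simp only [Finset.mem_filter, Finset.mem_range] at hi hj
    exact H.zpow_inj (by simp) ho hi.1 hj.1
      (H.flip_inj (outer_mem_darts (hoj i)) (outer_mem_darts (hoj j)) h)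
  · intro d hd
    simp only [Finset.mem_filter, List.mem_toFinset] at hd
    obtain ⟨t, ht, htd⟩ := H.exists_zpow (List.mem_cons_self ..) ho hd.2.1
    have h1 : D.flip ((φ ^ (t : ℤ)) o) = d := by rw [htd, H.valid.flip_flip d (hdd d hd.1)]
    refine ⟨t, ?_, h1⟩
    simp only [Finset.mem_filter, Finset.mem_range]
    rw [h1, htd]
    exact ⟨ht, hd.1, hd.2.2⟩

open Classical in
theorem card_not_smooth_face {fc : List ℕ} (hfc : fc ∈ D.outer :: D.inner) :
    (fc.toFinset.filter fun d => ¬ D.Smooth φ d).card =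
    (fc.toFinset.filter fun d => D.flip d ∈ D.outer ∧ ¬ D.Smooth φ (φ d)).card +
    (fc.toFinset.filter fun d => D.flip d ∉ D.outer ∧ ¬ D.Smooth φ (φ d)).card := by
  have h1 : (fc.toFinset.filter fun d => ¬ D.Smooth φ (φ d)).card =
      (fc.toFinset.filter fun d => ¬ D.Smooth φ d).card := by
    refine Finset.card_bij (fun d _ => φ d) ?_ (fun a _ b _ h => φ.injective h) ?_
    · intro d hd
      simp only [Finset.mem_filter, List.mem_toFinset] at hd ⊢
      exact ⟨H.next_mem hfc hd.1, hd.2⟩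
    · intro d hd
      simp only [Finset.mem_filter, List.mem_toFinset] at hd
      refine ⟨φ⁻¹ d, ?_, by simp⟩
      simp only [Finset.mem_filter, List.mem_toFinset, perm_apply_inv]
      exact ⟨H.prev_mem hfc hd.1, hd.2⟩
  rw [← h1, ← Finset.card_union_of_disjoint]
  · congr 1
    ext d
    simp only [Finset.mem_filter, Finset.mem_union]
    tauto
  · rw [Finset.disjoint_filter]
    tauto

open Classical in
theorem card_not_smooth : (D.darts.toFinset.filter fun d => ¬ D.Smooth φ d).card =
    (D.outer.toFinset.filter fun d => ¬ D.Smooth φ d).card +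
    ∑ k : Fin D.inner.length, (D.inner[k].toFinset.filter fun d => ¬ D.Smooth φ d).card := by
  have hc : ∀ l : List ℕ, l.Nodup → (l.toFinset.filter fun d => ¬ D.Smooth φ d).card =
      l.countP fun d => decide (¬ D.Smooth φ d) := by
    intro l hl
    rw [List.countP_eq_length_filter, ← List.toFinset_card_of_nodup (hl.filter _),
      List.toFinset_filter]
    congr 1
    ext d
    simp
  rw [hc _ H.valid.nodup, darts, List.countP_append, List.countP_flatten,
    hc _ (H.face_nodup (by simp))]
  congr 1
  rw [← Fin.sum_univ_fun_getElem]
  refine Finset.sum_congr rfl fun k _ => ?_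
  exact (hc _ (H.face_nodup (List.mem_cons_of_mem _ (List.getElem_mem _)))).symm

end Minimal
end PreDiagram
end GSC

namespace GSC
namespace PreDiagram

variable {S : Type} {P : C6Presentation S}

namespace Minimal

variable {D : PreDiagram P} {φ : Equiv.Perm ℕ} (H : D.Minimal φ)
include H

theorem flip_run {o : ℕ} (ho : o ∈ D.outer) {a b : ℕ}
    (hs : ∀ t : ℕ, a < t → t < b → D.Smooth φ ((φ ^ (t : ℤ)) o)) {t : ℕ} (ht : a + t < b) :
    D.flip ((φ ^ ((a + t : ℕ) : ℤ)) o) = (φ ^ (-t : ℤ)) (D.flip ((φ ^ (a : ℤ)) o)) := by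
  have hz : ∀ t : ℕ, (φ ^ ((a + t : ℕ) : ℤ)) o = (φ ^ (t : ℤ)) ((φ ^ (a : ℤ)) o) := fun t => by
    rw [zpow_zpow_apply]; congr 2; push_cast; ring
  rw [hz]
  refine H.flip_zpow_of_smooth (outer_mem_darts (H.zpow_mem (by simp) ho _)) (l := b - a)
    (fun s h1 h2 => ?_) (by omega)
  rw [← hz]
  exact hs _ (by omega) (by omega)

theorem run_le {o : ℕ} (ho : o ∈ D.outer) {a b : ℕ} (hb : b ≤ D.outer.length)
    (hs : ∀ t : ℕ, a < t → t < b → D.Smooth φ ((φ ^ (t : ℤ)) o)) {fc : List ℕ}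
    (hfc : fc ∈ D.inner) (hz : D.flip ((φ ^ (a : ℤ)) o) ∈ fc) : b - a ≤ fc.length := by
  by_contra hlt
  have hfc2 : fc ∈ D.outer :: D.inner := List.mem_cons_of_mem _ hfc
  have h1 := H.flip_run ho hs (t := fc.length) (by omega)
  have h2 := H.zpow_add_mul_length hfc2 hz 0 (-1)
  simp only [zero_add, neg_mul, one_mul, zpow_zero, Equiv.Perm.coe_one, id] at h2
  rw [h2] at h1
  have h3 := H.flip_inj (outer_mem_darts (H.zpow_mem (by simp) ho _))
    (outer_mem_darts (H.zpow_mem (by simp) ho _)) h1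
  have h4 := H.zpow_inj (by simp) ho (by omega) (by omega) h3
  have := List.length_pos_of_mem hz
  omega

theorem exists_chord {o : ℕ} (ho : o ∈ D.outer) {a b c d : ℕ} (hab : a < b) (hbc : b ≤ c)
    (hcd : c < d) (hd : d ≤ D.outer.length)
    (hs : ∀ t : ℕ, a < t → t < b → D.Smooth φ ((φ ^ (t : ℤ)) o))
    (hs' : ∀ t : ℕ, c < t → t < d → D.Smooth φ ((φ ^ (t : ℤ)) o)) {fc : List ℕ}
    (hfc : fc ∈ D.inner) (hza : D.flip ((φ ^ (a : ℤ)) o) ∈ fc)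
    (hzc : D.flip ((φ ^ (c : ℤ)) o) ∈ fc) :
    ∃ v : Word S, D.pos (D.vert ((φ ^ (d : ℤ)) o)) = D.pos (D.vert ((φ ^ (a : ℤ)) o)) * P.elt v ∧
      v.length + (b - a) + (d - c) ≤ fc.length := by
  have hfc2 : fc ∈ D.outer :: D.inner := List.mem_cons_of_mem _ hfc
  have hod : ∀ t : ℕ, (φ ^ (t : ℤ)) o ∈ D.darts := fun t =>
    outer_mem_darts (H.zpow_mem (by simp) ho _)
  set z := D.flip ((φ ^ (a : ℤ)) o) with hz
  have hzd : z ∈ D.darts := mem_darts.2 ⟨fc, hfc2, hza⟩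
  obtain ⟨e, rfl⟩ : ∃ e, d = c + e + 1 := ⟨d - c - 1, by omega⟩
  have hlast := H.flip_run ho hs' (t := e) (by omega)
  have hmem : D.flip ((φ ^ ((c + e : ℕ) : ℤ)) o) ∈ fc := hlast ▸ H.zpow_mem hfc2 hzc _
  obtain ⟨s, hs1, hs2⟩ := H.exists_zpow hfc2 hza hmem
  have hinj : ∀ i j : ℕ, i < D.outer.length → j < D.outer.length →
      D.flip ((φ ^ (i : ℤ)) o) = D.flip ((φ ^ (j : ℤ)) o) → i = j := fun i j hi hj h =>
    H.zpow_inj (by simp) ho hi hj (H.flip_inj (hod i) (hod j) h)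
  have hs0 : s ≠ 0 := by
    rintro rfl
    have := hinj a (c + e) (by omega) (by omega) (by rw [← hs2, hz]; simp)
    omega
  have key : s + e < fc.length - (b - a - 1) := by
    by_contra hlt
    have hle := H.run_le ho (by omega) hs hfc hza
    have hov : ∃ j t : ℕ, j ≤ e ∧ t < b - a ∧ (s : ℤ) + (e - j : ℕ) = fc.length - t := by
      rcases Nat.le_total s (fc.length - (b - a - 1)) with h1 | h1
      · exact ⟨e - (fc.length - (b - a - 1) - s), b - a - 1, by omega, by omega, by omega⟩
      · exact ⟨e, fc.length - s, by omega, by omega, by omega⟩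
    obtain ⟨j, t, hj, ht, hjt⟩ := hov
    have h1 := H.flip_run ho hs (t := t) (by omega)
    have h2 := H.flip_run ho hs' (t := j) (by omega)
    have h3 : D.flip ((φ ^ (c : ℤ)) o) = (φ ^ ((e : ℤ) + s)) z := by
      rw [← zpow_zpow_apply, hs2, hlast, zpow_zpow_apply]; simp
    rw [h3, zpow_zpow_apply, show -(j : ℤ) + (e + s) = -t + 1 * fc.length by omega,
      H.zpow_add_mul_length hfc2 hza, ← h1] at h2
    have := hinj _ _ (by omega) (by omega) h2
    omega
  obtain ⟨r, rfl⟩ : ∃ r, s = r + 1 := ⟨s - 1, by omega⟩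
  refine ⟨(List.range r).map fun t : ℕ => D.lab ((φ ^ (t : ℤ)) (φ z)), ?_, by simp; omega⟩
  have h4 := H.pos_zpow (H.next_mem_darts hzd) r
  rw [H.vert_next hzd, hz, H.valid.flip_flip _ (hod a), ← hz] at h4
  rw [← h4]
  have h5 : φ ((φ ^ ((c + e : ℕ) : ℤ)) o) = (φ ^ ((c + e + 1 : ℕ) : ℤ)) o := by
    rw [show ((c + e + 1 : ℕ) : ℤ) = 1 + (c + e : ℕ) by push_cast; ring, ← zpow_zpow_apply,
      zpow_one]
  rw [← h5, H.vert_next (hod _), ← hs2]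
  have h6 : φ z = (φ ^ (1 : ℤ)) z := by simp
  rw [h6, zpow_zpow_apply]
  rfl

theorem exists_boundary (hns : ∃ d ∈ D.outer, ¬ D.Smooth φ d) :
    Nonempty (Boundary P (D.outer.map D.lab)) := by
  classical
  have hl := List.length_pos_of_ne_nil H.outer_ne
  set o := D.outer[0] with ho
  have hom : o ∈ D.outer := List.getElem_mem _
  have houter := H.outer_eq hl ho
  have hoj : ∀ j : ℕ, (φ ^ (j : ℤ)) o ∈ D.outer := fun j => H.zpow_mem (by simp) hom _
  have hod : ∀ j : ℕ, (φ ^ (j : ℤ)) o ∈ D.darts := fun j => outer_mem_darts (hoj j)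
  choose own hown using fun j : ℕ => H.exists_inner (hoj j)
  have hin : ∀ k : Fin D.inner.length, D.inner[k] ∈ D.inner := fun k => List.getElem_mem _
  have hin2 : ∀ k : Fin D.inner.length, D.inner[k] ∈ D.outer :: D.inner := fun k =>
    List.mem_cons_of_mem _ (hin k)
  have hdis : ∀ j k : Fin D.inner.length, ∀ x ∈ D.inner[j], x ∈ D.inner[k] → j = k := by
    intro j k x hj hk
    have h1 := H.valid.nodup
    rw [darts, List.nodup_append, List.nodup_flatten] at h1
    by_contra hne
    rcases lt_or_gt_of_ne hne with h | h
    · exact List.pairwise_iff_getElem.1 h1.2.1.2 _ _ j.2 k.2 h hj hk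
    · exact List.pairwise_iff_getElem.1 h1.2.1.2 _ _ k.2 j.2 h hk hj
  have hiff : ∀ j k, own j = k ↔ D.flip ((φ ^ (j : ℤ)) o) ∈ D.inner[k] := fun j k =>
    ⟨fun h => h ▸ hown j, fun h => hdis _ _ _ (hown j) h⟩
  have hB : ∀ j < D.outer.length, (D.outer.map D.lab)[j]? = some (D.lab ((φ ^ (j : ℤ)) o)) := by
    intro j hj
    conv_lhs => rw [houter]
    simp [hj]
  have htake : ∀ j ≤ D.outer.length, D.pos (D.vert ((φ ^ (j : ℤ)) o)) =
      D.pos (D.vert o) * P.elt ((D.outer.map D.lab).take j) := fun j hj =>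
    H.pos_outer hl ho hj
  let int : Fin D.inner.length → ℕ := fun k =>
    (D.inner[k].toFinset.filter fun d => D.flip d ∉ D.outer ∧ ¬ D.Smooth φ (φ d)).card
  let cor : Fin D.inner.length → ℕ := fun k =>
    (D.inner[k].toFinset.filter fun d => D.flip d ∈ D.outer ∧ ¬ D.Smooth φ (φ d)).card
  have hcor : ∀ k, cor k = ((Finset.range D.outer.length).filter fun j : ℕ => own j = k ∧
      ¬ D.Smooth φ ((φ ^ (j : ℤ)) o)).card := by
    intro k
    simp only [hiff]
    refine Eq.trans ?_ ((H.card_ext_eq hom (fun d => ¬ D.Smooth φ d) (hin k)).trans ?_)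
    · refine congrArg Finset.card (Finset.ext fun d => ?_)
      simp only [Finset.mem_filter, List.mem_toFinset]
      refine and_congr_right fun hd => ?_
      rw [H.smooth_next_iff_flip (mem_darts.2 ⟨_, hin2 k, hd⟩)]
    · refine congrArg Finset.card (Finset.ext fun d => ?_)
      simp only [Finset.mem_filter]
  have hext : ∀ k, (D.inner[k].toFinset.filter fun d => D.flip d ∈ D.outer).card =
      ((Finset.range D.outer.length).filter fun j : ℕ => own j = k).card := by
    intro k
    simp only [hiff]
    have := H.card_ext_eq hom (fun _ => True) (hin k)
    simpa using this
  let brk : ℕ → Bool := fun j => decide (¬ D.Smooth φ ((φ ^ (j : ℤ)) o))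
  have hbrk : ∀ j, brk j = false ↔ D.Smooth φ ((φ ^ (j : ℤ)) o) := fun j => by simp [brk]
  have hbrk' : ∀ j, brk j = true ↔ ¬ D.Smooth φ ((φ ^ (j : ℤ)) o) := fun j => by simp [brk]
  refine ⟨⟨D.inner.length, fun k => D.inner[k].length, int, cor, own, brk,
    ?_, ?_, ?_, ?_, ?_, ?_, ?_, ?_, ?_⟩⟩
  · exact fun k => List.length_pos_of_ne_nil (H.valid.inner_ne _ (hin k))
  · have h1 := H.gauss_bonnet
    rw [H.card_not_smooth] at h1
    have h2 : (D.outer.toFinset.filter fun d => ¬ D.Smooth φ d).card = ∑ k, cor k := by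
      have h3 : (D.outer.toFinset.filter fun d => ¬ D.Smooth φ d).card =
          ((Finset.range D.outer.length).filter fun j : ℕ => ¬ D.Smooth φ ((φ ^ (j : ℤ)) o)).card := by
        symm
        refine Finset.card_bij (fun (j : ℕ) _ => (φ ^ (j : ℤ)) o) ?_ ?_ ?_
        · intro j hj
          simp only [Finset.mem_filter, List.mem_toFinset] at hj ⊢
          exact ⟨hoj j, hj.2⟩
        · intro i hi j hj h
          simp only [Finset.mem_filter, Finset.mem_range] at hi hj
          exact H.zpow_inj (by simp) hom hi.1 hj.1 h
        · intro d hd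
          simp only [Finset.mem_filter, List.mem_toFinset] at hd
          obtain ⟨t, ht, rfl⟩ := H.exists_zpow (List.mem_cons_self ..) hom hd.1
          exact ⟨t, by simpa [ht] using hd.2, rfl⟩
      rw [h3, Finset.card_eq_sum_card_fiberwise (f := own) (t := Finset.univ) (by simp)]
      refine Finset.sum_congr rfl fun k _ => ?_
      rw [hcor, Finset.filter_filter]
      simp only [and_comm]
    rw [h2] at h1
    refine le_trans (le_of_eq ?_) h1
    congr 1
    rw [← Finset.sum_add_distrib]
    refine Finset.sum_congr rfl fun k _ => ?_
    rw [H.card_not_smooth_face (hin2 k)]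
    simp only [cor, int]
    ring
  · intro k
    rw [hcor, List.length_map]
    simp only [hbrk']
  · exact fun k => H.ext_le_int (hin k)
  · intro k
    have h1 := H.six_mul_interior_le (hin k)
    have h2 := Finset.card_filter_add_card_filter_not (s := D.inner[k].toFinset)
      (fun d => D.flip d ∈ D.outer)
    rw [List.toFinset_card_of_nodup (H.face_nodup (hin2 k)), hext] at h2
    rw [List.length_map]
    simp only [int]
    omega
  · intro j _
    obtain ⟨e, he, he1, he2⟩ := H.exists_corner hns (hin (own j)) (hown j)
      (by rw [H.valid.flip_flip _ (hod j)]; exact hoj j)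
    refine Finset.card_pos.2 ⟨e, ?_⟩
    simp only [Finset.mem_filter, List.mem_toFinset]
    exact ⟨he, he1, he2⟩
  · intro a b hab hb hs
    simp only [hbrk, List.length_map] at hs hb
    refine ⟨fun t h1 h2 => ?_, H.run_le hom hb hs (hin _) (hown a), _,
      H.isRel_inv (hin _) (hown a), fun t ht => ?_⟩
    · obtain ⟨t, rfl⟩ := Nat.exists_eq_add_of_le h1
      rw [hiff, H.flip_run hom hs h2]
      exact H.zpow_mem (hin2 _) (hown a) _
    · rw [hB _ (by omega), ← H.flip_run hom hs (by omega : a + t < b),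
        H.valid.lab_flip _ (hod _), linv_linv]
  · intro h0
    rw [hbrk] at h0
    rw [List.length_map]
    have h1 : φ ((φ ^ ((D.outer.length - 1 : ℕ) : ℤ)) o) = (φ ^ ((0 : ℕ) : ℤ)) o := by
      have h2 := H.zpow_length (List.mem_cons_self ..) hom
      have h3 : (D.outer.length : ℤ) = 1 + (D.outer.length - 1 : ℕ) := by omega
      rw [h3, ← zpow_zpow_apply, zpow_one] at h2
      simpa using h2
    rw [← h1, H.smooth_next_iff (hod _), h1] at h0
    symm
    rw [hiff, ← h0]
    exact H.next_mem (hin2 _) (hown 0)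
  · intro a b c d hab hbc hcd hd hs hs' hac
    simp only [hbrk, List.length_map] at hs hs' hd
    obtain ⟨v, hv1, hv2⟩ := H.exists_chord hom hab hbc hcd hd hs hs' (hin _) (hown a)
      ((hiff _ _).1 hac.symm)
    refine ⟨v, ?_, hv2⟩
    rw [htake d hd, htake a (by omega), mul_assoc, mul_left_cancel_iff] at hv1
    rw [hv1]
    group

end Minimal

theorem HasNext.minimal {D : PreDiagram P} {φ : Equiv.Perm ℕ} (H : D.HasNext φ)
    (hne : D.outer ≠ [])
    (hinj : ∀ i j, i < j → j < D.outer.length →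
      P.elt ((D.outer.map D.lab).take i) ≠ P.elt ((D.outer.map D.lab).take j))
    (hx : ∀ x, D.outer.map D.lab ≠ [x, linv x])
    (hmin : ∀ n < D.inner.length, ¬ P.Area n (FreeGroup.mk (D.outer.map D.lab))) :
    D.Minimal φ := by
  have hl := List.length_pos_of_ne_nil hne
  set o := D.outer[0] with ho
  have hom : o ∈ D.outer := List.getElem_mem _
  have hout : D.outer ∈ D.outer :: D.inner := List.mem_cons_self ..
  have inj : ∀ d ∈ D.outer, ∀ e ∈ D.outer, D.vert d = D.vert e → d = e := by
    intro d hd e he hde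
    obtain ⟨i, hi, rfl⟩ := H.exists_zpow hout hom hd
    obtain ⟨j, hj, rfl⟩ := H.exists_zpow hout hom he
    have h1 := congrArg D.pos hde
    rw [H.pos_outer hl ho hi.le, H.pos_outer hl ho hj.le, mul_left_cancel_iff] at h1
    rcases Nat.lt_trichotomy i j with h | rfl | h
    · exact absurd h1 (hinj i j h hj)
    · rfl
    · exact absurd h1.symm (hinj j i h hi)
  refine ⟨H, hne, inj, fun d hd hf => ?_, hmin⟩
  have hdd := outer_mem_darts hd
  have h1 : φ d = D.flip d := inj _ (H.next_mem hout hd) _ hf (H.vert_next hdd)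
  have h2 : φ (D.flip d) = d := inj _ (H.next_mem hout hf) _ hd (by
    rw [H.vert_next (outer_mem_darts hf), H.valid.flip_flip d hdd])
  have h3 : (φ ^ ((2 : ℕ) : ℤ)) d = d := by
    rw [show ((2 : ℕ) : ℤ) = 1 + 1 by norm_num, ← zpow_zpow_apply, zpow_one, h1, h2]
  rcases Nat.lt_or_ge 2 D.outer.length with h | h
  · have := H.zpow_inj hout hd h hl (by simpa using h3)
    omega
  obtain ⟨i, hi⟩ := H.rotate_eq hout hd
  have hcases : D.outer.length = 1 ∨ D.outer.length = 2 := by omega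
  rcases hcases with h4 | h4
  · obtain ⟨x, hx⟩ := List.length_eq_one_iff.1 h4
    rw [hx, List.mem_singleton] at hd hf
    exact H.valid.flip_ne d hdd (by rw [hf, hd])
  · obtain ⟨x, y, hxy⟩ := List.length_eq_two.1 h4
    have hflip : D.flip x = y := by
      have hnd := H.face_nodup hout
      rw [hxy] at hd hf hnd
      simp only [List.mem_cons, List.not_mem_nil, or_false] at hd hf
      have hfd := H.valid.flip_ne d hdd
      have hff := H.valid.flip_flip d hdd
      rcases hd with rfl | rfl <;> rcases hf with hf | hf
      · exact absurd hf hfd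
      · exact hf
      · rw [← hff, ← hf]
      · exact absurd hf hfd
    refine hx (D.lab x) ?_
    rw [hxy, ← H.valid.lab_flip x (outer_mem_darts (by simp [hxy])), hflip]
    rfl

end PreDiagram

/-- A simple closed word is a relator or bounds a reduced disc diagram. -/
theorem C6Presentation.mem_rels_or_boundary {S : Type} (P : C6Presentation S) {B : Word S}
    (hne : B ≠ []) (h1 : P.elt B = 1)
    (hinj : ∀ i j, i < j → j < B.length → P.elt (B.take i) ≠ P.elt (B.take j))
    (hx : ∀ x, B ≠ [x, linv x]) : B ∈ P.rels ∨ Nonempty (Boundary P B) := by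
  classical
  have hex := P.exists_area h1
  have : Inhabited S := ⟨(B.head hne).1⟩
  obtain ⟨D, hD, rfl, hn⟩ := (Nat.find_spec hex).hasDiagram
  obtain ⟨φ, H⟩ := hD.exists_hasNext
  have hM : D.Minimal φ := H.minimal (by simpa using hne) (by simpa using hinj) hx
    fun n hlt => Nat.find_min hex (hn ▸ hlt)
  by_cases hs : ∀ d ∈ D.outer, D.Smooth φ d
  · exact Or.inl (hM.map_outer_mem_rels hs)
  · push Not at hs
    exact Or.inr (hM.exists_boundary hs)
end GSC

namespace GSC

variable {S : Type} {P : C6Presentation S}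

/-- A word is geodesic if it is a shortest representative of its value. -/
def C6Presentation.Geod (P : C6Presentation S) (w : Word S) : Prop :=
  ∀ v, P.elt v = P.elt w → w.length ≤ v.length

/-- The subword of length `m` at position `i` of an infinite word. -/
def seg (W : ℕ → S × Bool) (i m : ℕ) : Word S := (List.range m).map fun t => W (i + t)

@[simp] theorem length_seg (W : ℕ → S × Bool) (i m : ℕ) : (seg W i m).length = m := by simp [seg]

theorem seg_add (W : ℕ → S × Bool) (i m n : ℕ) : seg W i (m + n) = seg W i m ++ seg W (i + m) n := by
  simp [seg, List.range_add, add_assoc, Function.comp_def]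

theorem take_seg (W : ℕ → S × Bool) (i : ℕ) {m n : ℕ} (h : m ≤ n) :
    (seg W i n).take m = seg W i m := by
  obtain ⟨k, rfl⟩ := Nat.exists_eq_add_of_le h
  rw [seg_add, List.take_left' (by simp)]

theorem C6Presentation.exists_geod (P : C6Presentation S) (g : P.Grp) :
    ∃ w, P.elt w = g ∧ P.Geod w := by
  classical
  have hex : ∃ n, ∃ w : Word S, w.length = n ∧ P.elt w = g := by
    obtain ⟨w, hw⟩ := P.elt_surjective g
    exact ⟨_, w, rfl, hw⟩
  obtain ⟨w, hw, hg⟩ := Nat.find_spec hex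
  refine ⟨w, hg, fun v hv => ?_⟩
  rw [hw]
  exact Nat.find_min' hex ⟨v, rfl, hv.trans hg⟩

namespace C6Presentation

theorem Geod.middle {x y z : Word S} (h : P.Geod (x ++ y ++ z)) : P.Geod y := by
  intro v hv
  have := h (x ++ v ++ z) (by simp only [P.elt_append, hv])
  simp at this
  omega

theorem Geod.left {x y : Word S} (h : P.Geod (x ++ y)) : P.Geod x :=
  Geod.middle (x := []) (z := y) (by simpa using h)

theorem Geod.right {x y : Word S} (h : P.Geod (x ++ y)) : P.Geod y :=
  Geod.middle (x := x) (z := []) (by simpa using h)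

theorem geod_nil : P.Geod [] := fun v _ => by simp

theorem Geod.inv {w : Word S} (h : P.Geod w) : P.Geod (wordInv w) := by
  intro v hv
  have := h (wordInv v) (by rw [P.elt_wordInv, hv, P.elt_wordInv, inv_inv])
  simpa using this

theorem Geod.eq_nil {w : Word S} (h : P.Geod w) (h1 : P.elt w = 1) : w = [] := by
  have := h [] (by simp [h1])
  simpa using this

theorem IsRel.elt_seg {n : ℕ} {f : ℕ → S × Bool} (h : P.IsRel n f) (i : ℕ) :
    P.elt (seg f i n) = 1 := P.elt_rel (h.shift i).2.1

theorem IsRel.two_mul_le {n m : ℕ} {f : ℕ → S × Bool} (h : P.IsRel n f) (hm : m ≤ n)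
    (hg : P.Geod (seg f 0 m)) : 2 * m ≤ n := by
  have h1 := h.elt_seg 0
  rw [← Nat.add_sub_cancel' hm, seg_add, P.elt_append] at h1
  have := hg (wordInv (seg f (0 + m) (n - m))) (by
    rw [P.elt_wordInv]; exact (eq_inv_of_mul_eq_one_left h1).symm)
  simp at this
  omega

end C6Presentation

theorem drop_take_of_run {B : Word S} {f : ℕ → S × Bool} {a l : ℕ}
    (h : ∀ t < l, B[a + t]? = some (f t)) : (B.drop a).take l = seg f 0 l := by
  refine List.ext_getElem? fun t => ?_
  rcases Nat.lt_or_ge t l with ht | ht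
  · rw [List.getElem?_take_of_lt ht, List.getElem?_drop, h t ht]
    simp [seg, ht]
  · rw [List.getElem?_eq_none (by simp; omega), List.getElem?_eq_none (by simpa using ht)]

theorem drop_take_append {x s y : Word S} {a l : ℕ} (h1 : x.length ≤ a)
    (h2 : a + l ≤ x.length + s.length) :
    ((x ++ s ++ y).drop a).take l = (s.drop (a - x.length)).take l := by
  obtain ⟨c, rfl⟩ := Nat.exists_eq_add_of_le h1
  rw [List.append_assoc, List.drop_append, List.drop_eq_nil_of_le (by omega)]
  simp only [List.nil_append, Nat.add_sub_cancel_left]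
  rw [List.drop_append_of_le_length (by omega), List.take_append_of_le_length (by simp; omega)]

theorem C6Presentation.Geod.drop_take {s : Word S} (h : P.Geod s) (a l : ℕ) :
    P.Geod ((s.drop a).take l) := by
  refine C6Presentation.Geod.left (y := (s.drop a).drop l) ?_
  rw [List.take_append_drop]
  refine C6Presentation.Geod.right (x := s.take a) ?_
  rwa [List.take_append_drop]

/-- A run along a relator inside a geodesic side covers at most half of the relator. -/
theorem C6Presentation.IsRel.two_mul_le_of_run {B x s y : Word S} {n a l : ℕ}
    {f : ℕ → S × Bool} (h : P.IsRel n f) (hB : B = x ++ s ++ y) (hs : P.Geod s)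
    (hr : ∀ t < l, B[a + t]? = some (f t)) (hl : l ≤ n) (h1 : x.length ≤ a)
    (h2 : a + l ≤ x.length + s.length) : 2 * l ≤ n := by
  refine h.two_mul_le hl ?_
  rw [← drop_take_of_run hr, hB, drop_take_append h1 h2]
  exact hs.drop_take _ _

/-- A periodic word in which relators occur only in small proportion. -/
structure Good (P : C6Presentation S) (W : ℕ → S × Bool) (L K : ℕ) : Prop where
  period_pos : 1 ≤ L
  periodic : ∀ i, W (i + L) = W i
  K_pos : 1 ≤ K
  reduced : ∀ i, W (i + 1) ≠ linv (W i)
  small : ∀ n f i m, P.IsRel n f → m ≤ n → (∀ t < m, f t = W (i + t)) → 6 * m ≤ 2 * n + 3 ∧ m ≤ K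

theorem Good.small_of_run {W : ℕ → S × Bool} {L K : ℕ} (hW : Good P W L K) {B y : Word S}
    {n a l i m : ℕ} {f : ℕ → S × Bool} (h : P.IsRel n f) (hB : B = seg W i m ++ y)
    (hr : ∀ t < l, B[a + t]? = some (f t)) (hl : l ≤ n) (h2 : a + l ≤ m) :
    6 * l ≤ 2 * n + 3 ∧ l ≤ K := by
  refine hW.small n f (i + a) l h hl fun t ht => ?_
  have h3 := hr t ht
  rw [hB, List.getElem?_append_left (by simp; omega)] at h3
  have h4 : a + t < m := by omega
  simp [seg, h4] at h3
  rw [← h3, add_assoc]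

theorem exists_segments (N : ℕ) (st : ℕ → Prop) (h0 : st 0) [DecidablePred st] : ∃ nx : ℕ → ℕ,
    (∀ a < N, st a → a < nx a ∧ nx a ≤ N ∧ ∀ t, a < t → t < nx a → ¬ st t) ∧
    ∀ (p : ℕ → Prop) [DecidablePred p],
      (∀ a < N, st a → ∀ t, a ≤ t → t < nx a → (p t ↔ p a)) →
      ((Finset.range N).filter p).card =
        ∑ a ∈ (Finset.range N).filter (fun a => st a ∧ p a), (nx a - a) := by
  have hex : ∀ a, ∃ x, a < N → a < x ∧ (x = N ∨ st x) := fun a => ⟨N, fun h => ⟨h, Or.inl rfl⟩⟩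
  classical
  have hnx : ∀ a, ∃ x, a < N → (a < x ∧ x ≤ N ∧ (x = N ∨ st x) ∧ ∀ t, a < t → t < x → ¬ st t) := by
    intro a
    have hex : ∃ x, a < x ∧ (N ≤ x ∨ st x) := ⟨max (a + 1) N, by omega, Or.inl (by omega)⟩
    refine ⟨Nat.find hex, fun ha => ?_⟩
    have h1 := Nat.find_spec hex
    have h2 : Nat.find hex ≤ N := Nat.find_min' hex ⟨ha, Or.inl le_rfl⟩
    refine ⟨h1.1, h2, ?_, fun t ht1 ht2 hst => Nat.find_min hex ht2 ⟨ht1, Or.inr hst⟩⟩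
    rcases h1.2 with h | h
    · left; omega
    · right; exact h
  choose nx hnx using hnx
  refine ⟨nx, fun a ha _ => ⟨(hnx a ha).1, (hnx a ha).2.1, (hnx a ha).2.2.2⟩, fun p _ hp => ?_⟩
  let sg : ℕ → ℕ := fun j => Nat.findGreatest st j
  have hsg : ∀ j, st (sg j) ∧ sg j ≤ j ∧ ∀ t, sg j < t → t ≤ j → ¬ st t := fun j =>
    ⟨Nat.findGreatest_spec (Nat.zero_le j) h0, Nat.findGreatest_le j,
      fun t h1 h2 => Nat.findGreatest_is_greatest h1 h2⟩
  have hlt : ∀ j < N, j < nx (sg j) := by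
    intro j hj
    obtain ⟨h1, h2, h3⟩ := hsg j
    obtain ⟨h4, h5, h6, h7⟩ := hnx (sg j) (by omega)
    by_contra hle
    rcases h6 with h6 | h6
    · omega
    · exact h3 _ h4 (by omega) h6
  rw [Finset.card_eq_sum_card_fiberwise (f := sg)
    (t := (Finset.range N).filter fun a => st a ∧ p a)]
  · refine Finset.sum_congr rfl fun a ha => ?_
    simp only [Finset.mem_filter, Finset.mem_range] at ha
    obtain ⟨h4, h5, h6, h7⟩ := hnx a ha.1
    rw [← Nat.card_Ico]
    congr 1
    ext j
    simp only [Finset.mem_filter, Finset.mem_range, Finset.mem_Ico]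
    constructor
    · rintro ⟨⟨hj, -⟩, rfl⟩
      exact ⟨(hsg j).2.1, hlt j hj⟩
    · rintro ⟨h1, h2⟩
      refine ⟨⟨by omega, (hp a ha.1 ha.2.1 j h1 h2).2 ha.2.2⟩, ?_⟩
      obtain ⟨h8, h9, h10⟩ := hsg j
      rcases Nat.lt_trichotomy (sg j) a with h | h | h
      · exact absurd ha.2.1 (h10 a h h1)
      · exact h
      · exact absurd h8 (h7 _ h (by omega))
  · intro j hj
    simp only [Finset.coe_filter, Finset.mem_range, Set.mem_ofPred_eq] at hj ⊢
    obtain ⟨h1, h2, h3⟩ := hsg j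
    exact ⟨by omega, h1, (hp (sg j) (by omega) h1 j h2 (hlt j hj.1)).1 hj.2⟩

end GSC

namespace GSC

variable {S : Type} {P : C6Presentation S}

namespace Boundary

variable {B : Word S} (b : Boundary P B) (cuts : Finset ℕ)

/-- The positions on the boundary of face `k` at which a boundary arc starts, after subdividing
the boundary arcs at `cuts`. -/
def starts (k : Fin b.m) : Finset ℕ :=
  (Finset.range B.length).filter fun j => (b.brk j = true ∨ j ∈ cuts) ∧ b.own j = k

/-- The number of cuts inside boundary arcs of the face `k`. -/
def imp (k : Fin b.m) : ℕ := (cuts.filter fun a => b.brk a = false ∧ b.own a = k).card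

variable {b cuts}

theorem mem_starts {k : Fin b.m} {a : ℕ} : a ∈ b.starts cuts k ↔
    a < B.length ∧ (b.brk a = true ∨ a ∈ cuts) ∧ b.own a = k := by
  simp [starts]

theorem card_starts (hc : ∀ a ∈ cuts, a < B.length) (k : Fin b.m) :
    (b.starts cuts k).card = b.cor k + b.imp cuts k := by
  rw [b.cor_eq, imp, ← Finset.card_union_of_disjoint]
  · congr 1
    ext j
    simp only [mem_starts, Finset.mem_union, Finset.mem_filter, Finset.mem_range]
    have := hc j
    cases b.brk j <;> simp
    tauto
  · rw [Finset.disjoint_left]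
    simp only [Finset.mem_filter]
    rintro j ⟨-, -, h1⟩ ⟨-, h2, -⟩
    simp [h1] at h2

theorem sum_imp : ∑ k, b.imp cuts k = (cuts.filter fun a => b.brk a = false).card := by
  rw [Finset.card_eq_sum_card_fiberwise (f := b.own) (t := Finset.univ) (by simp)]
  refine Finset.sum_congr rfl fun k _ => ?_
  rw [imp, Finset.filter_filter]

theorem sum_imp_le : ∑ k, b.imp cuts k ≤ cuts.card :=
  sum_imp.trans_le (Finset.card_filter_le _ _)

theorem two_le_imp {a c : ℕ} (hac : a ≠ c) (ha : a ∈ cuts) (hc : c ∈ cuts) (h : b.brk a = false)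
    (h' : b.brk c = false) (ho : b.own a = b.own c) : 2 ≤ b.imp cuts (b.own a) :=
  Finset.one_lt_card.2 ⟨a, by simp [ha, h], c, by simp [hc, h', ho], hac⟩

theorem cor_pos_of_imp (hc : ∀ a ∈ cuts, a < B.length) {k : Fin b.m} (h : 1 ≤ b.imp cuts k) :
    1 ≤ b.cor k := by
  obtain ⟨a, ha⟩ := Finset.card_pos.1 h
  simp only [Finset.mem_filter] at ha
  rw [← ha.2.2]
  exact b.cor_pos a (hc a ha.1)

theorem gauss_cut : (6 : ℤ) ≤ ∑ k, (6 - (b.int k : ℤ) - 2 * b.cor k) := by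
  have h := b.gauss
  have h1 : ∑ k : Fin b.m, (6 - (b.int k : ℤ) - 2 * b.cor k) =
      6 * b.m - ((∑ k, (b.int k + 2 * b.cor k) : ℕ) : ℤ) := by
    push_cast
    rw [eq_sub_iff_add_eq, ← Finset.sum_add_distrib]
    simp [sub_sub, mul_comm]
  rw [h1]
  omega

theorem exists_next (h0 : 0 ∈ cuts) : ∃ nx : ℕ → ℕ,
    (∀ k, ∀ a ∈ b.starts cuts k, a < nx a ∧ nx a ≤ B.length ∧
      ∀ t, a < t → t < nx a → b.brk t = false ∧ t ∉ cuts) ∧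
    (∀ k, ((Finset.range B.length).filter fun j => b.own j = k).card =
      ∑ a ∈ b.starts cuts k, (nx a - a)) ∧
    ∀ k, ∀ m ∈ cuts, ((Finset.range m).filter fun j => b.own j = k ∧ j < B.length).card =
      ∑ a ∈ (b.starts cuts k).filter (fun a => a < m), (nx a - a) := by
  classical
  obtain ⟨nx, h1, h2⟩ := exists_segments B.length (fun j => b.brk j = true ∨ j ∈ cuts) (Or.inr h0)
  have h3 : ∀ a < B.length, (b.brk a = true ∨ a ∈ cuts) →
      ∀ t, a < t → t < nx a → b.brk t = false ∧ t ∉ cuts := by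
    intro a ha hst t h4 h5
    have := (h1 a ha hst).2.2 t h4 h5
    push Not at this
    simpa using this
  have h4 : ∀ a < B.length, (b.brk a = true ∨ a ∈ cuts) →
      ∀ t, a ≤ t → t < nx a → b.own t = b.own a := by
    intro a ha hst t h4 h5
    obtain ⟨h6, h7, h8⟩ := h1 a ha hst
    exact (b.run a (nx a) h6 h7 fun t h9 h10 => (h3 a ha hst t h9 h10).1).1 t h4 h5
  refine ⟨nx, fun k a ha => ?_, fun k => ?_, fun k m hm => ?_⟩
  · rw [mem_starts] at ha
    exact ⟨(h1 a ha.1 ha.2.1).1, (h1 a ha.1 ha.2.1).2.1, h3 a ha.1 ha.2.1⟩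
  · rw [h2 (fun j => b.own j = k) fun a ha hst t h5 h6 => by rw [h4 a ha hst t h5 h6]]
    rfl
  · have h5 : ((Finset.range m).filter fun j => b.own j = k ∧ j < B.length) =
        (Finset.range B.length).filter fun j => b.own j = k ∧ j < m := by
      ext j
      simp only [Finset.mem_filter, Finset.mem_range]
      tauto
    rw [h5, h2 (fun j => b.own j = k ∧ j < m)]
    · refine Finset.sum_congr (Finset.ext fun a => ?_) fun _ _ => rfl
      simp only [Finset.mem_filter, Finset.mem_range, mem_starts]
      tauto
    · intro a ha hst t h6 h7
      rw [h4 a ha hst t h6 h7]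
      refine and_congr_right fun _ => ⟨fun h => by omega, fun h => ?_⟩
      by_contra h8
      rcases Nat.lt_or_ge a m with h9 | h9
      · exact (h3 a ha hst m h9 (by omega)).2 hm
      · omega

end Boundary
end GSC

namespace GSC

variable {S : Type} {P : C6Presentation S}

namespace Boundary

variable {B : Word S} {b : Boundary P B} {cuts : Finset ℕ}

theorem brk_eq_false_of_card_le (h : cuts.card ≤ ∑ k, b.imp cuts k) {a : ℕ} (ha : a ∈ cuts) :
    b.brk a = false := by
  rw [sum_imp] at h
  have h1 := Finset.eq_of_subset_of_card_le (Finset.filter_subset _ _) h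
  rw [← h1] at ha
  exact (Finset.mem_filter.1 ha).2

theorem sum_card_own (m : ℕ) (hm : m ≤ B.length) :
    ∑ k, ((Finset.range m).filter fun j => b.own j = k ∧ j < B.length).card = m := by
  conv_rhs => rw [← Finset.card_range m]
  rw [Finset.card_eq_sum_card_fiberwise (f := b.own) (s := Finset.range m) (t := Finset.univ)
    (by simp)]
  refine Finset.sum_congr rfl fun k _ => congrArg Finset.card (Finset.ext fun j => ?_)
  simp only [Finset.mem_filter, Finset.mem_range]
  constructor
  · rintro ⟨h1, h2, -⟩
    exact ⟨h1, h2⟩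
  · rintro ⟨h1, h2⟩
    exact ⟨h1, h2, by omega⟩

/-- The combinatorial data of a boundary all of whose arcs are short: faces have curvature at most
three times the number of cuts on them. -/
theorem curvature_le (hc : ∀ a ∈ cuts, a < B.length) {nx : ℕ → ℕ}
    (h2 : ∀ k, ((Finset.range B.length).filter fun j => b.own j = k).card =
      ∑ a ∈ b.starts cuts k, (nx a - a))
    (hl : ∀ k, ∀ a ∈ b.starts cuts k, 2 * (nx a - a) ≤ b.len k) (k : Fin b.m) :
    (6 - (b.int k : ℤ) - 2 * b.cor k) ≤ 3 * b.imp cuts k := by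
  have hci := b.cor_le k
  have hp := @cor_pos_of_imp _ _ _ b cuts hc k
  by_contra hlt
  have hle := b.len_le k
  have hn := b.len_pos k
  have hcard := card_starts hc k
  have h3 : 2 * ((Finset.range B.length).filter fun j => b.own j = k).card ≤
      (b.cor k + b.imp cuts k) * b.len k := by
    rw [h2, Finset.mul_sum, ← hcard, ← smul_eq_mul]
    exact Finset.sum_le_card_nsmul _ _ _ (hl k)
  have h4 : b.imp cuts k = 0 := by omega
  rw [h4] at h3
  have h5 : b.cor k ≤ 1 := by omega
  obtain ⟨n, hn'⟩ := Nat.exists_eq_add_of_le hn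
  rw [hn'] at h3 hle
  simp only [Nat.add_sub_cancel_left] at hle
  have h6 : b.int k ≤ 5 - 2 * b.cor k := by omega
  have h7 : b.int k * n ≤ (5 - 2 * b.cor k) * n := Nat.mul_le_mul_right _ h6
  have h8 : b.cor k = 0 ∨ b.cor k = 1 := by omega
  rcases h8 with h8 | h8 <;> rw [h8] at h3 h7 <;> omega

end Boundary

/-- A simple closed word one side of which is a proper part of the periodic word, the other one
a geodesic, the periodic part being locally geodesic, has long geodesic side. -/
theorem Good.le_of_boundary {W : ℕ → S × Bool} {L K : ℕ} (hW : Good P W L K) {i m : ℕ}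
    (ih : ∀ m' < m, ∀ i, P.Geod (seg W i m')) {q : Word S} (hq : P.Geod q) (hm : 0 < m)
    (b : Boundary P (seg W i m ++ q)) : m ≤ q.length := by
  classical
  set B := seg W i m ++ q with hB
  have hN : B.length = m + q.length := by simp [hB]
  let cuts : Finset ℕ := ({0, m} : Finset ℕ).filter fun a => a < B.length
  have hc : ∀ a ∈ cuts, a < B.length := fun a ha => (Finset.mem_filter.1 ha).2
  have hc0 : 0 ∈ cuts := by simp [cuts]; omega
  obtain ⟨nx, hnx, hn, hs⟩ := b.exists_next hc0
  have hmid : ∀ k, ∀ a ∈ b.starts cuts k, a < m → nx a ≤ m := by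
    intro k a ha ham
    obtain ⟨h1, h2, h3⟩ := hnx k a ha
    by_contra hlt
    exact (h3 m ham (by omega)).2 (by simp [cuts]; omega)
  have hlen : ∀ k, ∀ a ∈ b.starts cuts k, (a < m → 6 * (nx a - a) ≤ 2 * b.len k + 3) ∧
      2 * (nx a - a) ≤ b.len k := by
    intro k a ha
    obtain ⟨h1, h2, h3⟩ := hnx k a ha
    obtain ⟨-, h4, f, hf, hr⟩ := b.run a (nx a) h1 h2 fun t h4 h5 => (h3 t h4 h5).1
    have hk := (Boundary.mem_starts.1 ha).2.2
    rw [hk] at h4 hf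
    have h5 : a < m → 6 * (nx a - a) ≤ 2 * b.len k + 3 := fun ham =>
      (hW.small_of_run hf hB hr h4 (by have := hmid k a ha ham; omega)).1
    refine ⟨h5, ?_⟩
    rcases Nat.lt_or_ge a m with ham | ham
    · have := h5 ham
      omega
    · exact hf.two_mul_le_of_run (x := seg W i m) (s := q) (y := []) (by simp [hB]) hq hr h4
        (by simpa using ham) (by simp; omega)
  have hkap := b.curvature_le hc hn fun k a ha => (hlen k a ha).2
  have hcard : cuts.card ≤ 2 := le_trans (Finset.card_filter_le _ _) Finset.card_le_two
  have hg := b.gauss_cut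
  have himp := b.sum_imp_le (cuts := cuts)
  have hsum : ∑ k, (6 - (b.int k : ℤ) - 2 * b.cor k) ≤ ∑ k, 3 * (b.imp cuts k : ℤ) :=
    Finset.sum_le_sum fun k _ => hkap k
  have hsum2 : ∑ k, 3 * (b.imp cuts k : ℤ) = 3 * ((∑ k, b.imp cuts k : ℕ) : ℤ) := by
    rw [← Finset.mul_sum]
    push_cast
    rfl
  have hall := (Finset.sum_eq_sum_iff_of_le fun k _ => hkap k).1 (le_antisymm hsum (by omega))
  have hcard2 : cuts.card = 2 := by omega
  have hmN : m < B.length := by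
    by_contra hlt
    have : cuts ⊆ {0} := by
      intro a ha
      simp only [cuts, Finset.mem_filter, Finset.mem_insert, Finset.mem_singleton] at ha ⊢
      omega
    have := Finset.card_le_card this
    simp at this
    omega
  have hmc : m ∈ cuts := by simp [cuts]; omega
  have hbrk : ∀ a ∈ cuts, b.brk a = false := fun a ha =>
    Boundary.brk_eq_false_of_card_le (by omega) ha
  have key : ∀ k, 2 * ((Finset.range m).filter fun j => b.own j = k ∧ j < B.length).card ≤
      ((Finset.range B.length).filter fun j => b.own j = k).card := by
    intro k
    rw [hs k m hmc, hn]
    have hk := hall k (Finset.mem_univ k)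
    have hp := @Boundary.cor_pos_of_imp _ _ _ b cuts hc k
    have hle := b.len_le k
    have hci := b.cor_le k
    have hlp := b.len_pos k
    rw [hn] at hle
    obtain ⟨n, hn'⟩ := Nat.exists_eq_add_of_le hlp
    have hcs := Boundary.card_starts hc k
    have h3 : (b.cor k = 0 ∧ b.imp cuts k = 0 ∧ b.int k = 6) ∨
        (b.cor k = 1 ∧ b.imp cuts k = 0 ∧ b.int k = 4) ∨
        (b.cor k + b.imp cuts k = 2 ∧ b.int k ≤ 2 ∧ b.imp cuts k ≤ 1) := by omega
    rcases h3 with ⟨h3, h4, h5⟩ | ⟨h3, h4, h5⟩ | ⟨h3, h4, h5⟩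
    · have : b.starts cuts k = ∅ := by rw [← Finset.card_eq_zero]; omega
      rw [this]
      simp
    · obtain ⟨a, ha⟩ := Finset.card_eq_one.1 (by rw [hcs]; omega : (b.starts cuts k).card = 1)
      have h6 := hlen k a (by simp [ha])
      rw [ha] at hle ⊢
      rw [Finset.filter_singleton]
      rw [Finset.sum_singleton] at hle
      split_ifs with ham
      · have := h6.1 ham
        rw [h5, hn'] at hle
        omega
      · simp
    · obtain ⟨a, c, hac, hacs⟩ : ∃ a c, a < c ∧ b.starts cuts k = {a, c} := by
        obtain ⟨a, c, hne, h⟩ := Finset.card_eq_two.1 (by rw [hcs]; omega : (b.starts cuts k).card = 2)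
        rcases Nat.lt_or_gt_of_ne hne with h' | h'
        · exact ⟨a, c, h', h⟩
        · exact ⟨c, a, h', by rw [h, Finset.pair_comm]⟩
      have has : a ∈ b.starts cuts k := by simp [hacs]
      have hcs' : c ∈ b.starts cuts k := by simp [hacs]
      have h6 := hlen k a has
      have h7 := hlen k c hcs'
      have h8 : b.int k * (b.len k - 1) ≤ 2 * (b.len k - 1) := Nat.mul_le_mul_right _ h4
      obtain ⟨ha1, ha2, ha3⟩ := hnx k a has
      obtain ⟨hc1, hc2, hc3⟩ := hnx k c hcs'
      rw [hacs, Finset.sum_pair hac.ne] at hle ⊢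
      rcases Nat.lt_or_ge c m with hcm | hcm
      · exfalso
        have hnac : nx a ≤ c := by
          by_contra hlt
          have h9 := ha3 c hac (by omega)
          have h10 := (Boundary.mem_starts.1 hcs').2.1
          simp [h9.1, h9.2] at h10
        have h11 := hmid k c hcs' hcm
        obtain ⟨v, hv1, hv2⟩ := b.chord a (nx a) c (nx c) ha1 hnac hc1 hc2
          (fun t h1 h2 => (ha3 t h1 h2).1) (fun t h1 h2 => (hc3 t h1 h2).1)
          ((Boundary.mem_starts.1 has).2.2.trans (Boundary.mem_starts.1 hcs').2.2.symm)
        rw [(Boundary.mem_starts.1 has).2.2] at hv2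
        have hv3 : P.elt v = P.elt (seg W (i + a) (nx c - a)) := by
          rw [hv1, hB, List.take_append_of_le_length (by simp; omega),
            List.take_append_of_le_length (by simp; omega), take_seg _ _ (by omega),
            take_seg _ _ h11, inv_mul_eq_iff_eq_mul, ← P.elt_append, ← seg_add,
            Nat.add_sub_cancel' (by omega)]
        rcases Nat.lt_or_ge (nx c - a) m with h12 | h12
        · have := ih _ h12 (i + a) v hv3
          simp only [length_seg] at this
          omega
        · have ha0 : a = 0 := by omega
          have hcm' : nx c = m := by omega
          have hom : b.own m = b.own c := by
            refine (b.run c (m + 1) (by omega) (by omega) fun t h1 h2 => ?_).1 m hcm.le (by omega)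
            rcases Nat.lt_or_ge t m with h | h
            · exact (hc3 t h1 (by omega)).1
            · obtain rfl : t = m := by omega
              exact hbrk _ hmc
          have := Boundary.two_le_imp hm.ne hc0 hmc (hbrk 0 hc0) (hbrk m hmc)
            (by rw [hom, (Boundary.mem_starts.1 hcs').2.2, ← ha0, (Boundary.mem_starts.1 has).2.2])
          rw [← ha0, (Boundary.mem_starts.1 has).2.2] at this
          omega
      · rw [Finset.filter_insert, Finset.filter_singleton]
        have : ¬ c < m := by omega
        rw [if_neg this]
        split_ifs with ham
        · have := h6.1 ham
          simp
          omega
        · simp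
  have h1 := Boundary.sum_card_own (b := b) m hmN.le
  have h2 := Boundary.sum_card_own (b := b) B.length le_rfl
  have h3 := Finset.sum_le_sum fun k (_ : k ∈ Finset.univ) => key k
  rw [← Finset.mul_sum, h1] at h3
  have h4 : ∑ k, ((Finset.range B.length).filter fun j => b.own j = k).card = B.length := by
    conv_rhs => rw [← h2]
    refine Finset.sum_congr rfl fun k _ => congrArg Finset.card (Finset.ext fun j => ?_)
    simp only [Finset.mem_filter, Finset.mem_range]
    tauto
  omega

theorem Good.geod {W : ℕ → S × Bool} {L K : ℕ} (hW : Good P W L K) :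
    ∀ m i, P.Geod (seg W i m) := by
  intro m
  induction m using Nat.strong_induction_on with
  | _ m ih =>
  intro i
  obtain ⟨p, hp, hpg⟩ := P.exists_geod (P.elt (seg W i m))
  suffices h : m ≤ p.length by
    intro v hv
    have := hpg v (hv.trans hp.symm)
    rw [length_seg]
    omega
  by_contra hlt
  set q := wordInv p with hq
  have hqg : P.Geod q := hpg.inv
  have hql : q.length = p.length := by simp [hq, length_wordInv]
  have hq1 : P.elt (seg W i m) * P.elt q = 1 := by rw [hq, P.elt_wordInv, hp, mul_inv_cancel]
  have hN : (seg W i m ++ q).length = m + p.length := by simp [hql]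
  have hne : seg W i m ++ q ≠ [] := by
    rw [← List.length_pos_iff]
    omega
  have hleft : ∀ j ≤ m, (seg W i m ++ q).take j = seg W i j := fun j hj => by
    rw [List.take_append_of_le_length (by simpa using hj), take_seg _ _ hj]
  have hright : ∀ j, m ≤ j → (seg W i m ++ q).take j = seg W i m ++ q.take (j - m) := fun j hj => by
    rw [List.take_append, List.take_of_length_le (by simpa using hj), length_seg]
  have hinj : ∀ i' j', i' < j' → j' < (seg W i m ++ q).length →
      P.elt ((seg W i m ++ q).take i') ≠ P.elt ((seg W i m ++ q).take j') := by
    intro i' j' hij hj heq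
    rw [hN] at hj
    rcases Nat.lt_or_ge m j' with hmj | hmj
    · rcases Nat.lt_or_ge i' m with him | him
      · rw [hleft _ him.le, hright _ hmj.le] at heq
        have hsplit : P.elt (seg W i m) = P.elt (seg W i i') * P.elt (seg W (i + i') (m - i')) := by
          rw [← P.elt_append, ← seg_add, Nat.add_sub_cancel' him.le]
        have hqs : P.elt q = P.elt (q.take (j' - m)) * P.elt (q.drop (j' - m)) := by
          rw [← P.elt_append, List.take_append_drop]
        rw [P.elt_append] at heq
        rcases Nat.eq_zero_or_pos i' with h0 | h0
        · subst h0
          have : P.elt (q.take (j' - m)) = P.elt q := by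
            rw [← mul_right_inj (P.elt (seg W i m)), hq1, ← heq]
            simp [seg]
          have := hqg _ this
          simp at this
          omega
        · have e1 : P.elt (wordInv (q.take (j' - m))) = P.elt (seg W (i + i') (m - i')) := by
            rw [P.elt_wordInv, inv_eq_iff_mul_eq_one]
            rw [hsplit, mul_assoc, left_eq_mul] at heq
            exact mul_eq_one_comm.1 heq
          have e2 : P.elt (wordInv (q.drop (j' - m))) = P.elt (seg W i i') := by
            rw [P.elt_wordInv, inv_eq_iff_mul_eq_one, heq, mul_eq_one_comm, mul_assoc, ← hqs, hq1]
          have h1 := ih (m - i') (by omega) (i + i') _ e1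
          have h2 := ih i' him i _ e2
          simp [length_wordInv] at h1 h2
          omega
      · rw [hright _ him, hright _ hmj.le, P.elt_append, P.elt_append, mul_right_inj] at heq
        have h1 : q.take (j' - m) = q.take (i' - m) ++ (q.drop (i' - m)).take (j' - i') := by
          rw [show j' - m = (i' - m) + (j' - i') by omega, List.take_add]
        rw [h1, P.elt_append, left_eq_mul] at heq
        have := congrArg List.length ((hqg.drop_take (i' - m) (j' - i')).eq_nil heq)
        simp at this
        omega
    · rw [hleft _ (by omega), hleft _ hmj, ← Nat.add_sub_cancel' hij.le, seg_add, P.elt_append,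
        left_eq_mul] at heq
      rcases Nat.lt_or_ge (j' - i') m with h | h
      · have := congrArg List.length ((ih _ h (i + i')).eq_nil heq)
        simp at this
        omega
      · obtain rfl : i' = 0 := by omega
        obtain rfl : j' = m := by omega
        simp only [add_zero, Nat.sub_zero] at heq
        rw [heq] at hp
        rw [hpg.eq_nil hp] at hj
        simp at hj
  have hx : ∀ x, seg W i m ++ q ≠ [x, linv x] := by
    intro x hx
    have h1 := congrArg List.length hx
    rw [hN] at h1
    simp only [List.length_cons, List.length_nil] at h1
    obtain rfl : m = 2 := by omega
    rw [List.length_eq_zero_iff.1 (by omega : q.length = 0)] at hx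
    simp [seg, List.range_succ] at hx
    exact hW.reduced i (by rw [hx.2, hx.1])
  rcases P.mem_rels_or_boundary hne (by rw [P.elt_append, hq1]) hinj hx with hB | ⟨⟨b⟩⟩
  · have := (hW.small _ _ i m (P.isRel_of_mem hB hne (W 0)) (by omega) fun t ht => by
      rw [Nat.mod_eq_of_lt (by omega), List.getD_append _ _ _ _ (by simpa using ht)]
      simp [seg, ht]).1
    omega
  · have := hW.le_of_boundary ih hqg (by omega) b
    omega

end GSC

namespace GSC

variable {S : Type} {P : C6Presentation S}

/-- A word is piecewise geodesic if it is a concatenation of at most `k` geodesic words. -/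
def C6Presentation.PGeod (P : C6Presentation S) : ℕ → Word S → Prop
  | 0, q => q = []
  | k + 1, q => ∃ x y, q = x ++ y ∧ P.Geod x ∧ C6Presentation.PGeod P k y

namespace C6Presentation.PGeod

theorem succ {k : ℕ} {q : Word S} (h : P.PGeod k q) : P.PGeod (k + 1) q :=
  ⟨[], q, rfl, geod_nil, h⟩

theorem right : ∀ {k : ℕ} {u v : Word S}, P.PGeod k (u ++ v) → P.PGeod k v
  | 0, u, v, h => (List.append_eq_nil_iff.1 h).2
  | k + 1, u, v, ⟨x, y, h, hx, hy⟩ => by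
    rcases List.append_eq_append_iff.1 h with ⟨a, rfl, rfl⟩ | ⟨a, rfl, rfl⟩
    · exact ⟨a, y, rfl, hx.right, hy⟩
    · exact hy.right.succ

theorem left : ∀ {k : ℕ} {u v : Word S}, P.PGeod k (u ++ v) → P.PGeod k u
  | 0, u, v, h => (List.append_eq_nil_iff.1 h).1
  | k + 1, u, v, ⟨x, y, h, hx, hy⟩ => by
    rcases List.append_eq_append_iff.1 h with ⟨a, rfl, rfl⟩ | ⟨a, rfl, rfl⟩
    · refine ⟨u, [], by simp, hx.left, ?_⟩
      exact left (u := []) (v := y) hy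
    · exact ⟨x, a, rfl, hx, hy.left⟩

theorem remove : ∀ {k : ℕ} {x y z : Word S}, P.PGeod k (x ++ y ++ z) → ¬ P.Geod y →
    P.PGeod k (x ++ z)
  | 0, x, y, z, h, hy => by
    simp only [PGeod, List.append_eq_nil_iff] at h
    rw [h.1.2] at hy
    exact absurd geod_nil hy
  | k + 1, x, y, z, ⟨g, r, h, hg, hr⟩, hy => by
    rw [List.append_assoc] at h
    rcases List.append_eq_append_iff.1 h with ⟨a, rfl, h2⟩ | ⟨a, rfl, rfl⟩
    · rcases List.append_eq_append_iff.1 h2 with ⟨c, rfl, rfl⟩ | ⟨c, rfl, rfl⟩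
      · exact absurd hg.right.left hy
      · exact ⟨x, z, rfl, hg.left, hr.right⟩
    · rw [← List.append_assoc] at hr
      exact ⟨g, a ++ z, by simp, hg, remove hr hy⟩

end C6Presentation.PGeod

/-- `x` is at distance at most `c` from `Z`. -/
def Near (P : C6Presentation S) (Z : Set P.Grp) (c : ℕ) (x : P.Grp) : Prop :=
  ∃ z ∈ Z, ∃ v : Word S, P.elt v = z⁻¹ * x ∧ v.length ≤ c

open Classical in
/-- The number of vertices near `Z` on the path labelled `q` from `h`, not counting the first. -/
noncomputable def nearCount (P : C6Presentation S) (Z : Set P.Grp) (c : ℕ) (h : P.Grp)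
    (q : Word S) : ℕ :=
  ∑ t ∈ Finset.range q.length, if Near P Z c (h * P.elt (q.take (t + 1))) then 1 else 0

theorem nearCount_append {Z : Set P.Grp} {c : ℕ} {h : P.Grp} {u v : Word S} :
    nearCount P Z c h (u ++ v) = nearCount P Z c h u + nearCount P Z c (h * P.elt u) v := by
  rw [nearCount, List.length_append, Finset.sum_range_add]
  congr 1
  · refine Finset.sum_congr rfl fun t ht => ?_
    rw [Finset.mem_range] at ht
    rw [List.take_append_of_le_length ht]
  · refine Finset.sum_congr rfl fun t ht => ?_
    rw [add_assoc, List.take_append, List.take_of_length_le (by omega), P.elt_append, mul_assoc,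
      Nat.add_sub_cancel_left]

open Classical in
theorem one_le_nearCount {Z : Set P.Grp} {c : ℕ} {h : P.Grp} {q : Word S} (hq : q ≠ [])
    (hz : h * P.elt q ∈ Z) : 1 ≤ nearCount P Z c h q := by
  have h1 := List.length_pos_of_ne_nil hq
  have h2 := Finset.single_le_sum (s := Finset.range q.length) (f := fun t =>
    if Near P Z c (h * P.elt (q.take (t + 1))) then 1 else 0) (fun _ _ => Nat.zero_le _)
    (Finset.mem_range.2 (by omega : q.length - 1 < q.length))
  rw [Nat.sub_add_cancel h1, List.take_length, if_pos ⟨_, hz, [], by simp, by simp⟩] at h2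
  exact h2

open Classical in
theorem Good.polygon_of_boundary {W : ℕ → S × Bool} {L K : ℕ} (hW : Good P W L K) {Z : Set P.Grp}
    {i m : ℕ} {h : P.Grp} {q : Word S} (hq : P.PGeod 3 q) (hm : 0 < m)
    (hZ : ∀ j ≤ m, h * P.elt (seg W i j) ∈ Z) (b : Boundary P (seg W i m ++ q)) :
    m ≤ K * (20 + nearCount P Z (6 * K) (h * P.elt (seg W i m)) q) := by
  obtain ⟨q1, -, rfl, hq1, q2, -, rfl, hq2, q3, q4, rfl, hq3, rfl⟩ := hq
  rw [List.append_nil] at b ⊢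
  set q := q1 ++ (q2 ++ q3) with hqdef
  set B := seg W i m ++ q with hB
  have hql : q.length = q1.length + (q2.length + q3.length) := by simp [hqdef]
  have hN : B.length = m + q.length := by simp [hB]
  let cuts : Finset ℕ := ({0, m, m + q1.length, m + q1.length + q2.length} : Finset ℕ).filter
    fun a => a < B.length
  have hc : ∀ a ∈ cuts, a < B.length := fun a ha => (Finset.mem_filter.1 ha).2
  have hc0 : 0 ∈ cuts := by simp [cuts]; omega
  obtain ⟨nx, hnx, hn, hs⟩ := b.exists_next hc0
  have hcut : ∀ c ∈ ({0, m, m + q1.length, m + q1.length + q2.length} : Finset ℕ),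
      ∀ k, ∀ a ∈ b.starts cuts k, a < c → nx a ≤ c := by
    intro c hcc k a ha ham
    obtain ⟨h1, h2, h3⟩ := hnx k a ha
    by_contra hlt
    exact (h3 c ham (by omega)).2 (Finset.mem_filter.2 ⟨hcc, by omega⟩)
  have hlen : ∀ k, ∀ a ∈ b.starts cuts k,
      (a < m → 6 * (nx a - a) ≤ 2 * b.len k + 3 ∧ nx a - a ≤ K) ∧
      2 * (nx a - a) ≤ b.len k := by
    intro k a ha
    obtain ⟨h1, h2, h3⟩ := hnx k a ha
    obtain ⟨-, h4, f, hf, hr⟩ := b.run a (nx a) h1 h2 fun t h4 h5 => (h3 t h4 h5).1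
    have hk := (Boundary.mem_starts.1 ha).2.2
    rw [hk] at h4 hf
    have h5 : a < m → 6 * (nx a - a) ≤ 2 * b.len k + 3 ∧ nx a - a ≤ K := fun ham =>
      hW.small_of_run hf hB hr h4 (by have := hcut m (by simp) k a ha ham; omega)
    refine ⟨h5, ?_⟩
    rcases Nat.lt_or_ge a m with ham | ham
    · have := (h5 ham).1
      omega
    rcases Nat.lt_or_ge a (m + q1.length) with ham1 | ham1
    · have := hcut _ (by simp) k a ha ham1
      exact hf.two_mul_le_of_run (x := seg W i m) (s := q1) (y := q2 ++ q3) (by simp [hB, hqdef])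
        hq1 hr h4 (by simpa using ham) (by simp; omega)
    rcases Nat.lt_or_ge a (m + q1.length + q2.length) with ham2 | ham2
    · have := hcut _ (by simp) k a ha ham2
      exact hf.two_mul_le_of_run (x := seg W i m ++ q1) (s := q2) (y := q3) (by simp [hB, hqdef])
        hq2 hr h4 (by simpa using ham1) (by simp; omega)
    · exact hf.two_mul_le_of_run (x := seg W i m ++ q1 ++ q2) (s := q3) (y := [])
        (by simp [hB, hqdef]) hq3 hr h4 (by simp; omega) (by simp; omega)
  have hcard : cuts.card ≤ 4 := le_trans (Finset.card_filter_le _ _) Finset.card_le_four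
  have hg := b.gauss_cut
  have himp := b.sum_imp_le (cuts := cuts)
  let nk : Fin b.m → ℕ := fun k => ((Finset.range q.length).filter fun t =>
    Near P Z (6 * K) (h * P.elt (seg W i m) * P.elt (q.take (t + 1))) ∧ b.own (m + t) = k).card
  have hnk : ∑ k, nk k = nearCount P Z (6 * K) (h * P.elt (seg W i m)) q := by
    rw [nearCount, ← Finset.card_filter,
      Finset.card_eq_sum_card_fiberwise (f := fun t => b.own (m + t)) (t := Finset.univ) (by simp)]
    refine Finset.sum_congr rfl fun k _ => ?_
    rw [Finset.filter_filter]
  have key : ∀ k, (((b.starts cuts k).filter fun a => a < m).card : ℤ) ≤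
      -2 * (6 - (b.int k : ℤ) - 2 * b.cor k) + 8 * b.imp cuts k + nk k := by
    intro k
    have hp := @Boundary.cor_pos_of_imp _ _ _ b cuts hc k
    have hle := b.len_le k
    have hci := b.cor_le k
    have hlp := b.len_pos k
    rw [hn] at hle
    obtain ⟨n, hn'⟩ := Nat.exists_eq_add_of_le hlp
    have hcs := Boundary.card_starts hc k
    have hfl := Finset.card_filter_le (b.starts cuts k) fun a => a < m
    have h3 : (b.cor k = 0 ∧ b.imp cuts k = 0) ∨ (b.cor k = 1 ∧ b.imp cuts k = 0) ∨
        (b.cor k = 2 ∧ b.imp cuts k = 0 ∧ b.int k = 2) ∨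
        (b.cor k = 2 ∧ b.imp cuts k = 0 ∧ 3 ≤ b.int k) ∨ (1 ≤ b.imp cuts k ∨ 3 ≤ b.cor k) := by
      omega
    rcases h3 with ⟨h3, h4⟩ | ⟨h3, h4⟩ | ⟨h3, h4, h5⟩ | ⟨h3, h4, h5⟩ | h3
    · have : b.starts cuts k = ∅ := by rw [← Finset.card_eq_zero]; omega
      rw [this] at hle ⊢
      have h7 : 7 ≤ b.int k := by
        by_contra hlt
        have : b.int k * (b.len k - 1) ≤ 6 * (b.len k - 1) := Nat.mul_le_mul_right _ (by omega)
        simp only [Finset.sum_empty] at hle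
        omega
      simp
      omega
    · obtain ⟨a, ha⟩ := Finset.card_eq_one.1 (by rw [hcs]; omega : (b.starts cuts k).card = 1)
      have h6 := hlen k a (by simp [ha])
      rw [ha] at hle ⊢
      rw [Finset.filter_singleton]
      rw [Finset.sum_singleton] at hle
      split_ifs with ham
      · have h8 := (h6.1 ham).1
        have h7 : 5 ≤ b.int k := by
          by_contra hlt
          have : b.int k * (b.len k - 1) ≤ 4 * (b.len k - 1) := Nat.mul_le_mul_right _ (by omega)
          omega
        simp
        omega
      · have h7 : 4 ≤ b.int k := by
          by_contra hlt
          have : b.int k * (b.len k - 1) ≤ 3 * (b.len k - 1) := Nat.mul_le_mul_right _ (by omega)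
          omega
        simp
        omega
    · obtain ⟨a, c, hac, hacs⟩ : ∃ a c, a < c ∧ b.starts cuts k = {a, c} := by
        obtain ⟨a, c, hne, h⟩ := Finset.card_eq_two.1 (by rw [hcs]; omega : (b.starts cuts k).card = 2)
        rcases Nat.lt_or_gt_of_ne hne with h' | h'
        · exact ⟨a, c, h', h⟩
        · exact ⟨c, a, h', by rw [h, Finset.pair_comm]⟩
      have has : a ∈ b.starts cuts k := by simp [hacs]
      have hcs' : c ∈ b.starts cuts k := by simp [hacs]
      have h6 := hlen k a has
      have h7 := hlen k c hcs'
      rw [h5] at hle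
      obtain ⟨ha1, ha2, ha3⟩ := hnx k a has
      obtain ⟨hc1, hc2, hc3⟩ := hnx k c hcs'
      have hoa := (Boundary.mem_starts.1 has).2.2
      have hoc := (Boundary.mem_starts.1 hcs').2.2
      rw [hacs, Finset.sum_pair hac.ne] at hle
      rw [hacs]
      have hnac : nx a ≤ c := by
        by_contra hlt
        have h9 := ha3 c hac (by omega)
        have h10 := (Boundary.mem_starts.1 hcs').2.1
        simp [h9.1, h9.2] at h10
      rcases Nat.lt_or_ge c m with hcm | hcm
      · exfalso
        have h11 := hcut m (by simp) k c hcs' hcm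
        obtain ⟨v, hv1, hv2⟩ := b.chord a (nx a) c (nx c) ha1 hnac hc1 hc2
          (fun t h1 h2 => (ha3 t h1 h2).1) (fun t h1 h2 => (hc3 t h1 h2).1) (hoa.trans hoc.symm)
        rw [hoa] at hv2
        have hv3 : P.elt v = P.elt (seg W (i + a) (nx c - a)) := by
          rw [hv1, hB, List.take_append_of_le_length (by simp; omega),
            List.take_append_of_le_length (by simp; omega), take_seg _ _ (by omega),
            take_seg _ _ h11, inv_mul_eq_iff_eq_mul, ← P.elt_append, ← seg_add,
            Nat.add_sub_cancel' (by omega)]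
        have := hW.geod _ _ v hv3
        simp only [length_seg] at this
        omega
      · rw [Finset.filter_insert, Finset.filter_singleton]
        have : ¬ c < m := by omega
        rw [if_neg this]
        split_ifs with ham
        · have h8 := h6.1 ham
          obtain ⟨v, hv1, hv2⟩ := b.chord a (a + 1) c (c + 1) (by omega) (by omega) (by omega)
            (by omega) (fun t h1 h2 => by omega) (fun t h1 h2 => by omega) (hoa.trans hoc.symm)
          rw [hoa] at hv2
          have hpos : 1 ≤ nk k := by
            refine Finset.card_pos.2 ⟨c - m, ?_⟩
            simp only [Finset.mem_filter, Finset.mem_range]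
            refine ⟨by omega, ⟨_, hZ a ham.le, v, ?_, by omega⟩, by
              rw [Nat.add_sub_cancel' hcm, hoc]⟩
            rw [hv1, hB, List.take_append_of_le_length (by simp; omega), take_seg _ _ ham.le,
              List.take_append, List.take_of_length_le (by simp; omega), P.elt_append, length_seg,
              show c + 1 - m = c - m + 1 by omega]
            group
          simp
          omega
        · simp
          omega
    · omega
    · omega
  have hsum := Finset.sum_le_sum fun k (_ : k ∈ Finset.univ) => key k
  rw [Finset.sum_add_distrib, Finset.sum_add_distrib, ← Finset.mul_sum, ← Finset.mul_sum] at hsum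
  have hT : ∑ k, ((b.starts cuts k).filter fun a => a < m).card ≤
      20 + nearCount P Z (6 * K) (h * P.elt (seg W i m)) q := by
    have himp' : ∑ k, (b.imp cuts k : ℤ) ≤ 4 := by
      rw [← Nat.cast_sum]
      omega
    rw [← hnk, ← Nat.cast_le (α := ℤ), Nat.cast_add, Nat.cast_sum, Nat.cast_sum]
    push_cast
    omega
  refine le_trans ?_ (Nat.mul_le_mul_left K hT)
  have h1 := Boundary.sum_card_own (b := b) m (by omega)
  rw [Finset.mul_sum]
  conv_lhs => rw [← h1]
  refine Finset.sum_le_sum fun k _ => ?_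
  have hle : ∀ a ∈ (b.starts cuts k).filter fun a => a < m, nx a - a ≤ K := fun a ha =>
    ((hlen k a (Finset.mem_filter.1 ha).1).1 (Finset.mem_filter.1 ha).2).2
  have h2 : ((Finset.range m).filter fun j => b.own j = k ∧ j < B.length).card =
      ∑ a ∈ (b.starts cuts k).filter (fun a => a < m), (nx a - a) := by
    by_cases hmN : m < B.length
    · exact hs k m (by simp [cuts, hmN])
    · have h3 : m = B.length := by omega
      have h4 : ((b.starts cuts k).filter fun a => a < m) = b.starts cuts k :=
        Finset.filter_true_of_mem fun a ha => h3 ▸ (Boundary.mem_starts.1 ha).1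
      rw [h4, ← hn, h3]
      refine congrArg Finset.card (Finset.ext fun j => ?_)
      simp only [Finset.mem_filter, Finset.mem_range]
      tauto
  rw [h2, mul_comm, ← smul_eq_mul]
  exact Finset.sum_le_card_nsmul _ _ _ hle

end GSC

namespace GSC

variable {S : Type} {P : C6Presentation S}

/-- In a polygon one side of which lies on the periodic word, the length of this side is linearly
bounded by the number of nearby vertices on the other sides. -/
theorem Good.polygon {W : ℕ → S × Bool} {L K : ℕ} (hW : Good P W L K) {Z : Set P.Grp} :
    ∀ (n : ℕ) (q : Word S) (i m : ℕ) (h : P.Grp), q.length = n → P.PGeod 3 q →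
      P.elt (seg W i m ++ q) = 1 → (∀ j ≤ m, h * P.elt (seg W i j) ∈ Z) →
      m ≤ 21 * K * nearCount P Z (6 * K) (h * P.elt (seg W i m)) q := by
  intro n
  induction n using Nat.strong_induction_on with
  | _ n ih =>
  intro q i m h hn hq h1 hZ
  by_cases hq0 : q = []
  · rw [hq0, List.append_nil] at h1
    have := congrArg List.length ((hW.geod m i).eq_nil h1)
    simp at this
    omega
  have hM : 1 ≤ nearCount P Z (6 * K) (h * P.elt (seg W i m)) q := by
    refine one_le_nearCount hq0 ?_
    rw [mul_assoc, ← P.elt_append, h1]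
    simpa [seg] using hZ 0 (Nat.zero_le m)
  rcases Nat.lt_or_ge K m with hKm | hKm
  swap
  · nlinarith [hW.K_pos]
  have hK := hW.K_pos
  have hql := List.length_pos_of_ne_nil hq0
  have hN : (seg W i m ++ q).length = m + q.length := by simp
  have hne : seg W i m ++ q ≠ [] := by simp [hq0]
  have hleft : ∀ j ≤ m, (seg W i m ++ q).take j = seg W i j := fun j hj => by
    rw [List.take_append_of_le_length (by simpa using hj), take_seg _ _ hj]
  have hright : ∀ j, m ≤ j → (seg W i m ++ q).take j = seg W i m ++ q.take (j - m) := fun j hj => by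
    rw [List.take_append, List.take_of_length_le (by simpa using hj), length_seg]
  have hsm : ∀ j ≤ m, P.elt (seg W i m) = P.elt (seg W i j) * P.elt (seg W (i + j) (m - j)) :=
    fun j hj => by rw [← P.elt_append, ← seg_add, Nat.add_sub_cancel' hj]
  by_cases hinj : ∀ i' j', i' < j' → j' < (seg W i m ++ q).length →
      P.elt ((seg W i m ++ q).take i') ≠ P.elt ((seg W i m ++ q).take j')
  · have hx : ∀ x, seg W i m ++ q ≠ [x, linv x] := by
      intro x hx
      have h2 := congrArg List.length hx
      rw [hN] at h2
      simp only [List.length_cons, List.length_nil] at h2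
      omega
    rcases P.mem_rels_or_boundary hne h1 hinj hx with hB | ⟨⟨b⟩⟩
    · have := (hW.small _ _ i m (P.isRel_of_mem hB hne (W 0)) (by omega) fun t ht => by
        rw [Nat.mod_eq_of_lt (by omega), List.getD_append _ _ _ _ (by simpa using ht)]
        simp [seg, ht]).2
      omega
    · have := hW.polygon_of_boundary hq (by omega) hZ b
      nlinarith
  · push Not at hinj
    obtain ⟨i', j', hij, hj, heq⟩ := hinj
    rw [hN] at hj
    rcases Nat.lt_or_ge m j' with hmj | hmj
    · rcases Nat.lt_or_ge i' m with him | him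
      · rw [hleft _ him.le, hright _ hmj.le, P.elt_append, hsm i' him.le, mul_assoc,
          left_eq_mul, ← P.elt_append] at heq
        have hs := List.take_append_drop (j' - m) q
        have e2 : P.elt (seg W i i' ++ q.drop (j' - m)) = 1 := by
          rw [← hs, P.elt_append, P.elt_append, hsm i' him.le] at h1
          rw [P.elt_append] at heq
          rw [P.elt_append, ← h1, ← mul_assoc, mul_assoc (P.elt (seg W i i')), heq, mul_one]
        have b1 := ih (q.take (j' - m)).length (by simp; omega) _ (i + i') (m - i')
          (h * P.elt (seg W i i')) rfl (C6Presentation.PGeod.left (by rw [hs]; exact hq)) heq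
          fun j hj => by
            rw [mul_assoc, ← P.elt_append, ← seg_add]
            exact hZ _ (by omega)
        have b2 := ih (q.drop (j' - m)).length (by simp; omega) _ i i' h rfl
          (C6Presentation.PGeod.right (by rw [hs]; exact hq)) e2 fun j hj => hZ j (by omega)
        have e3 : h * P.elt (seg W i i') * P.elt (seg W (i + i') (m - i')) =
            h * P.elt (seg W i m) := by rw [mul_assoc, ← hsm i' him.le]
        have e4 : h * P.elt (seg W i m) * P.elt (q.take (j' - m)) = h * P.elt (seg W i i') := by
          rw [← e3, mul_assoc, ← P.elt_append, heq, mul_one]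
        rw [e3] at b1
        conv_rhs => rw [← hs]
        rw [nearCount_append, e4]
        rw [mul_add]
        omega
      · rw [hright _ him, hright _ hmj.le, P.elt_append, P.elt_append, mul_right_inj] at heq
        have h2 : q.take (j' - m) = q.take (i' - m) ++ (q.drop (i' - m)).take (j' - i') := by
          rw [show j' - m = (i' - m) + (j' - i') by omega, List.take_add]
        rw [h2, P.elt_append, left_eq_mul] at heq
        have h3 : q = q.take (i' - m) ++ (q.drop (i' - m)).take (j' - i') ++ q.drop (j' - m) := by
          rw [← h2, List.take_append_drop]
        set x := q.take (i' - m)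
        set y := (q.drop (i' - m)).take (j' - i') with hy
        set z := q.drop (j' - m)
        have hyl : y.length = j' - i' := by simp [hy]; omega
        have hql' := congrArg List.length h3
        simp only [List.length_append] at hql'
        have b := ih (x ++ z).length (by simp; omega) (x ++ z) i m h rfl
          (C6Presentation.PGeod.remove (h3 ▸ hq) fun hg => by
            rw [hg.eq_nil heq, List.length_nil] at hyl
            omega)
          (by rw [h3] at h1; simpa [P.elt_append, heq] using h1) hZ
        rw [h3, nearCount_append, nearCount_append, P.elt_append, heq, mul_one]
        rw [nearCount_append] at b
        refine b.trans (Nat.mul_le_mul_left _ ?_)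
        omega
    · rw [hleft _ (by omega), hleft _ hmj, ← Nat.add_sub_cancel' hij.le, seg_add, P.elt_append,
        left_eq_mul] at heq
      have := congrArg List.length ((hW.geod _ _).eq_nil heq)
      simp at this
      omega

end GSC

namespace GSC

variable {S : Type} {P : C6Presentation S}

namespace C6Presentation

theorem wordLength_le (P : C6Presentation S) (v : Word S) :
    wordLength P.gens (P.elt v) ≤ v.length := by
  refine Nat.sInf_le ⟨_, List.length_map _, ?_, rfl⟩
  intro x hx
  obtain ⟨⟨a, s⟩, -, rfl⟩ := List.mem_map.1 hx
  cases s
  · right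
    exact ⟨a, by simp⟩
  · left
    exact ⟨a, by simp⟩

theorem exists_length_eq (P : C6Presentation S) (g : P.Grp) :
    ∃ v : Word S, P.elt v = g ∧ v.length = wordLength P.gens g := by
  have hne : {n : ℕ | ∃ l : List P.Grp, l.length = n ∧ (∀ x ∈ l, x ∈ P.gens ∨ x⁻¹ ∈ P.gens) ∧
      l.prod = g}.Nonempty := by
    obtain ⟨v, hv⟩ := P.elt_surjective g
    refine ⟨_, _, rfl, ?_, hv⟩
    intro x hx
    obtain ⟨⟨a, s⟩, -, rfl⟩ := List.mem_map.1 hx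
    cases s
    · right
      exact ⟨a, by simp⟩
    · left
      exact ⟨a, by simp⟩
  obtain ⟨l, hl, hx, hg⟩ := Nat.sInf_mem hne
  change ∃ v : Word S, P.elt v = g ∧ v.length = sInf _
  rw [← hl, ← hg]
  clear hl hg hne
  induction l with
  | nil => exact ⟨[], by simp, rfl⟩
  | cons x l ih =>
    obtain ⟨v, hv, hvl⟩ := ih fun y hy => hx y (List.mem_cons_of_mem _ hy)
    rcases hx x (List.mem_cons_self ..) with ⟨a, ha⟩ | ⟨a, ha⟩
    · refine ⟨(a, true) :: v, ?_, by simp [hvl]⟩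
      rw [P.elt_cons, hv, List.prod_cons, ← ha]
      simp [C6Presentation.elt]
    · refine ⟨(a, false) :: v, ?_, by simp [hvl]⟩
      rw [P.elt_cons, hv, List.prod_cons, ← inv_inv x, ← ha]
      simp [C6Presentation.elt]

end C6Presentation

theorem nearCount_le_of_start {Z : Set P.Grp} {c : ℕ} {h : P.Grp} {q : Word S} {C : ℕ}
    (H : ∀ t < q.length, Near P Z c (h * P.elt (q.take (t + 1))) → t + 1 ≤ C) :
    nearCount P Z c h q ≤ C + 1 := by
  classical
  rw [nearCount, ← Finset.card_filter]
  refine le_trans (Finset.card_le_card (t := Finset.range (C + 1)) fun t ht => ?_) (by simp)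
  simp only [Finset.mem_filter, Finset.mem_range] at ht ⊢
  have := H t ht.1 ht.2
  omega

theorem nearCount_le_of_end {Z : Set P.Grp} {c : ℕ} {h : P.Grp} {q : Word S} {C : ℕ}
    (H : ∀ t < q.length, Near P Z c (h * P.elt (q.take (t + 1))) → q.length ≤ t + 1 + C) :
    nearCount P Z c h q ≤ C + 1 := by
  classical
  rw [nearCount, ← Finset.card_filter]
  refine le_trans (Finset.card_le_card (t := Finset.Ico (q.length - (C + 1)) q.length)
    fun t ht => ?_) (by simp; omega)
  simp only [Finset.mem_filter, Finset.mem_range, Finset.mem_Ico] at ht ⊢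
  have := H t ht.1 ht.2
  omega

/-- A path from `x` no longer than the distance from `x` to `Y` is near `Y` only close to its
end. -/
theorem nearCount_le_of_closest {Y Z : Set P.Grp} {c d : ℕ} {x : P.Grp} {w : Word S}
    (hZ : ∀ z ∈ Z, Near P Y d z)
    (hw : ∀ y ∈ Y, ∀ v : Word S, P.elt v = x⁻¹ * y → w.length ≤ v.length) :
    nearCount P Z c x w ≤ c + d + 1 ∧ nearCount P Z c (x * P.elt w) (wordInv w) ≤ c + d + 1 := by
  have key : ∀ p s, w = p ++ s → Near P Z c (x * P.elt p) → w.length ≤ p.length + (c + d) := by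
    rintro p s rfl ⟨z, hz, v, hv, hvc⟩
    obtain ⟨y, hy, u, hu, hud⟩ := hZ z hz
    refine (hw y hy (p ++ wordInv v ++ wordInv u) ?_).trans ?_
    · rw [P.elt_append, P.elt_append, P.elt_wordInv, P.elt_wordInv, hu, hv]
      group
    · simp only [List.length_append, length_wordInv]
      omega
  constructor
  · refine nearCount_le_of_end fun t ht hn => ?_
    have := key _ _ (List.take_append_drop (t + 1) w).symm hn
    rw [List.length_take] at this
    omega
  · refine nearCount_le_of_start fun t ht hn => ?_
    have h1 : w = wordInv ((wordInv w).drop (t + 1)) ++ wordInv ((wordInv w).take (t + 1)) := by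
      rw [← wordInv_append, List.take_append_drop, wordInv_wordInv]
    have h2 := congrArg P.elt h1
    rw [P.elt_append, P.elt_wordInv ((wordInv w).take (t + 1))] at h2
    have := key _ _ h1 (by
      convert hn using 1
      rw [h2]
      group)
    simp only [length_wordInv, List.length_drop] at this ht
    omega

namespace Good

variable {W : ℕ → S × Bool} {L K : ℕ}

theorem elt_seg_mul (hW : Good P W L K) (k r : ℕ) :
    P.elt (seg W 0 (k * L + r)) = P.elt (seg W 0 L) ^ k * P.elt (seg W 0 r) := by
  induction k with
  | zero => simp
  | succ k ih =>
    have h1 : seg W L (k * L + r) = seg W 0 (k * L + r) := by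
      refine List.map_congr_left fun t _ => ?_
      rw [zero_add, add_comm, hW.periodic]
    rw [show (k + 1) * L + r = L + (k * L + r) by ring, seg_add, P.elt_append, zero_add, h1, ih,
      pow_succ', mul_assoc]

theorem not_isOfFinOrder (hW : Good P W L K) : ¬ IsOfFinOrder (P.elt (seg W 0 L)) := by
  rw [isOfFinOrder_iff_pow_eq_one]
  rintro ⟨n, hn, h⟩
  have h1 := hW.elt_seg_mul n 0
  rw [h] at h1
  have h2 := congrArg List.length ((hW.geod _ _).eq_nil (h1.trans (by simp [seg])))
  have := Nat.mul_pos hn hW.period_pos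
  rw [length_seg, List.length_nil] at h2
  omega

theorem elt_seg_zpow (hW : Good P W L K) {a b : ℤ} (hab : a ≤ b) :
    P.elt (seg W 0 ((b - a).natAbs * L)) = (P.elt (seg W 0 L) ^ a)⁻¹ * P.elt (seg W 0 L) ^ b := by
  rw [← add_zero ((b - a).natAbs * L), hW.elt_seg_mul, ← zpow_neg, ← zpow_add, ← zpow_natCast]
  simp only [seg, List.range_zero, List.map_nil, P.elt_nil, mul_one]
  congr 1
  omega

theorem near_seg (hW : Good P W L K) (a : ℤ) (j : ℕ) :
    Near P (Subgroup.zpowers (P.elt (seg W 0 L)) : Set P.Grp) L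
      (P.elt (seg W 0 L) ^ a * P.elt (seg W 0 j)) := by
  refine ⟨P.elt (seg W 0 L) ^ (a + (j / L : ℕ)), ⟨_, rfl⟩, seg W 0 (j % L), ?_, ?_⟩
  · have e := hW.elt_seg_mul (j / L) (j % L)
    rw [Nat.div_add_mod'] at e
    rw [e, zpow_add, zpow_natCast]
    group
  · rw [length_seg]
    exact (Nat.mod_lt _ hW.period_pos).le

/-- Projections to the axis of points no further from each other than from the axis are close. -/
theorem natAbs_sub_le (hW : Good P W L K) {x x' : P.Grp} {a b : ℤ} {u u' w : Word S}
    (hu : P.elt u = x⁻¹ * P.elt (seg W 0 L) ^ a) (hu' : P.elt u' = x'⁻¹ * P.elt (seg W 0 L) ^ b)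
    (hw : P.elt w = x⁻¹ * x') (hwg : P.Geod w)
    (hY : ∀ y ∈ (Subgroup.zpowers (P.elt (seg W 0 L)) : Set P.Grp), ∀ v : Word S,
      P.elt v = x⁻¹ * y → u.length ≤ v.length ∧ w.length ≤ v.length)
    (hY' : ∀ y ∈ (Subgroup.zpowers (P.elt (seg W 0 L)) : Set P.Grp), ∀ v : Word S,
      P.elt v = x'⁻¹ * y → u'.length ≤ v.length) :
    (b - a).natAbs * L ≤ 21 * K * (3 * (6 * K + L + 1)) := by
  set g := P.elt (seg W 0 L) with hg
  have hug : P.Geod u := fun v hv => (hY _ ⟨a, rfl⟩ v (hv.trans hu)).1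
  have hug' : P.Geod u' := fun v hv => hY' _ ⟨b, rfl⟩ v (hv.trans hu')
  let Z : Set P.Grp := {z | Near P (Subgroup.zpowers g : Set P.Grp) L z}
  obtain ⟨c1, c2⟩ := nearCount_le_of_closest (Z := Z) (c := 6 * K) (fun z hz => hz)
    fun y hy v hv => (hY y hy v hv).1
  obtain ⟨c3, c4⟩ := nearCount_le_of_closest (Z := Z) (c := 6 * K) (fun z hz => hz)
    fun y hy v hv => (hY y hy v hv).2
  obtain ⟨c5, c6⟩ := nearCount_le_of_closest (Z := Z) (c := 6 * K) (fun z hz => hz) hY'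
  have hxu : x * P.elt u = g ^ a := by rw [hu]; group
  have hxu' : x' * P.elt u' = g ^ b := by rw [hu']; group
  have hxw : x * P.elt w = x' := by rw [hw]; group
  rw [hxu] at c2
  rw [hxu'] at c6
  rw [hxw] at c4
  rcases le_total a b with hab | hab
  · have hs := hW.elt_seg_zpow hab
    rw [← hg] at hs
    have := hW.polygon (Z := Z) _ (wordInv u' ++ (wordInv w ++ u)) 0 ((b - a).natAbs * L) (g ^ a)
      rfl ⟨_, _, rfl, hug'.inv, _, _, rfl, hwg.inv, u, [], by simp, hug, rfl⟩
      (by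
        simp only [P.elt_append, P.elt_wordInv, hs, hu, hu', hw]
        group)
      fun j _ => hW.near_seg a j
    refine this.trans (Nat.mul_le_mul_left _ ?_)
    rw [nearCount_append, nearCount_append, hs, mul_inv_cancel_left]
    have e1 : g ^ b * P.elt (wordInv u') = x' := by rw [P.elt_wordInv, ← hxu']; group
    have e2 : x' * P.elt (wordInv w) = x := by rw [P.elt_wordInv, ← hxw]; group
    rw [e1, e2]
    omega
  · have hs := hW.elt_seg_zpow hab
    rw [← hg] at hs
    rw [show (b - a).natAbs = (a - b).natAbs by omega]
    have := hW.polygon (Z := Z) _ (wordInv u ++ (w ++ u')) 0 ((a - b).natAbs * L) (g ^ b)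
      rfl ⟨_, _, rfl, hug.inv, _, _, rfl, hwg, u', [], by simp, hug', rfl⟩
      (by
        simp only [P.elt_append, P.elt_wordInv, hs, hu, hu', hw]
        group)
      fun j _ => hW.near_seg b j
    refine this.trans (Nat.mul_le_mul_left _ ?_)
    rw [nearCount_append, nearCount_append, hs, mul_inv_cancel_left]
    have e1 : g ^ a * P.elt (wordInv u) = x := by rw [P.elt_wordInv, ← hxu]; group
    rw [e1, hxw]
    omega

theorem stronglyContracting (hW : Good P W L K) :
    StronglyContracting P.gens (Subgroup.zpowers (P.elt (seg W 0 L)) : Set P.Grp) := by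
  set g := P.elt (seg W 0 L) with hg
  set Y : Set P.Grp := (Subgroup.zpowers g : Set P.Grp) with hYdef
  set C : ℕ := 21 * K * (3 * (6 * K + L + 1)) with hC
  refine ⟨(C : ℝ), ⟨monotone_id, monotone_const, Filter.eventually_ge_atTop 0,
    Filter.Eventually.of_forall fun _ => Nat.cast_nonneg C, fun _ => le_rfl, fun M => ⟨M, le_rfl⟩,
    tendsto_const_nhds.div_atTop Filter.tendsto_id⟩, ?_⟩
  have hmin : ∀ x : P.Grp, ∀ y ∈ Y, setDist P.gens x Y ≤ wdist P.gens x y := fun x y hy =>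
    csInf_le ⟨0, by rintro _ ⟨z, -, rfl⟩; exact Nat.cast_nonneg _⟩ ⟨y, hy, rfl⟩
  have hdist : ∀ x : P.Grp, ∀ y ∈ Y, ∀ v : Word S, P.elt v = x⁻¹ * y →
      setDist P.gens x Y ≤ v.length := fun x y hy v hv =>
    (hmin x y hy).trans (by
      rw [wdist, ← hv]
      exact_mod_cast P.wordLength_le v)
  have hproj : ∀ x, ∀ y ∈ proj P.gens Y x, ∃ (a : ℤ) (u : Word S), y = g ^ a ∧
      P.elt u = x⁻¹ * y ∧ (u.length : ℝ) = setDist P.gens x Y := by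
    rintro x y ⟨⟨a, rfl⟩, hd⟩
    obtain ⟨u, hu, hul⟩ := P.exists_length_eq (x⁻¹ * g ^ a)
    exact ⟨a, u, rfl, hu, by rw [← hd, wdist, hul]⟩
  have main : ∀ x x', wdist P.gens x x' ≤ setDist P.gens x Y → ∀ y ∈ proj P.gens Y x,
      ∀ y' ∈ proj P.gens Y x', wdist P.gens y y' ≤ C ∧ wdist P.gens y' y ≤ C := by
    intro x x' hxx y hy y' hy'
    obtain ⟨a, u, rfl, hu, hul⟩ := hproj x y hy
    obtain ⟨b, u', rfl, hu', hul'⟩ := hproj x' y' hy'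
    obtain ⟨w, hw, hwl⟩ := P.exists_length_eq (x⁻¹ * x')
    have hwg : P.Geod w := fun v hv => by
      rw [hwl, ← hw, ← hv]
      exact P.wordLength_le v
    have h := hW.natAbs_sub_le hu hu' hw hwg
      (fun y1 hy1 v hv => ⟨by
        have := hdist x y1 hy1 v hv
        rw [← hul] at this
        exact_mod_cast this, by
        have := hxx.trans (hdist x y1 hy1 v hv)
        rw [wdist, ← hwl] at this
        exact_mod_cast this⟩)
      fun y1 hy1 v hv => by
        have := hdist x' y1 hy1 v hv
        rw [← hul'] at this
        exact_mod_cast this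
    have h1 : ∀ z : P.Grp, ∀ v : Word S, P.elt v = z → v.length ≤ C →
        (wordLength P.gens z : ℝ) ≤ C := by
      rintro z v rfl hv
      exact_mod_cast (P.wordLength_le v).trans hv
    rcases le_total a b with hab | hab
    · have hs := hW.elt_seg_zpow hab
      rw [← hg] at hs
      refine ⟨h1 _ _ hs (by rwa [length_seg]),
        h1 _ (wordInv (seg W 0 ((b - a).natAbs * L))) ?_ (by rwa [length_wordInv, length_seg])⟩
      rw [P.elt_wordInv, hs, mul_inv_rev, inv_inv]
    · have hs := hW.elt_seg_zpow hab
      rw [← hg] at hs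
      rw [show (b - a).natAbs = (a - b).natAbs by omega] at h
      refine ⟨h1 _ (wordInv (seg W 0 ((a - b).natAbs * L))) ?_
        (by rwa [length_wordInv, length_seg]), h1 _ _ hs (by rwa [length_seg])⟩
      rw [P.elt_wordInv, hs, mul_inv_rev, inv_inv]
  have hself : ∀ x, wdist P.gens x x ≤ setDist P.gens x Y := by
    intro x
    have h1 : wdist P.gens x x = 0 := by
      have := P.wordLength_le []
      rw [wdist, inv_mul_cancel, ← P.elt_nil]
      simpa using this
    rw [h1]
    exact Real.sInf_nonneg (by rintro _ ⟨z, -, rfl⟩; exact Nat.cast_nonneg _)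
  rintro x - x' - hxx y (hy | hy) y' (hy' | hy')
  · exact (main x x (hself x) y hy y' hy').1
  · exact (main x x' hxx y hy y' hy').1
  · exact (main x x' hxx y' hy' y hy).2
  · exact (main x' x' (hself x') y hy y' hy').1

end Good

end GSC

namespace GSC

section Axis

variable {S : Type} {P : C6Presentation S}

/-- The infinite path through a chain of subwords `F z 1 … F z (ℓ z)` of relators `F z`, each at
least a sixth of its relator, is an axis provided that no two consecutive subwords cancel and
neither relator extends across the junction. -/
theorem exists_good_of_blocks {σ : Type} [Finite σ] [Nonempty σ] (N l : σ → ℕ)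
    (F : σ → ℕ → S × Bool) (next : σ → σ) (hF : ∀ z, P.IsRel (N z) (F z)) (hl : ∀ z, 1 ≤ l z)
    (hlN : ∀ z, l z ≤ N z) (hN : ∀ z, N z ≤ 6 * l z) (hN' : ∀ z, 6 * l z ≤ 2 * N z + 3)
    (h1 : ∀ z, F (next z) 1 ≠ F z (l z + 1)) (h2 : ∀ z, F (next z) 1 ≠ linv (F z (l z)))
    (h3 : ∀ z, F z (l z) ≠ F (next z) 0) : ∃ W L K, Good P W L K := by
  obtain ⟨M, hM⟩ : ∃ M, ∀ z, l z ≤ M := by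
    obtain ⟨M, hM⟩ := (Set.finite_range l).bddAbove
    exact ⟨M, fun z => hM ⟨z, rfl⟩⟩
  let succ : (Σ z, Fin (l z)) → Σ z, Fin (l z) := fun s =>
    if h : s.2.1 + 1 < l s.1 then ⟨s.1, s.2.1 + 1, h⟩ else ⟨next s.1, 0, hl _⟩
  let s₀ : Σ z, Fin (l z) := ⟨Classical.arbitrary σ, 0, hl _⟩
  obtain ⟨p, q, hpq, heq⟩ : ∃ p q, p < q ∧ succ^[p] s₀ = succ^[q] s₀ := by
    obtain ⟨p, q, hne, h⟩ := Finite.exists_ne_map_eq_of_infinite fun i => succ^[i] s₀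
    rcases lt_or_gt_of_ne hne with hlt | hlt
    · exact ⟨p, q, hlt, h⟩
    · exact ⟨q, p, hlt, h.symm⟩
  let st : ℕ → Σ z, Fin (l z) := fun i => succ^[p + i] s₀
  have hst : ∀ i, st (i + 1) = succ (st i) := fun i => Function.iterate_succ_apply' succ (p + i) s₀
  let W : ℕ → S × Bool := fun i => F (st i).1 (1 + (st i).2.1)
  have hstay : ∀ i k, (st i).2.1 + k < l (st i).1 →
      (st (i + k)).1 = (st i).1 ∧ (st (i + k)).2.1 = (st i).2.1 + k := by
    intro i k
    induction k with
    | zero => simp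
    | succ k ih =>
      intro h
      obtain ⟨e1, e2⟩ := ih (by omega)
      rw [← add_assoc, hst]
      simp only [succ]
      rw [dif_pos (by have := congrArg l e1; omega)]
      exact ⟨e1, by simp only [e2]; omega⟩
  have hjump : ∀ i, (st (i + (l (st i).1 - (st i).2.1))).1 = next (st i).1 ∧
      (st (i + (l (st i).1 - (st i).2.1))).2.1 = 0 := by
    intro i
    have hlt := (st i).2.2
    obtain ⟨e1, e2⟩ := hstay i (l (st i).1 - (st i).2.1 - 1) (by omega)
    rw [show i + (l (st i).1 - (st i).2.1) = i + (l (st i).1 - (st i).2.1 - 1) + 1 by omega, hst]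
    simp only [succ]
    rw [dif_neg (by have := congrArg l e1; omega)]
    exact ⟨by simp only [e1], rfl⟩
  have hWstay : ∀ i k, (st i).2.1 + k < l (st i).1 →
      W (i + k) = F (st i).1 (1 + (st i).2.1 + k) := by
    intro i k h
    obtain ⟨e1, e2⟩ := hstay i k h
    simp only [W]
    rw [e2, e1, add_assoc]
  have hWjump : ∀ i k, k < l (next (st i).1) →
      W (i + (l (st i).1 - (st i).2.1) + k) = F (next (st i).1) (1 + k) := by
    intro i k h
    obtain ⟨e1, e2⟩ := hjump i
    rw [hWstay _ _ (by have := congrArg l e1; omega), e2, e1, add_zero]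
  refine ⟨W, q - p, 2 * M, by omega, fun i => ?_, ?_, fun i => ?_, fun n f i m hf hm hW => ?_⟩
  · have : st (i + (q - p)) = st i := by
      simp only [st]
      rw [show p + (i + (q - p)) = i + q by omega, show p + i = i + p by omega,
        Function.iterate_add_apply, Function.iterate_add_apply, heq]
    exact congrArg (fun s : Σ z, Fin (l z) => F s.1 (1 + s.2.1)) this
  · have := hM s₀.1
    have := hl s₀.1
    omega
  · have hlt := (st i).2.2
    by_cases h : (st i).2.1 + 1 < l (st i).1
    · rw [hWstay i 1 h]
      exact (hF _).succ_ne _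
    · have h4 := hWjump i 0 (hl _)
      have h5 := hWstay i 0 (by omega)
      rw [show l (st i).1 - (st i).2.1 = 1 by omega] at h4
      rw [show 1 + (st i).2.1 + 0 = l (st i).1 by omega] at h5
      rw [add_zero] at h4 h5
      rw [h4, h5]
      exact h2 _
  · obtain ⟨z, o, hlt, hs, hj⟩ : ∃ z o, o < l z ∧ (∀ k, o + k < l z → W (i + k) = F z (1 + o + k)) ∧
        ∀ k < l (next z), W (i + (l z - o) + k) = F (next z) (1 + k) :=
      ⟨_, _, (st i).2.2, hWstay i, hWjump i⟩
    have b1 := hlN z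
    have b2 := hN z
    have b3 := hN' z
    have b4 := hlN (next z)
    have b5 := hN (next z)
    have c1 := hM z
    have c2 := hM (next z)
    rcases Nat.lt_or_ge (l z - o) m with hd | hd
    · have d1 : 6 * (l z - o) < n := by
        by_contra hc
        obtain ⟨-, h4⟩ := hf.heavy_at (a := 0) (b := 1 + o) (hF z) (m := l z - o) (by omega)
          (by omega) (by omega) fun t ht => by
            rw [zero_add, hW t (by omega), hs t (by omega)]
        have h5 := h4 (l z - o)
        rw [zero_add, hW _ hd, show 1 + o + (l z - o) = l z + 1 by omega] at h5
        have h6 := hj 0 (hl _)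
        rw [add_zero, add_zero, h5] at h6
        exact h1 z h6.symm
      have d2 : ∀ k, k ≤ m - (l z - o) → k ≤ l (next z) → 6 * k < n ∧ 6 * k < N (next z) := by
        intro k hk hk'
        have h4 : ∀ t < k, f (l z - o + t) = F (next z) (1 + t) := fun t ht => by
          rw [hW _ (by omega), ← add_assoc, hj t (by omega)]
        by_contra hc
        have h5 : n = N (next z) ∧ ∀ t, f (l z - o + t) = F (next z) (1 + t) := by
          rcases Nat.lt_or_ge (6 * k) n with h6 | h6
          · have h7 := (hF (next z)).heavy_at hf (m := k) (a := 1) (b := l z - o) (by omega)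
              (by omega) (by omega) fun t ht => (h4 t ht).symm
            exact ⟨h7.1.symm, fun t => (h7.2 t).symm⟩
          · exact hf.heavy_at (hF _) (by omega) (by omega) h6 h4
        have h6 := h5.2 (n - 1)
        rw [show l z - o + (n - 1) = l z - o - 1 + n by omega, hf.2.2, hW _ (by omega),
          hs _ (by omega), show 1 + (n - 1) = 0 + N (next z) by omega, (hF _).2.2,
          show 1 + o + (l z - o - 1) = l z by omega] at h6
        exact h3 z h6
      have d3 := d2 (min (m - (l z - o)) (l (next z))) (by omega) (by omega)
      omega
    · refine ⟨?_, by omega⟩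
      rcases Nat.lt_or_ge (6 * m) n with h6 | h6
      · omega
      · obtain ⟨rfl, -⟩ := hf.heavy_at (a := 0) (b := 1 + o) (hF z) hm (by omega) h6 fun t ht => by
          rw [zero_add, hW t ht, hs t (by omega)]
        omega

/-- The letter `y` occurs twice in a row in a relator. -/
def C6Presentation.IsDouble (P : C6Presentation S) (y : S × Bool) : Prop :=
  ∃ n f, 2 ≤ n ∧ P.IsRel n f ∧ f 0 = y ∧ f 1 = y

theorem C6Presentation.IsDouble.linv {y : S × Bool} (h : P.IsDouble y) : P.IsDouble (linv y) := by
  obtain ⟨n, f, hn, hf, h0, h1⟩ := h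
  refine ⟨n, _, hn, hf.inv.shift (n - 2), ?_, ?_⟩
  · rw [add_zero, Nat.mod_eq_of_lt (by omega), show n - 1 - (n - 2) = 1 by omega, h1]
  · rw [Nat.mod_eq_of_lt (by omega), show n - 1 - (n - 2 + 1) = 0 by omega, h0]

theorem exists_good_of_isDouble [Finite S] {a b : S} (hab : a ≠ b) (ha : P.IsDouble (a, true))
    (hb : P.IsDouble (b, true)) : ∃ W L K, Good P W L K := by
  have hd : ∀ s, P.IsDouble (a, s) ∧ P.IsDouble (b, s) := by
    rintro (_ | _)
    · exact ⟨ha.linv, hb.linv⟩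
    · exact ⟨ha, hb⟩
  let σ := {y : S × Bool // P.IsDouble y}
  have : Nonempty σ := ⟨⟨_, ha⟩⟩
  choose N F hN hF hF0 hF1 using fun z : σ => z.2
  let l : σ → ℕ := fun z => (N z + 5) / 6
  have hnext : ∀ z : σ, ∃ y : σ, y.1 ≠ F z (l z + 1) ∧ y.1 ≠ linv (F z (l z)) ∧ F z (l z) ≠ y.1 := by
    intro z
    obtain ⟨c, hc, hcd⟩ : ∃ c, c ≠ (F z (l z)).1 ∧ ∀ s, P.IsDouble (c, s) := by
      by_cases h : a = (F z (l z)).1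
      · exact ⟨b, fun h' => hab (h.trans h'.symm), fun s => (hd s).2⟩
      · exact ⟨a, h, fun s => (hd s).1⟩
    obtain ⟨s, hs⟩ : ∃ s, (c, s) ≠ F z (l z + 1) := by
      by_cases h : (c, true) = F z (l z + 1)
      · exact ⟨false, fun h' => by simpa using h.trans h'.symm⟩
      · exact ⟨true, h⟩
    exact ⟨⟨(c, s), hcd s⟩, hs, fun h => hc (congrArg Prod.fst h),
      fun h => hc (congrArg Prod.fst h).symm⟩
  choose next h1 h2 h3 using hnext
  have hl : ∀ z, l z = (N z + 5) / 6 := fun _ => rfl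
  refine exists_good_of_blocks N l F next hF ?_ ?_ ?_ ?_ (fun z => ?_) (fun z => ?_) fun z => ?_
  · intro z; have := hN z; have := hl z; omega
  · intro z; have := hN z; have := hl z; omega
  · intro z; have := hN z; have := hl z; omega
  · intro z; have := hN z; have := hl z; omega
  · rw [hF1]; exact h1 z
  · rw [hF1]; exact h2 z
  · rw [hF0]; exact h3 z

theorem good_const {y : S × Bool} (h1 : [y] ∉ P.rels) (h2 : ¬ P.IsDouble y) :
    Good P (fun _ => y) 1 1 := by
  refine ⟨le_rfl, fun _ => rfl, le_rfl, fun _ => (linv_ne y).symm, fun n f i m hf hm hW => ?_⟩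
  have hm1 : m ≤ 1 := by
    by_contra hc
    exact h2 ⟨n, f, by omega, hf, hW 0 (by omega), hW 1 (by omega)⟩
  have hn := hf.1
  rcases Nat.lt_or_ge n 2 with h | h
  · rcases Nat.eq_zero_or_pos m with rfl | h0
    · omega
    · obtain rfl : n = 1 := by omega
      have := hf.2.1
      rw [List.range_one, List.map_singleton, hW 0 h0] at this
      exact absurd this h1
  · omega

theorem C6Presentation.elt_singleton_true (a : S) : P.elt [(a, true)] = PresentedGroup.of a := by
  simp [C6Presentation.elt]

/-- If all other letters are relators, then a relator containing `a` twice in a row is a power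
of `a`. -/
theorem C6Presentation.IsDouble.isOfFinOrder {a : S} (h : P.IsDouble (a, true))
    (hT : ∀ b, b ≠ a → [(b, true)] ∈ P.rels) : IsOfFinOrder (PresentedGroup.of a : P.Grp) := by
  obtain ⟨n, f, hn, hf, h0, -⟩ := h
  have hT' : ∀ y : S × Bool, y.1 ≠ a → [y] ∈ P.rels := by
    rintro ⟨b, _ | _⟩ hb
    · exact P.inv_mem _ (hT b hb)
    · exact hT b hb
  have ha : ∀ t, (f t).1 = a := by
    intro t
    by_contra hc
    have h1 : P.IsRel 1 fun _ => f t := ⟨le_rfl, by simpa using hT' _ hc, fun _ => rfl⟩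
    have := (h1.heavy_at hf (m := 1) (a := 0) (b := t) le_rfl hf.1 (by omega) fun s hs => by
      rw [Nat.lt_one_iff.1 hs, add_zero]).1
    omega
  have hconst : ∀ t, f t = (a, true) := by
    intro t
    induction t with
    | zero => exact h0
    | succ t ih =>
      have h1 := hf.succ_ne t
      have h2 := ha (t + 1)
      rw [ih] at h1
      rcases hy : f (t + 1) with ⟨c, _ | _⟩
      · rw [hy] at h1 h2
        exact absurd (by rw [← h2]; rfl) h1
      · rw [hy] at h2
        rw [← h2]
  have h1 : ∀ k, P.elt ((List.range k).map f) = (PresentedGroup.of a : P.Grp) ^ k := by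
    intro k
    induction k with
    | zero => simp
    | succ k ih =>
      rw [List.range_succ, List.map_append, P.elt_append, ih, pow_succ, List.map_singleton, hconst,
        P.elt_singleton_true]
  exact isOfFinOrder_iff_pow_eq_one.2 ⟨n, hf.1, by rw [← h1, P.elt_rel hf.2.1]⟩

theorem C6Presentation.finite_of_mem_zpowers {g : P.Grp} (hg : IsOfFinOrder g)
    (h : ∀ a : S, (PresentedGroup.of a : P.Grp) ∈ Subgroup.zpowers g) : Finite P.Grp := by
  have htop : ∀ x, x ∈ (Subgroup.zpowers g : Set P.Grp) := by
    intro x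
    obtain ⟨w, rfl⟩ := P.elt_surjective x
    refine Subgroup.list_prod_mem _ fun y hy => ?_
    obtain ⟨c, -, rfl⟩ := List.mem_map.1 hy
    exact Subgroup.zpow_mem _ (h _) _
  exact Set.finite_univ_iff.1 ((finite_zpowers.2 hg).subset fun x _ => htop x)

theorem exists_good [Finite S] (hG : Infinite P.Grp) : ∃ W L K, Good P W L K := by
  by_contra hno
  have hA : ∀ a, [(a, true)] ∈ P.rels ∨ P.IsDouble (a, true) := by
    intro a
    by_contra! hc
    exact hno ⟨_, _, _, good_const hc.1 hc.2⟩
  have hone : ∀ a, [(a, true)] ∈ P.rels → (PresentedGroup.of a : P.Grp) = 1 := fun a ha => by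
    rw [← P.elt_singleton_true, P.elt_rel ha]
  refine hG.not_finite ?_
  by_cases hT : ∀ a, [(a, true)] ∈ P.rels
  · exact C6Presentation.finite_of_mem_zpowers IsOfFinOrder.one fun a => by
      rw [hone a (hT a)]
      exact Subgroup.one_mem _
  · push Not at hT
    obtain ⟨a, ha⟩ := hT
    have hda := (hA a).resolve_left ha
    have hb : ∀ b, b ≠ a → [(b, true)] ∈ P.rels := fun b hba =>
      (hA b).resolve_right fun hdb => hno (exists_good_of_isDouble hba hdb hda)
    refine C6Presentation.finite_of_mem_zpowers (hda.isOfFinOrder hb) fun b => ?_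
    by_cases hba : b = a
    · rw [hba]
      exact Subgroup.mem_zpowers _
    · rw [hone b (hb b hba)]
      exact Subgroup.one_mem _

end Axis
end GSC

namespace GSC

/-- A classical C'(1/6) group over a finite alphabet that is infinite
contains an infinite-order element `g` with `⟨g⟩` strongly contracting in `Cay(G,S)`. -/
theorem statement11 {S : Type} [Finite S] (P : C6Presentation S)
    (hG : Infinite P.Grp) :
    ∃ g : P.Grp, ¬ IsOfFinOrder g ∧
      StronglyContracting P.gens ((Subgroup.zpowers g : Subgroup P.Grp) : Set P.Grp) := by
  obtain ⟨W, L, K, hW⟩ := exists_good (P := P) hG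
  exact ⟨_, hW.not_isOfFinOrder, hW.stronglyContracting⟩

end GSC
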